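/- arXiv:math/0502211 — 2 statements merged into one kernel-verified Lean document; each statement's English description precedes it below -/
import Mathlib

section
/- Let D be a separable, unital, strongly self-absorbing, K₁-injective C*-algebra, let A be a separable D-stable C*-algebra, and let J ⊲ A be a closed two-sided ideal. Then both J and the quotient A/J are D-stable. -/
open scoped MultiplierAlgebra TensorProduct
open Filter Topology

noncomputable section

universe u v w x

/-- Approximate unitary equivalence of two maps `φ ψ : A → B`, witnessed by a sequence of
unitaries in the multiplier algebra `𝓜(ℂ, B)` (in which `B` embeds canonically). -/
def ApproxUnitaryEquiv {A : Type u} {B : Type v} [NonUnitalCStarAlgebra B]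
    (φ ψ : A → B) : Prop :=
  ∃ v : ℕ → 𝓜(ℂ, B), (∀ n, v n ∈ unitary 𝓜(ℂ, B)) ∧
    ∀ a : A, Tendsto
      (fun n => ‖star (v n) * (φ a : 𝓜(ℂ, B)) * v n - (ψ a : 𝓜(ℂ, B))‖)
      atTop (𝓝 (0 : ℝ))

/-- Data exhibiting `T` as a C*-tensor product of `A` and `B`: a bilinear, multiplicative,
star-preserving, cross-normed map `A × B → T` with dense span. -/
structure CStarTensor (A : Type u) (B : Type v) (T : Type w) [NonUnitalCStarAlgebra A]
    [NonUnitalCStarAlgebra B] [NonUnitalCStarAlgebra T] where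
  tmul : A → B → T
  add_left : ∀ a a' b, tmul (a + a') b = tmul a b + tmul a' b
  add_right : ∀ a b b', tmul a (b + b') = tmul a b + tmul a b'
  smul_left : ∀ (c : ℂ) a b, tmul (c • a) b = c • tmul a b
  smul_right : ∀ (c : ℂ) a b, tmul a (c • b) = c • tmul a b
  mul_tmul : ∀ a a' b b', tmul a b * tmul a' b' = tmul (a * a') (b * b')
  star_tmul : ∀ a b, star (tmul a b) = tmul (star a) (star b)
  norm_tmul : ∀ a b, ‖tmul a b‖ = ‖a‖ * ‖b‖
  dense_span : Dense ((Submodule.span ℂ {t : T | ∃ a b, tmul a b = t} : Submodule ℂ T) : Set T)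

/-- Data exhibiting `T` as *the minimal (spatial) tensor product* of `A` and `B`: a C*-tensor
product which is dominated by every other C*-tensor product of `A` and `B` (i.e., it carries
the smallest C*-norm). -/
structure MinTensor (A : Type u) (B : Type v) (T : Type w) [NonUnitalCStarAlgebra A]
    [NonUnitalCStarAlgebra B] [NonUnitalCStarAlgebra T] extends CStarTensor A B T where
  minimal : ∀ (T' : Type (max u v)) [NonUnitalCStarAlgebra T'] (h : CStarTensor A B T'),
    ∃ π : T' →⋆ₙₐ[ℂ] T, ∀ a b, π (h.tmul a b) = tmul a b

/-- The first-factor unital embedding `d ↦ d ⊗ 1`. -/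
def MinTensor.fst {D : Type u} {E : Type v} {T : Type w} [CStarAlgebra D] [CStarAlgebra E]
    [CStarAlgebra T] (h : MinTensor D E T) : D → T := fun d => h.tmul d 1

/-- The second-factor unital embedding `d ↦ 1 ⊗ d`. -/
def MinTensor.snd {D : Type u} {E : Type v} {T : Type w} [CStarAlgebra D] [CStarAlgebra E]
    [CStarAlgebra T] (h : MinTensor D E T) : E → T := fun d => h.tmul 1 d

/-- A unital C*-algebra `D` has *approximately inner half flip* (with respect to a
realization `T` of the minimal tensor product `D ⊗ D`) if the two factor embeddings
`id_D ⊗ 1_D` and `1_D ⊗ id_D` of `D` into `D ⊗ D` are approximately unitarily equivalent. -/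
def HasApproxInnerHalfFlip {D : Type u} {T : Type w} [CStarAlgebra D] [CStarAlgebra T]
    (h : MinTensor D D T) : Prop :=
  ApproxUnitaryEquiv h.fst h.snd

/-- A unital C*-algebra `D` has *approximately inner flip* (with respect to a realization
`T` of `D ⊗ D`) if the flip automorphism `σ_D : a ⊗ b ↦ b ⊗ a` of `D ⊗ D` is approximately
unitarily equivalent to the identity map. -/
def HasApproxInnerFlip {D : Type u} {T : Type w} [CStarAlgebra D] [CStarAlgebra T]
    (h : MinTensor D D T) : Prop :=
  ∃ σ : T ≃⋆ₐ[ℂ] T, (∀ a b, σ (h.tmul a b) = h.tmul b a) ∧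
    ApproxUnitaryEquiv (⇑σ) (id : T → T)

/-- A unital C*-algebra `D ≇ ℂ` is *strongly self-absorbing* (with respect to a realization
`T` of the minimal tensor product `D ⊗ D`) if there is an isomorphism `φ : D → D ⊗ D` which
is approximately unitarily equivalent to `id_D ⊗ 1_D`. -/
def IsStronglySelfAbsorbing {D : Type u} {T : Type w} [CStarAlgebra D] [CStarAlgebra T]
    (h : MinTensor D D T) : Prop :=
  IsEmpty (D ≃⋆ₐ[ℂ] ℂ) ∧ ∃ φ : D ≃⋆ₐ[ℂ] T, ApproxUnitaryEquiv (⇑φ) h.fst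

/-- The image of `u` under the upper-left-corner stabilization `u ↦ diag(u, 1, …, 1)`
into `M_{n+1}(A)`. -/
def stabUnitary {A : Type u} [CStarAlgebra A] (n : ℕ) (u : A) :
    Matrix (Fin (n + 1)) (Fin (n + 1)) A :=
  Matrix.diagonal (fun i => if i = 0 then u else 1)

/-- A unitary `u` represents `0` in `K₁(A)`: some matrix stabilization `diag(u, 1, …, 1)`
is connected to the identity through the unitary group of a matrix algebra over `A`. -/
def RepresentsZeroInK1 {A : Type u} [CStarAlgebra A] (u : A) : Prop :=
  ∃ n : ℕ, ∃ h : stabUnitary n u ∈ unitary (Matrix (Fin (n + 1)) (Fin (n + 1)) A),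
    Joined (⟨stabUnitary n u, h⟩ : ↥(unitary (Matrix (Fin (n + 1)) (Fin (n + 1)) A))) 1

/-- A unital C*-algebra is `K₁`-injective if the canonical map `U(A)/U₀(A) → K₁(A)` is
injective, i.e. every unitary representing `0` in `K₁(A)` lies in the connected component
of the unit of `U(A)`. -/
def K1Injective (A : Type u) [CStarAlgebra A] : Prop :=
  ∀ u : ↥(unitary A), RepresentsZeroInK1 (u : A) → Joined u 1

/-- `w` is a norm limit of elements `y * x * z` with `‖y‖ ≤ 1` and `‖z‖ ≤ C`. -/
def ConjApprox {B : Type u} [NonUnitalCStarAlgebra B] (C : ℝ) (x w : B) : Prop :=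
  ∀ ε > 0, ∃ y z : B, ‖y‖ ≤ 1 ∧ ‖z‖ ≤ C ∧ ‖w - y * x * z‖ < ε

lemma exists_contractive_approximateUnit (B : Type u) [NonUnitalCStarAlgebra B] :
    ∃ l : Filter B, l.IsApproximateUnit ∧ ∀ᶠ e in l, ‖e‖ ≤ 1 := by
  let _ := CStarAlgebra.spectralOrder B
  have := CStarAlgebra.spectralOrderedRing B
  exact ⟨_, (CStarAlgebra.increasingApproximateUnit B).toIsApproximateUnit,
    (CStarAlgebra.increasingApproximateUnit B).eventually_norm⟩

lemma exists_norm_sub_mul_lt {B : Type u} [NonUnitalCStarAlgebra B] (x : B) {ε : ℝ}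
    (hε : 0 < ε) : ∃ e : B, ‖e‖ ≤ 1 ∧ ‖x - x * e‖ < ε ∧ ‖x - e * x * e‖ < ε := by
  obtain ⟨l, hl, hl1⟩ := exists_contractive_approximateUnit B
  have := hl.neBot
  have h1 : Tendsto (fun e => ‖x - x * e‖) l (𝓝 0) := by
    simpa using ((tendsto_const_nhds (x := x)).sub (hl.tendsto_mul_left x)).norm
  have h2 : Tendsto (fun e => ‖x - e * x‖) l (𝓝 0) := by
    simpa using ((tendsto_const_nhds (x := x)).sub (hl.tendsto_mul_right x)).norm
  obtain ⟨e, he, he1, he2⟩ := (hl1.and ((h1.eventually_lt_const (half_pos hε)).and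
    (h2.eventually_lt_const (half_pos hε)))).exists
  refine ⟨e, he, he1.trans (half_lt_self hε), ?_⟩
  calc ‖x - e * x * e‖ = ‖(x - e * x) + e * (x - x * e)‖ := by
        rw [mul_sub, mul_assoc]; abel_nf
    _ ≤ ‖x - e * x‖ + ‖e * (x - x * e)‖ := norm_add_le _ _
    _ ≤ ‖x - e * x‖ + 1 * ‖x - x * e‖ := by
        gcongr; exact (norm_mul_le _ _).trans (by gcongr)
    _ < ε := by linarith

namespace ConjApprox

variable {B : Type u} [NonUnitalCStarAlgebra B] {C : ℝ} {x w : B}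

lemma norm_mul_mul_le {y z : B} (hy : ‖y‖ ≤ 1) (hz : ‖z‖ ≤ C) (x : B) :
    ‖y * x * z‖ ≤ C * ‖x‖ := by
  calc ‖y * x * z‖ ≤ ‖y‖ * ‖x‖ * ‖z‖ :=
        (norm_mul_le _ _).trans (by gcongr; exact norm_mul_le _ _)
    _ ≤ 1 * ‖x‖ * C := by gcongr
    _ = C * ‖x‖ := by ring

lemma norm_le (h : ConjApprox C x w) : ‖w‖ ≤ C * ‖x‖ := by
  refine le_of_forall_pos_le_add fun ε hε => ?_
  obtain ⟨y, z, hy, hz, h⟩ := h ε hε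
  calc ‖w‖ = ‖y * x * z + (w - y * x * z)‖ := by congr 1; abel
    _ ≤ ‖y * x * z‖ + ‖w - y * x * z‖ := norm_add_le _ _
    _ ≤ C * ‖x‖ + ε := add_le_add (norm_mul_mul_le hy hz x) h.le

lemma map {E : Type v} [NonUnitalCStarAlgebra E] (κ : B →⋆ₙₐ[ℂ] E) (h : ConjApprox C x w) :
    ConjApprox C (κ x) (κ w) := by
  intro ε hε
  obtain ⟨y, z, hy, hz, h⟩ := h ε hε
  refine ⟨κ y, κ z, (NonUnitalStarAlgHom.norm_apply_le κ y).trans hy,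
    (NonUnitalStarAlgHom.norm_apply_le κ z).trans hz, ?_⟩
  rw [← map_mul, ← map_mul, ← map_sub]
  exact (NonUnitalStarAlgHom.norm_apply_le κ _).trans_lt h

lemma of_approx (h : ∀ ε > 0, ∃ x' w', ‖x - x'‖ < ε ∧ ‖w - w'‖ < ε ∧ ConjApprox C x' w') :
    ConjApprox C x w := by
  intro ε hε
  have hC : 0 ≤ C := by
    obtain ⟨x', w', -, -, h⟩ := h 1 one_pos
    obtain ⟨y, z, -, hz, -⟩ := h 1 one_pos
    exact (norm_nonneg z).trans hz
  have hδ : 0 < ε / (C + 3) := by positivity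
  obtain ⟨x', w', hx, hw, h⟩ := h _ hδ
  obtain ⟨y, z, hy, hz, h⟩ := h _ hδ
  refine ⟨y, z, hy, hz, ?_⟩
  calc ‖w - y * x * z‖ = ‖(w - w') + (w' - y * x' * z) - y * (x - x') * z‖ := by
        rw [mul_sub, sub_mul]; congr 1; abel
    _ ≤ ‖w - w'‖ + ‖w' - y * x' * z‖ + ‖y * (x - x') * z‖ :=
        (norm_sub_le _ _).trans (by gcongr; exact norm_add_le _ _)
    _ ≤ ε / (C + 3) + ε / (C + 3) + C * (ε / (C + 3)) := by
        gcongr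
        exact (norm_mul_mul_le hy hz _).trans (by gcongr)
    _ < ε / (C + 3) + ε / (C + 3) + ε / (C + 3) + C * (ε / (C + 3)) := by linarith
    _ = ε := by field_simp; ring

lemma of_tendsto_right {α : Type*} {l : Filter α} [l.NeBot] {f : α → B}
    (hf : Tendsto f l (𝓝 w)) (h : ∀ᶠ a in l, ConjApprox C x (f a)) : ConjApprox C x w := by
  refine of_approx fun ε hε => ?_
  have : Tendsto (fun a => ‖w - f a‖) l (𝓝 0) := by
    simpa using ((tendsto_const_nhds (x := w)).sub hf).norm
  obtain ⟨a, ha, hxa⟩ := ((this.eventually_lt_const hε).and h).exists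
  exact ⟨x, f a, by simpa using hε, ha, hxa⟩

lemma mem_of_isClosed (h : ConjApprox C x w) {S : Set B} (hS : IsClosed S)
    (hx : ∀ y z, y * x * z ∈ S) : w ∈ S := by
  refine hS.closure_subset (Metric.mem_closure_iff.2 fun ε hε => ?_)
  obtain ⟨y, z, -, -, h⟩ := h ε hε
  exact ⟨_, hx y z, by rwa [dist_eq_norm]⟩

/-- Approximate conjugacy inside an algebra restricts to ideals. -/
lemma of_ideal {J : Type v} [NonUnitalCStarAlgebra J] (ι : J →⋆ₙₐ[ℂ] B)
    (hι : Function.Injective ι)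
    (hideal : ∀ x ∈ Set.range ι, ∀ a : B, a * x ∈ Set.range ι ∧ x * a ∈ Set.range ι) {x w : J}
    (h : ConjApprox C (ι x) (ι w)) : ConjApprox C x w := by
  intro ε hε
  have hC : 0 ≤ C := by
    obtain ⟨y, z, -, hz, -⟩ := h 1 one_pos
    exact (norm_nonneg z).trans hz
  have hδ : 0 < ε / (C + 1) := by positivity
  obtain ⟨y, z, hy, hz, h⟩ := h _ hδ
  obtain ⟨e, he, -, hex⟩ := exists_norm_sub_mul_lt x hδ
  obtain ⟨y', hy'⟩ := (hideal (ι e) ⟨e, rfl⟩ y).1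
  obtain ⟨z', hz'⟩ := (hideal (ι e) ⟨e, rfl⟩ z).2
  have hn := NonUnitalStarAlgHom.norm_map ι hι
  refine ⟨y', z', ?_, ?_, ?_⟩
  · rw [← hn, hy']
    calc ‖y * ι e‖ ≤ ‖y‖ * ‖ι e‖ := norm_mul_le _ _
      _ ≤ 1 * 1 := by rw [hn]; gcongr
      _ = 1 := one_mul 1
  · rw [← hn, hz']
    calc ‖ι e * z‖ ≤ ‖ι e‖ * ‖z‖ := norm_mul_le _ _
      _ ≤ 1 * C := by rw [hn]; gcongr
      _ = C := one_mul C
  · rw [← hn, map_sub, map_mul, map_mul, hy', hz']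
    calc ‖ι w - y * ι e * ι x * (ι e * z)‖
        = ‖(ι w - y * ι x * z) + y * (ι (x - e * x * e)) * z‖ := by
          rw [map_sub, map_mul, map_mul, mul_sub, sub_mul]; simp only [mul_assoc]; congr 1; abel
      _ ≤ ‖ι w - y * ι x * z‖ + ‖y * (ι (x - e * x * e)) * z‖ := norm_add_le _ _
      _ ≤ ‖ι w - y * ι x * z‖ + C * (ε / (C + 1)) := by
          gcongr
          exact (norm_mul_mul_le hy hz _).trans (by rw [hn]; gcongr)
      _ < ε / (C + 1) + C * (ε / (C + 1)) := by gcongr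
      _ = ε := by field_simp; ring

end ConjApprox

lemma mul_mem_of_mem_closure_span {B : Type u} [NonUnitalCStarAlgebra B] {G S : Set B}
    {K : Submodule ℂ B} (hK : IsClosed (K : Set B)) (h : ∀ g ∈ G, ∀ s ∈ S, g * s ∈ K) {y s : B}
    (hy : y ∈ closure (Submodule.span ℂ G : Set B))
    (hs : s ∈ closure (Submodule.span ℂ S : Set B)) : y * s ∈ K := by
  have h1 : ∀ g ∈ Submodule.span ℂ G, ∀ s ∈ S, g * s ∈ K := fun g hg s hs => by
    refine (Submodule.span_le (p := K.comap (LinearMap.mulRight ℂ s))).2 ?_ hg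
    exact fun g hg => h g hg s hs
  have h2 : ∀ g ∈ Submodule.span ℂ G, ∀ s ∈ Submodule.span ℂ S, g * s ∈ K :=
    fun g hg s hs => by
      refine (Submodule.span_le (p := K.comap (LinearMap.mulLeft ℂ g))).2 ?_ hs
      exact fun s hs => h1 g hg s hs
  have := map_mem_closure₂ continuous_mul hy hs h2
  rwa [hK.closure_eq] at this

/-- A bilinear, multiplicative, star-preserving map `B × D → B` with dense span such that
`b` and `b ⊗ 1` are approximately conjugate, via contractions, in both directions. -/
structure SelfTensor (B : Type u) (D : Type v) [NonUnitalCStarAlgebra B] [CStarAlgebra D] where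
  tmul : B → D → B
  add_left : ∀ a a' b, tmul (a + a') b = tmul a b + tmul a' b
  add_right : ∀ a b b', tmul a (b + b') = tmul a b + tmul a b'
  smul_left : ∀ (c : ℂ) a b, tmul (c • a) b = c • tmul a b
  smul_right : ∀ (c : ℂ) a b, tmul a (c • b) = c • tmul a b
  mul_tmul : ∀ a a' b b', tmul a b * tmul a' b' = tmul (a * a') (b * b')
  star_tmul : ∀ a b, star (tmul a b) = tmul (star a) (star b)
  norm_tmul_le : ∀ a b, ‖tmul a b‖ ≤ ‖a‖ * ‖b‖
  dense_span : Dense ((Submodule.span ℂ {t : B | ∃ a b, tmul a b = t} : Submodule ℂ B) : Set B)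
  conj_right : ∀ b, ConjApprox 1 b (tmul b 1)
  conj_left : ∀ b, ConjApprox 1 (tmul b 1) b

namespace SelfTensor

variable {B : Type u} {D : Type v} [NonUnitalCStarAlgebra B] [CStarAlgebra D]

lemma norm_tmul_one (T : SelfTensor B D) (b : B) : ‖T.tmul b 1‖ = ‖b‖ :=
  le_antisymm (by simpa using (T.conj_right b).norm_le) (by simpa using (T.conj_left b).norm_le)

lemma sub_left (T : SelfTensor B D) (a a' : B) (d : D) :
    T.tmul (a - a') d = T.tmul a d - T.tmul a' d := by
  rw [sub_eq_add_neg, T.add_left, ← neg_one_smul ℂ a', T.smul_left, neg_one_smul, sub_eq_add_neg]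

lemma zero_right (T : SelfTensor B D) (a : B) : T.tmul a 0 = 0 := by
  simpa using T.smul_right 0 a 0

lemma tmul_mul_right (T : SelfTensor B D) (a e : B) (d : D) :
    T.tmul (a * e) d = T.tmul a 1 * T.tmul e d := by
  rw [T.mul_tmul, one_mul]

lemma norm_map_tmul_le (T : SelfTensor B D) {E : Type w} [NonUnitalCStarAlgebra E]
    (κ : B →⋆ₙₐ[ℂ] E) (b : B) (d : D) : ‖κ (T.tmul b d)‖ ≤ ‖κ b‖ * ‖d‖ := by
  refine le_of_forall_pos_le_add fun ε hε => ?_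
  have hδ : 0 < ε / (‖d‖ + 1) := by positivity
  obtain ⟨e, he, hbe, -⟩ := exists_norm_sub_mul_lt b hδ
  have h1 : ‖κ (T.tmul b 1)‖ ≤ ‖κ b‖ := by simpa using ((T.conj_right b).map κ).norm_le
  calc ‖κ (T.tmul b d)‖
      = ‖κ (T.tmul b 1) * κ (T.tmul e d) + κ (T.tmul (b - b * e) d)‖ := by
        rw [T.sub_left, T.tmul_mul_right, map_sub, map_mul]; congr 1; abel
    _ ≤ ‖κ (T.tmul b 1) * κ (T.tmul e d)‖ + ‖κ (T.tmul (b - b * e) d)‖ := norm_add_le _ _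
    _ ≤ ‖κ b‖ * (1 * ‖d‖) + (ε / (‖d‖ + 1)) * ‖d‖ := by
        gcongr
        · refine (norm_mul_le _ _).trans ?_
          gcongr
          refine (NonUnitalStarAlgHom.norm_apply_le κ _).trans ((T.norm_tmul_le _ _).trans ?_)
          gcongr
        · refine (NonUnitalStarAlgHom.norm_apply_le κ _).trans ((T.norm_tmul_le _ _).trans ?_)
          gcongr
    _ ≤ ‖κ b‖ * ‖d‖ + ε := by
        have : ε / (‖d‖ + 1) * ‖d‖ ≤ ε / (‖d‖ + 1) * (‖d‖ + 1) := by gcongr; linarith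
        rw [div_mul_cancel₀ _ (by positivity)] at this
        linarith

/-- The structure passes to quotients. -/
def quotient (T : SelfTensor B D) {Q : Type w} [NonUnitalCStarAlgebra Q]
    (π : B →⋆ₙₐ[ℂ] Q) (hπ : Function.Surjective π) : SelfTensor Q D :=
  have key : ∀ b d, T.tmul (Function.surjInv hπ (π b)) d - T.tmul b d ∈ {x | π x = 0} := by
    intro b d
    rw [← T.sub_left, Set.mem_ofPred_eq, ← norm_le_zero_iff]
    refine (T.norm_map_tmul_le π _ d).trans ?_
    rw [map_sub, Function.surjInv_eq hπ, sub_self, norm_zero, zero_mul]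
  have hmap : ∀ b d, π (T.tmul (Function.surjInv hπ (π b)) d) = π (T.tmul b d) := by
    intro b d
    rw [← sub_eq_zero, ← map_sub]
    exact key b d
  { tmul := fun q d => π (T.tmul (Function.surjInv hπ q) d)
    add_left := hπ.forall₂.2 fun a a' d => by
      rw [← map_add, hmap, hmap, hmap, T.add_left, map_add]
    add_right := fun q d d' => by rw [T.add_right, map_add]
    smul_left := fun c => hπ.forall.2 fun a d => by
      rw [← map_smul, hmap, hmap, T.smul_left, map_smul]
    smul_right := fun c q d => by rw [T.smul_right, map_smul]
    mul_tmul := hπ.forall₂.2 fun a a' d d' => by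
      rw [← map_mul π a, hmap, hmap, hmap, ← map_mul, T.mul_tmul]
    star_tmul := hπ.forall.2 fun a d => by
      rw [← map_star π a, hmap, hmap, ← map_star, T.star_tmul]
    norm_tmul_le := fun q d => by
      simpa only [Function.surjInv_eq] using T.norm_map_tmul_le π (Function.surjInv hπ q) d
    dense_span := by
      have h := hπ.denseRange.dense_image
        (LipschitzWith.continuous (K := 1) (LipschitzWith.of_dist_le_mul fun x y => by
          simpa [dist_eq_norm, ← map_sub] using NonUnitalStarAlgHom.norm_apply_le π (x - y)))
        T.dense_span
      refine h.mono ?_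
      rintro _ ⟨x, hx, rfl⟩
      have : Submodule.span ℂ {t : B | ∃ a b, T.tmul a b = t} ≤
          (Submodule.span ℂ {t : Q | ∃ a b, π (T.tmul (Function.surjInv hπ a) b) = t}).comap
            (π : B →ₗ[ℂ] Q) := by
        rw [Submodule.span_le]
        rintro _ ⟨a, b, rfl⟩
        exact Submodule.subset_span ⟨π a, b, hmap a b⟩
      exact this hx
    conj_right := hπ.forall.2 fun b => by
      rw [hmap]; exact (T.conj_right b).map π
    conj_left := hπ.forall.2 fun b => by
      rw [hmap]; exact (T.conj_left b).map π }

lemma exists_tmul_eq (T : SelfTensor B D) {J : Type w} {Q : Type x} [NonUnitalCStarAlgebra J]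
    [NonUnitalCStarAlgebra Q] (ι : J →⋆ₙₐ[ℂ] B) (π : B →⋆ₙₐ[ℂ] Q)
    (hker : ∀ a, π a = 0 ↔ a ∈ Set.range ι) (j : J) (d : D) : ∃ k, ι k = T.tmul (ι j) d :=
  (hker _).1 <| by
    rw [← norm_le_zero_iff]
    refine (T.norm_map_tmul_le π _ d).trans ?_
    rw [(hker _).2 ⟨j, rfl⟩, norm_zero, zero_mul]

/-- The structure passes to closed ideals that are invariant under the action. -/
def restrict (T : SelfTensor B D) {J : Type w} [NonUnitalCStarAlgebra J]
    (ι : J →⋆ₙₐ[ℂ] B) (hι : Function.Injective ι)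
    (hideal : ∀ x ∈ Set.range ι, ∀ a : B, a * x ∈ Set.range ι ∧ x * a ∈ Set.range ι)
    (f : J → D → J) (hmap : ∀ j d, ι (f j d) = T.tmul (ι j) d) : SelfTensor J D :=
  { tmul := f
    add_left := fun a a' d => hι <| by simp only [map_add, hmap, T.add_left]
    add_right := fun a d d' => hι <| by simp only [map_add, hmap, T.add_right]
    smul_left := fun c a d => hι <| by simp only [map_smul, hmap, T.smul_left]
    smul_right := fun c a d => hι <| by simp only [map_smul, hmap, T.smul_right]
    mul_tmul := fun a a' d d' => hι <| by simp only [map_mul, hmap, T.mul_tmul]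
    star_tmul := fun a d => hι <| by simp only [map_star, hmap, T.star_tmul]
    norm_tmul_le := fun a d => by
      rw [← NonUnitalStarAlgHom.norm_map ι hι, ← NonUnitalStarAlgHom.norm_map ι hι a, hmap]
      exact T.norm_tmul_le _ _
    dense_span := by
      set S : Set B := {t : B | ∃ j d, T.tmul (ι j) d = t} with hS
      set K : Submodule ℂ B := (Submodule.span ℂ S).topologicalClosure
      have hKc : IsClosed (K : Set B) := Submodule.isClosed_topologicalClosure _
      have hL : ∀ y, ∀ s ∈ K, y * s ∈ K := fun y s hs => by
        refine mul_mem_of_mem_closure_span hKc ?_ (T.dense_span y) hs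
        rintro _ ⟨a, e, rfl⟩ _ ⟨j, d, rfl⟩
        obtain ⟨k, hk⟩ := (hideal (ι j) ⟨j, rfl⟩ a).1
        rw [T.mul_tmul, ← hk]
        exact Submodule.le_topologicalClosure _ (Submodule.subset_span ⟨_, _, rfl⟩)
      have hR : ∀ y, ∀ s ∈ K, s * y ∈ K := fun y s hs => by
        refine mul_mem_of_mem_closure_span hKc ?_ hs (T.dense_span y)
        rintro _ ⟨j, d, rfl⟩ _ ⟨a, e, rfl⟩
        obtain ⟨k, hk⟩ := (hideal (ι j) ⟨j, rfl⟩ a).2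
        rw [T.mul_tmul, ← hk]
        exact Submodule.le_topologicalClosure _ (Submodule.subset_span ⟨_, _, rfl⟩)
      have hmem : ∀ j, ι j ∈ closure (ι '' (Submodule.span ℂ {t : J | ∃ a b, f a b = t}
          : Submodule ℂ J)) := by
        intro j
        have h1 : ι j ∈ (K : Set B) := (T.conj_left (ι j)).mem_of_isClosed hKc
          fun y z => hR _ _ (hL _ _ (Submodule.le_topologicalClosure _
            (Submodule.subset_span ⟨j, 1, rfl⟩)))
        have h2 : Submodule.span ℂ S = (Submodule.span ℂ {t : J | ∃ a b, f a b = t}).map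
            (ι : J →ₗ[ℂ] B) := by
          rw [Submodule.map_span, hS]
          congr 1
          ext t
          constructor
          · rintro ⟨j, d, rfl⟩; exact ⟨_, ⟨j, d, rfl⟩, hmap j d⟩
          · rintro ⟨_, ⟨j, d, rfl⟩, rfl⟩; exact ⟨j, d, (hmap j d).symm⟩
        have h3 : (K : Set B) = closure (Submodule.span ℂ S : Set B) :=
          Submodule.topologicalClosure_coe _
        rw [h3, h2] at h1
        exact h1
      intro j
      rw [(NonUnitalStarAlgHom.isometry ι
        hι).isUniformInducing.isInducing.closure_eq_preimage_closure_image]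
      exact hmem j
    conj_right := fun b => ConjApprox.of_ideal ι hι hideal <| by
      rw [hmap]; exact T.conj_right _
    conj_left := fun b => ConjApprox.of_ideal ι hι hideal <| by
      rw [hmap]; exact T.conj_left _ }

end SelfTensor

namespace SelfTensor

variable {B : Type u} {D : Type v} [NonUnitalCStarAlgebra B] [CStarAlgebra D]

lemma norm_tmul_le_one (T : SelfTensor B D) {b : B} {d : D} (hb : ‖b‖ ≤ 1) {C : ℝ}
    (hd : ‖d‖ ≤ C) : ‖T.tmul b d‖ ≤ C :=
  (T.norm_tmul_le b d).trans <| by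
    calc ‖b‖ * ‖d‖ ≤ 1 * C := by gcongr
      _ = C := one_mul C

lemma one_le_norm_tmul (T : SelfTensor B D)
    (hD : ∀ N : TwoSidedIdeal D, ∀ d ∈ N, d ≠ 0 → (1 : D) ∈ N) [PartialOrder D]
    [StarOrderedRing D] {b : B} (hb : IsSelfAdjoint b) (hb1 : ‖b‖ = 1) {e : D} (he : 0 ≤ e)
    (he1 : ‖e‖ = 1) : 1 ≤ ‖T.tmul b e‖ := by
  have : Nontrivial D := ⟨e, 0, by rintro rfl; simp at he1⟩
  by_contra! hr
  set r := ‖T.tmul b e‖ with hrdef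
  obtain ⟨s, hrs, hs1⟩ := exists_between hr
  have hr0 : 0 ≤ r := norm_nonneg _
  have hs0 : 0 < s := hr0.trans_lt hrs
  let β : ℕ → B := fun k => (fun x => x * x)^[k] b
  have hβs : ∀ k, β (k + 1) = β k * β k := fun k => Function.iterate_succ_apply' _ _ _
  have hβsa : ∀ k, IsSelfAdjoint (β k) ∧ ‖β k‖ = 1 := by
    intro k
    induction k with
    | zero => exact ⟨hb, hb1⟩
    | succ k ih =>
      rw [hβs]
      refine ⟨by simpa only [ih.1.star_eq] using IsSelfAdjoint.star_mul_self (β k), ?_⟩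
      have := CStarRing.norm_star_mul_self (x := β k)
      rw [ih.1.star_eq, ih.2] at this
      rw [this, one_mul]
  have hpow : ∀ k, ‖T.tmul (β k) (e ^ 2 ^ k)‖ ≤ r ^ 2 ^ k := by
    intro k
    induction k with
    | zero => simp [β, hrdef]
    | succ k ih =>
      rw [hβs, pow_succ 2, pow_mul, pow_two, ← T.mul_tmul, pow_mul, pow_two]
      exact (norm_mul_le _ _).trans (by gcongr)
  let g : D := cfc (fun t : ℝ => max (t - s) 0) e
  let h : ℕ → D := fun n => cfc (fun t : ℝ => max (t - s) 0 * ((max t s) ^ n)⁻¹) e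
  have hesa : IsSelfAdjoint e := he.isSelfAdjoint
  have hcont : ∀ n : ℕ, Continuous fun t : ℝ => max (t - s) 0 * ((max t s) ^ n)⁻¹ := by
    intro n
    refine Continuous.mul (by fun_prop) (Continuous.inv₀ (by fun_prop) fun t => ?_)
    have : 0 < max t s := lt_max_of_lt_right hs0
    positivity
  have hg : ∀ n, g = e ^ n * h n := by
    intro n
    have h1 : e ^ n = cfc (fun t : ℝ => t ^ n) e := (cfc_pow_id e n).symm
    rw [h1, ← cfc_mul _ _ e (by fun_prop) (hcont n).continuousOn]
    refine cfc_congr fun t _ => ?_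
    rcases le_total t s with hts | hts
    · simp [max_eq_right (sub_nonpos.2 hts)]
    · have : 0 < t := hs0.trans_le hts
      simp only [max_eq_left hts]
      field_simp
  have hh : ∀ n, ‖h n‖ ≤ (s ^ n)⁻¹ := by
    intro n
    refine norm_cfc_le (by positivity) fun t ht => ?_
    have ht1 : t ≤ 1 := by
      have := spectrum.norm_le_norm_of_mem ht
      rw [he1] at this
      exact (le_abs_self t).trans this
    have hm : 0 < max t s := lt_max_of_lt_right hs0
    rw [Real.norm_of_nonneg (by positivity)]
    calc max (t - s) 0 * ((max t s) ^ n)⁻¹ ≤ 1 * (s ^ n)⁻¹ := by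
          gcongr
          · exact max_le (by linarith) zero_le_one
          · exact le_max_right _ _
      _ = _ := one_mul _
  have hg0 : g ≠ 0 := by
    intro h0
    have h1 : (1 : ℝ) ∈ spectrum ℝ e := he1 ▸ CStarAlgebra.norm_mem_spectrum_of_nonneg he
    have h2 := norm_apply_le_norm_cfc (fun t : ℝ => max (t - s) 0) e h1
    change _ ≤ ‖g‖ at h2
    rw [h0, norm_zero, norm_le_zero_iff] at h2
    have : (0 : ℝ) < max (1 - s) 0 := lt_max_of_lt_left (by linarith)
    exact this.ne' h2
  have hsucc : ∀ k c d, ‖T.tmul (β (k + 1)) (c * d)‖ ≤ ‖T.tmul (β k) c‖ * ‖T.tmul (β k) d‖ := by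
    intro k c d
    rw [hβs, ← T.mul_tmul]
    exact norm_mul_le _ _
  let N : TwoSidedIdeal D := TwoSidedIdeal.mk'
    {d | Tendsto (fun k => ‖T.tmul (β k) d‖) atTop (𝓝 0)}
    (by simp [T.zero_right])
    (by
      intro c d hc hd
      refine squeeze_zero (fun _ => norm_nonneg _) (fun k => ?_) (by simpa using hc.add hd)
      rw [T.add_right]
      exact norm_add_le _ _)
    (by
      intro c hc
      refine hc.congr fun k => ?_
      rw [← neg_one_smul ℂ c, T.smul_right, neg_one_smul, norm_neg])
    (by
      intro c d hd
      refine (tendsto_add_atTop_iff_nat 1).1 (squeeze_zero (fun _ => norm_nonneg _) (fun k => ?_)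
        (by simpa using hd.const_mul ‖c‖))
      refine (hsucc k c d).trans ?_
      gcongr
      exact T.norm_tmul_le_one (hβsa k).2.le le_rfl)
    (by
      intro c d hc
      refine (tendsto_add_atTop_iff_nat 1).1 (squeeze_zero (fun _ => norm_nonneg _) (fun k => ?_)
        (by simpa using hc.mul_const ‖d‖))
      refine (hsucc k c d).trans ?_
      gcongr
      exact T.norm_tmul_le_one (hβsa k).2.le le_rfl)
  have hgN : g ∈ N := by
    rw [TwoSidedIdeal.mem_mk']
    have hlim : Tendsto (fun k : ℕ => (r / s) ^ 2 ^ k) atTop (𝓝 0) :=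
      (tendsto_pow_atTop_nhds_zero_of_lt_one (by positivity) ((div_lt_one hs0).2 hrs)).comp
        (tendsto_pow_atTop_atTop_of_one_lt one_lt_two)
    refine (tendsto_add_atTop_iff_nat 1).1 (squeeze_zero (fun _ => norm_nonneg _) (fun k => ?_)
      hlim)
    rw [hg (2 ^ k), div_pow, div_eq_mul_inv]
    refine (hsucc k _ _).trans ?_
    gcongr
    · exact hpow k
    · exact T.norm_tmul_le_one (hβsa k).2.le (hh _)
  have h1N := hD N g hgN hg0
  rw [TwoSidedIdeal.mem_mk'] at h1N
  have h1N' : Tendsto (fun k => ‖T.tmul (β k) 1‖) atTop (𝓝 0) := h1N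
  simp only [norm_tmul_one, (hβsa _).2] at h1N'
  exact one_ne_zero (tendsto_nhds_unique tendsto_const_nhds h1N')

lemma norm_tmul (T : SelfTensor B D)
    (hD : ∀ N : TwoSidedIdeal D, ∀ d ∈ N, d ≠ 0 → (1 : D) ∈ N) (b : B) (d : D) :
    ‖T.tmul b d‖ = ‖b‖ * ‖d‖ := by
  refine le_antisymm (T.norm_tmul_le b d) ?_
  let _ := CStarAlgebra.spectralOrder D
  have _ := CStarAlgebra.spectralOrderedRing D
  rcases eq_or_ne b 0 with rfl | hb
  · simp
  rcases eq_or_ne d 0 with rfl | hd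
  · simp
  have hb' : 0 < ‖b‖ * ‖b‖ := by positivity
  have hd' : 0 < ‖d‖ * ‖d‖ := by positivity
  have key := T.one_le_norm_tmul hD (b := (((‖b‖ * ‖b‖)⁻¹ : ℝ) : ℂ) • (star b * b))
    (e := (((‖d‖ * ‖d‖)⁻¹ : ℝ) : ℂ) • (star d * d))
    (IsSelfAdjoint.smul (Complex.conj_ofReal _) (IsSelfAdjoint.star_mul_self b))
    (by rw [norm_smul, Complex.norm_real, CStarRing.norm_star_mul_self,
          Real.norm_of_nonneg (by positivity), inv_mul_cancel₀ hb'.ne'])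
    (by rw [Complex.coe_smul]; exact smul_nonneg (by positivity) (star_mul_self_nonneg d))
    (by rw [norm_smul, Complex.norm_real, CStarRing.norm_star_mul_self,
          Real.norm_of_nonneg (by positivity), inv_mul_cancel₀ hd'.ne'])
  rw [T.smul_left, T.smul_right, ← T.mul_tmul, ← T.star_tmul, norm_smul, norm_smul,
    CStarRing.norm_star_mul_self, Complex.norm_real, Complex.norm_real,
    Real.norm_of_nonneg (by positivity), Real.norm_of_nonneg (by positivity)] at key
  have h2 : (‖b‖ * ‖b‖) * (‖d‖ * ‖d‖) ≤ ‖T.tmul b d‖ * ‖T.tmul b d‖ := by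
    calc (‖b‖ * ‖b‖) * (‖d‖ * ‖d‖) = (‖b‖ * ‖b‖) * (‖d‖ * ‖d‖) * 1 := (mul_one _).symm
      _ ≤ (‖b‖ * ‖b‖) * (‖d‖ * ‖d‖) *
          ((‖b‖ * ‖b‖)⁻¹ * ((‖d‖ * ‖d‖)⁻¹ * (‖T.tmul b d‖ * ‖T.tmul b d‖))) := by gcongr
      _ = _ := by field_simp
  refine abs_le_of_sq_le_sq' ?_ (norm_nonneg _) |>.2
  linarith

/-- The tensor product structure obtained when the second factor is simple. -/
def toCStarTensor (T : SelfTensor B D)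
    (hD : ∀ N : TwoSidedIdeal D, ∀ d ∈ N, d ≠ 0 → (1 : D) ∈ N) : CStarTensor B D B :=
  { T with norm_tmul := T.norm_tmul hD }

lemma nonempty_starAlgEquiv {B D BD : Type u} [NonUnitalCStarAlgebra B] [CStarAlgebra D]
    [NonUnitalCStarAlgebra BD] (T : SelfTensor B D)
    (hD : ∀ N : TwoSidedIdeal D, ∀ d ∈ N, d ≠ 0 → (1 : D) ∈ N) (h : MinTensor B D BD) :
    Nonempty (BD ≃⋆ₐ[ℂ] B) := by
  obtain ⟨ρ, hρ⟩ := h.minimal B (T.toCStarTensor hD)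
  have hinj : Function.Injective ρ := by
    refine (injective_iff_map_eq_zero ρ).2 fun b hb => ?_
    rcases subsingleton_or_nontrivial D with hs | hn
    · rw [← norm_eq_zero, ← T.norm_tmul_one, Subsingleton.elim (1 : D) 0, T.zero_right, norm_zero]
    have h1 := ((T.conj_right b).map ρ).norm_le
    have h2 : ρ (T.tmul b 1) = h.tmul b 1 := hρ b 1
    rw [h2, h.norm_tmul, hb, norm_zero, mul_zero, CStarRing.norm_one, mul_one,
      norm_le_zero_iff] at h1
    exact h1
  have hiso := NonUnitalStarAlgHom.isometry ρ hinj
  have hsurj : Function.Surjective ρ := by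
    have hcl : IsClosed (Set.range ρ) := hiso.isClosedEmbedding.isClosed_range
    have hsub : ((Submodule.span ℂ {t : BD | ∃ a b, h.tmul a b = t} : Submodule ℂ BD) : Set BD) ⊆
        Set.range ρ := by
      have : Submodule.span ℂ {t : BD | ∃ a b, h.tmul a b = t} ≤
          LinearMap.range (ρ : B →ₗ[ℂ] BD) := by
        rw [Submodule.span_le]
        rintro _ ⟨a, b, rfl⟩
        exact ⟨T.tmul a b, hρ a b⟩
      intro x hx
      obtain ⟨y, hy⟩ := this hx
      exact ⟨y, hy⟩
    rw [← Set.range_eq_univ, ← hcl.closure_eq]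
    exact (h.dense_span.mono hsub).closure_eq
  exact ⟨(StarAlgEquiv.ofBijective ρ ⟨hinj, hsurj⟩).symm⟩

end SelfTensor

/-- The elements `g` such that `g` is a contraction congruent to `1` modulo `N`. -/
def contractionsMod {D : Type u} [CStarAlgebra D] (N : TwoSidedIdeal D) : Set D :=
  {g | ‖g‖ ≤ 1 ∧ 1 - g ∈ N}

lemma mul_mem_contractionsMod {D : Type u} [CStarAlgebra D] {N : TwoSidedIdeal D} {g g' : D}
    (hg : g ∈ contractionsMod N) (hg' : g' ∈ contractionsMod N) :
    g * g' ∈ contractionsMod N := by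
  refine ⟨(norm_mul_le _ _).trans (mul_le_one₀ hg.1 (norm_nonneg _) hg'.1), ?_⟩
  have : 1 - g * g' = (1 - g) + g * (1 - g') := by noncomm_ring
  rw [this]
  exact N.add_mem hg.2 (N.mul_mem_left _ _ hg'.2)

lemma exists_contractionsMod_norm_mul_lt {D : Type u} [CStarAlgebra D] {N : TwoSidedIdeal D}
    {x : D} (hx : x ∈ N) {ε : ℝ} (hε : 0 < ε) : ∃ g ∈ contractionsMod N, ‖g * x‖ < ε := by
  let _ := CStarAlgebra.spectralOrder D
  have _ := CStarAlgebra.spectralOrderedRing D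
  rcases subsingleton_or_nontrivial D with hs | hn
  · refine ⟨1, ⟨by simp [Subsingleton.elim (1 : D) 0], by simp⟩, ?_⟩
    simpa [Subsingleton.elim x 0] using hε
  obtain ⟨δ, hδ, hδε⟩ : ∃ δ : ℝ, 0 < δ ∧ δ < ε ^ 2 := exists_between (by positivity)
  set h : D := x * star x with hh
  have h0 : 0 ≤ h := mul_star_self_nonneg x
  have hsa : IsSelfAdjoint h := h0.isSelfAdjoint
  have hspec : ∀ t ∈ spectrum ℝ h, 0 ≤ t := fun t ht => spectrum_nonneg_of_nonneg h0 ht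
  let f : ℝ → ℝ := fun t => δ / (max t 0 + δ)
  have hf : Continuous f := by
    refine continuous_const.div (by fun_prop) fun t => ?_
    have : 0 ≤ max t 0 := le_max_right _ _
    positivity
  let k : ℝ → ℝ := fun t => 1 / (max t 0 + δ)
  have hk : Continuous k := by
    refine continuous_const.div (by fun_prop) fun t => ?_
    have : 0 ≤ max t 0 := le_max_right _ _
    positivity
  have h1g : 1 - cfc f h = h * cfc k h := by
    have e1 : cfc (fun t : ℝ => t) h = h := cfc_id' ℝ h
    have e2 : h * cfc k h = cfc (fun t => t * k t) h := by
      rw [cfc_mul (fun t : ℝ => t) k h (by fun_prop) hk.continuousOn, e1]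
    rw [e2, ← cfc_one ℝ h, ← cfc_sub _ _ h (by fun_prop) hf.continuousOn]
    refine cfc_congr fun t ht => ?_
    have := hspec t ht
    simp only [f, k, max_eq_left this, Pi.one_apply]
    field_simp
    ring
  refine ⟨cfc f h, ⟨norm_cfc_le zero_le_one fun t ht => ?_, ?_⟩, ?_⟩
  · have := hspec t ht
    simp only [f, max_eq_left this]
    rw [Real.norm_of_nonneg (by positivity), div_le_one (by positivity)]
    linarith
  · rw [h1g]
    exact N.mul_mem_right _ _ (N.mul_mem_right _ _ hx)
  · have hgsa : IsSelfAdjoint (cfc f h) := cfc_predicate f h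
    have key : ‖cfc f h * x‖ * ‖cfc f h * x‖ ≤ δ := by
      rw [← CStarRing.norm_self_mul_star (x := cfc f h * x), star_mul, hgsa.star_eq]
      have e1 : cfc (fun t : ℝ => t) h = h := cfc_id' ℝ h
      have : cfc f h * x * (star x * cfc f h) = cfc (fun t => f t * t * f t) h := by
        rw [cfc_mul (fun t : ℝ => f t * t) f h (by fun_prop) hf.continuousOn,
          cfc_mul f (fun t : ℝ => t) h hf.continuousOn (by fun_prop), e1, hh]
        simp only [mul_assoc]
      rw [this]
      refine norm_cfc_le hδ.le fun t ht => ?_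
      have := hspec t ht
      simp only [f, max_eq_left this]
      rw [Real.norm_of_nonneg (by positivity)]
      rw [div_mul_eq_mul_div, div_mul_div_comm, div_le_iff₀ (by positivity)]
      nlinarith [mul_nonneg hδ.le (sq_nonneg t), mul_nonneg (mul_nonneg hδ.le hδ.le) this,
        pow_pos hδ 3]
    by_contra! hlt
    nlinarith [norm_nonneg (cfc f h * x)]

namespace CStarTensor

variable {A : Type u} {D : Type v} {T : Type w} [NonUnitalCStarAlgebra A] [CStarAlgebra D]
  [NonUnitalCStarAlgebra T]

/-- The canonical map from the algebraic tensor product. -/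
def lift (h : CStarTensor A D T) : TensorProduct ℂ A D →ₗ[ℂ] T :=
  TensorProduct.lift (LinearMap.mk₂ ℂ h.tmul h.add_left h.smul_left h.add_right h.smul_right)

@[simp]
lemma lift_tmul (h : CStarTensor A D T) (a : A) (d : D) : h.lift (a ⊗ₜ d) = h.tmul a d := rfl

lemma denseRange_lift (h : CStarTensor A D T) : DenseRange h.lift := by
  refine h.dense_span.mono ?_
  have : Submodule.span ℂ {t : T | ∃ a b, h.tmul a b = t} ≤ LinearMap.range h.lift := by
    rw [Submodule.span_le]
    rintro _ ⟨a, b, rfl⟩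
    exact ⟨a ⊗ₜ b, rfl⟩
  exact this

lemma continuous_tmul_right (h : CStarTensor A D T) (a : A) : Continuous fun d => h.tmul a d := by
  refine (LinearMap.mkContinuous (LinearMap.mk₂ ℂ h.tmul h.add_left h.smul_left h.add_right
    h.smul_right a) ‖a‖ fun d => ?_).continuous
  exact (h.norm_tmul a d).le

lemma continuous_tmul_left (h : CStarTensor A D T) (d : D) : Continuous fun a => h.tmul a d := by
  refine (LinearMap.mkContinuous ((LinearMap.mk₂ ℂ h.tmul h.add_left h.smul_left h.add_right
    h.smul_right).flip d) ‖d‖ fun a => ?_).continuous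
  exact ((h.norm_tmul a d).trans (mul_comm _ _)).le

/-- Exchange the two factors. -/
def swap {E : Type v} [NonUnitalCStarAlgebra E] (h : CStarTensor A E T) : CStarTensor E A T where
  tmul e a := h.tmul a e
  add_left _ _ _ := h.add_right _ _ _
  add_right _ _ _ := h.add_left _ _ _
  smul_left _ _ _ := h.smul_right _ _ _
  smul_right _ _ _ := h.smul_left _ _ _
  mul_tmul _ _ _ _ := h.mul_tmul _ _ _ _
  star_tmul _ _ := h.star_tmul _ _
  norm_tmul _ _ := (h.norm_tmul _ _).trans (mul_comm _ _)
  dense_span := by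
    have : {t : T | ∃ e a, h.tmul a e = t} = {t : T | ∃ a e, h.tmul a e = t} :=
      Set.ext fun t => exists_comm
    rw [this]
    exact h.dense_span

/-- Transport along an isomorphism. -/
def trans {E : Type x} [NonUnitalCStarAlgebra E] (h : CStarTensor A D T) (e : T ≃⋆ₐ[ℂ] E) :
    CStarTensor A D E where
  tmul a d := e (h.tmul a d)
  add_left a a' d := by rw [h.add_left, map_add]
  add_right a d d' := by rw [h.add_right, map_add]
  smul_left c a d := by rw [h.smul_left, map_smul]
  smul_right c a d := by rw [h.smul_right, map_smul]
  mul_tmul a a' d d' := by rw [← map_mul, h.mul_tmul]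
  star_tmul a d := by rw [← map_star, h.star_tmul]
  norm_tmul a d := by rw [← h.norm_tmul, NonUnitalStarAlgHom.norm_map e e.injective]
  dense_span := by
    have h1 := e.surjective.denseRange.dense_image
      (NonUnitalStarAlgHom.isometry e e.injective).continuous h.dense_span
    refine h1.mono ?_
    rintro _ ⟨x, hx, rfl⟩
    refine Submodule.span_induction (p := fun x _ => e x ∈ Submodule.span ℂ
      {t : E | ∃ a b, e (h.tmul a b) = t}) ?_ ?_ ?_ ?_ hx
    · rintro _ ⟨a, b, rfl⟩; exact Submodule.subset_span ⟨a, b, rfl⟩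
    · rw [map_zero]; exact Submodule.zero_mem _
    · intro a b _ _ ha hb; rw [map_add]; exact Submodule.add_mem _ ha hb
    · intro c a _ ha; rw [map_smul]; exact Submodule.smul_mem _ c ha

end CStarTensor

lemma tendsto_conj_of_tendsto_conj {D : Type u} [CStarAlgebra D] {u : ℕ → D}
    (hu : ∀ n, u n ∈ unitary D) {d x : D}
    (h : Tendsto (fun n => star (u n) * d * u n) atTop (𝓝 x)) :
    Tendsto (fun n => u n * x * star (u n)) atTop (𝓝 d) := by
  rw [tendsto_iff_norm_sub_tendsto_zero] at h ⊢
  refine h.congr fun n => ?_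
  have h1 : u n * x * star (u n) - d =
      u n * (x - star (u n) * d * u n) * star (u n) := by
    have e1 : u n * star (u n) = 1 := (Unitary.mem_iff.1 (hu n)).2
    calc u n * x * star (u n) - d
        = u n * x * star (u n) - (u n * star (u n)) * d * (u n * star (u n)) := by
          rw [e1, one_mul, mul_one]
      _ = _ := by noncomm_ring
  rw [h1, CStarRing.norm_mul_mem_unitary _ (Unitary.star_mem (hu n)),
    CStarRing.norm_mem_unitary_mul _ (hu n), norm_sub_rev]

lemma CStarTensor.induction_on {A : Type u} {D : Type v} {T : Type w} [NonUnitalCStarAlgebra A]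
    [CStarAlgebra D] [NonUnitalCStarAlgebra T] (h : CStarTensor A D T) {p : T → Prop}
    (hp : IsClosed {x | p x}) (htmul : ∀ a d, p (h.tmul a d))
    (hadd : ∀ x y, p x → p y → p (x + y))
    (x : T) : p x := by
  refine h.denseRange_lift.induction_on x hp fun z => ?_
  induction z with
  | zero =>
    have := htmul 0 0
    rwa [← h.lift_tmul, TensorProduct.zero_tmul] at this
  | tmul a d => exact htmul a d
  | add z z' hz hz' => rw [map_add]; exact hadd _ _ hz hz'

/-- If `d ↦ d ⊗ 1` is approximately inner with respect to a self-tensor product structure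
carrying a flip, then the algebra is simple. -/
lemma one_mem_of_mem_twoSidedIdeal {D : Type u} [CStarAlgebra D] (h : CStarTensor D D D)
    (h1 : h.tmul 1 1 = 1) (β : D →⋆ₙₐ[ℂ] D) (hβ : ∀ a b, β (h.tmul a b) = h.tmul b a)
    {u : ℕ → D} (hu : ∀ n, u n ∈ unitary D)
    (hlim : ∀ d, Tendsto (fun n => star (u n) * d * u n) atTop (𝓝 (h.tmul d 1)))
    (N : TwoSidedIdeal D) (d : D) (hd : d ∈ N) (hd0 : d ≠ 0) : (1 : D) ∈ N := by
  have : Nontrivial D := ⟨d, 0, hd0⟩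
  have hβc : Continuous β := AddMonoidHomClass.continuous_of_bound β 1 fun x => by
    simpa using NonUnitalStarAlgHom.norm_apply_le β x
  have hββ : ∀ x, β (β x) = x := by
    refine h.induction_on (isClosed_eq (hβc.comp hβc) continuous_id) (fun a b => ?_)
      (fun x y hx hy => ?_)
    · rw [hβ, hβ]
    · rw [map_add, map_add, hx, hy]
  have hβ1 : β 1 = 1 := by rw [← h1, hβ]
  let N' : TwoSidedIdeal D := N.comap β
  have hN' : ∀ x, x ∈ N' ↔ β x ∈ N := fun x => TwoSidedIdeal.mem_comap β
  set S : Set D := {t | ∃ x ∈ N', ∃ c, h.tmul x c = t} with hS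
  set K : Submodule ℂ D := (Submodule.span ℂ S).topologicalClosure
  have hKc : IsClosed (K : Set D) := Submodule.isClosed_topologicalClosure _
  have hSK : ∀ x ∈ N', ∀ c, h.tmul x c ∈ K := fun x hx c =>
    Submodule.le_topologicalClosure _ (Submodule.subset_span ⟨x, hx, c, rfl⟩)
  have hL : ∀ y, ∀ s ∈ K, y * s ∈ K := fun y s hs => by
    refine mul_mem_of_mem_closure_span hKc ?_ (h.dense_span y) hs
    rintro _ ⟨a, e, rfl⟩ _ ⟨x, hx, c, rfl⟩
    rw [h.mul_tmul]
    exact hSK _ (N'.mul_mem_left _ _ hx) _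
  have hR : ∀ y, ∀ s ∈ K, s * y ∈ K := fun y s hs => by
    refine mul_mem_of_mem_closure_span hKc ?_ hs (h.dense_span y)
    rintro _ ⟨x, hx, c, rfl⟩ _ ⟨a, e, rfl⟩
    rw [h.mul_tmul]
    exact hSK _ (N'.mul_mem_right _ _ hx) _
  have hN'K : ∀ x ∈ N', x ∈ K := fun x hx =>
    hKc.mem_of_tendsto (tendsto_conj_of_tendsto_conj hu (hlim x))
      (Eventually.of_forall fun n => hR _ _ (hL _ _ (hSK x hx 1)))
  have hdK : h.tmul 1 d ∈ K := by
    rw [← hβ]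
    refine hKc.mem_of_tendsto ((hβc.tendsto _).comp (hlim d)) (Eventually.of_forall fun n => ?_)
    simp only [Function.comp_apply, map_mul]
    refine hR _ _ (hL _ _ (hN'K _ ((hN' _).2 ?_)))
    rwa [hββ]
  have key : ∀ t ∈ Submodule.span ℂ S, ∀ g₀ ∈ contractionsMod N', ∀ ε > 0,
      ∃ g ∈ contractionsMod N', ‖h.tmul (g * g₀) 1 * t‖ < ε := by
    intro t ht
    refine Submodule.span_induction (p := fun t _ => ∀ g₀ ∈ contractionsMod N', ∀ ε > 0,
      ∃ g ∈ contractionsMod N', ‖h.tmul (g * g₀) 1 * t‖ < ε) ?_ ?_ ?_ ?_ ht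
    · rintro _ ⟨x, hx, c, rfl⟩ g₀ hg₀ ε hε
      have hδ : 0 < ε / (‖c‖ + 1) := by positivity
      obtain ⟨g, hg, hgx⟩ := exists_contractionsMod_norm_mul_lt (N'.mul_mem_left g₀ _ hx) hδ
      refine ⟨g, hg, ?_⟩
      rw [h.mul_tmul, h.norm_tmul, one_mul, mul_assoc]
      calc ‖g * (g₀ * x)‖ * ‖c‖ ≤ ‖g * (g₀ * x)‖ * (‖c‖ + 1) := by gcongr; linarith
        _ < ε / (‖c‖ + 1) * (‖c‖ + 1) := by gcongr
        _ = ε := by field_simp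
    · intro g₀ hg₀ ε hε
      exact ⟨g₀, hg₀, by simpa using hε⟩
    · intro t t' _ _ ht ht' g₀ hg₀ ε hε
      obtain ⟨g, hg, hgt⟩ := ht g₀ hg₀ (ε / 2) (half_pos hε)
      obtain ⟨g', hg', hgt'⟩ := ht' (g * g₀) (mul_mem_contractionsMod hg hg₀) (ε / 2) (half_pos hε)
      refine ⟨g' * g, mul_mem_contractionsMod hg' hg, ?_⟩
      have e1 : h.tmul (g' * g * g₀) 1 * t = h.tmul g' 1 * (h.tmul (g * g₀) 1 * t) := by
        rw [← mul_assoc, h.mul_tmul, one_mul, mul_assoc g']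
      have e2 : ‖h.tmul g' 1‖ ≤ 1 := by
        rw [h.norm_tmul, CStarRing.norm_one, mul_one]; exact hg'.1
      rw [mul_add, e1, mul_assoc g']
      calc _ ≤ ‖h.tmul g' 1 * (h.tmul (g * g₀) 1 * t)‖ + ‖h.tmul (g' * (g * g₀)) 1 * t'‖ :=
            norm_add_le _ _
        _ ≤ 1 * ‖h.tmul (g * g₀) 1 * t‖ + ‖h.tmul (g' * (g * g₀)) 1 * t'‖ := by
            gcongr
            exact (norm_mul_le _ _).trans (by gcongr)
        _ < ε := by linarith
    · intro c t _ ht g₀ hg₀ ε hε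
      obtain ⟨g, hg, hgt⟩ := ht g₀ hg₀ (ε / (‖c‖ + 1)) (by positivity)
      refine ⟨g, hg, ?_⟩
      rw [mul_smul_comm, norm_smul]
      calc ‖c‖ * ‖h.tmul (g * g₀) 1 * t‖ ≤ (‖c‖ + 1) * ‖h.tmul (g * g₀) 1 * t‖ := by
            gcongr; linarith
        _ < (‖c‖ + 1) * (ε / (‖c‖ + 1)) := by gcongr
        _ = ε := by field_simp
  have hdpos : 0 < ‖d‖ := norm_pos_iff.2 hd0
  obtain ⟨t, ht, htd⟩ := Metric.mem_closure_iff.1 (show h.tmul 1 d ∈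
    closure (Submodule.span ℂ S : Set D) from hdK) (‖d‖ / 2) (half_pos hdpos)
  have hone : (1 : D) ∈ contractionsMod N' := ⟨CStarRing.norm_one.le, by simp⟩
  obtain ⟨g, hg, hgt⟩ := key t ht 1 hone (‖d‖ / 2) (half_pos hdpos)
  rw [mul_one] at hgt
  have hlt : ‖g‖ < 1 := by
    have e2 : ‖h.tmul g 1‖ ≤ 1 := by
      rw [h.norm_tmul, CStarRing.norm_one, mul_one]; exact hg.1
    have : ‖g‖ * ‖d‖ < ‖d‖ := by
      calc ‖g‖ * ‖d‖ = ‖h.tmul g 1 * h.tmul 1 d‖ := by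
            rw [h.mul_tmul, mul_one, one_mul, h.norm_tmul]
        _ = ‖h.tmul g 1 * (h.tmul 1 d - t) + h.tmul g 1 * t‖ := by
            rw [← mul_add, sub_add_cancel]
        _ ≤ ‖h.tmul g 1 * (h.tmul 1 d - t)‖ + ‖h.tmul g 1 * t‖ := norm_add_le _ _
        _ ≤ 1 * ‖h.tmul 1 d - t‖ + ‖h.tmul g 1 * t‖ := by
            gcongr
            exact (norm_mul_le _ _).trans (by gcongr)
        _ < ‖d‖ := by rw [dist_eq_norm] at htd; linarith
    exact (mul_lt_iff_lt_one_left hdpos).1 this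
  obtain ⟨v, hv⟩ := isUnit_one_sub_of_norm_lt_one hlt
  have h1N' : (1 : D) ∈ N' := by
    have := N'.mul_mem_left (↑v⁻¹ : D) _ hg.2
    rwa [← hv, Units.inv_mul] at this
  simpa only [hN', hβ1] using h1N'

lemma norm_le_one_of_mem_unitary {D : Type u} [CStarAlgebra D] {u : D} (hu : u ∈ unitary D) :
    ‖u‖ ≤ 1 := by
  rcases subsingleton_or_nontrivial D with _ | _
  · simp [Subsingleton.elim u 0]
  · exact (CStarRing.norm_of_mem_unitary hu).le

lemma ConjApprox.mono {B : Type u} [NonUnitalCStarAlgebra B] {C C' : ℝ} {x w : B}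
    (h : ConjApprox C x w) (hC : C ≤ C') : ConjApprox C' x w := fun ε hε => by
  obtain ⟨y, z, hy, hz, h⟩ := h ε hε
  exact ⟨y, z, hy, hz.trans hC, h⟩

/-- Unitary multipliers of a unital algebra come from unitaries of the algebra. -/
lemma exists_unitary_coe_eq {B : Type u} [CStarAlgebra B] {v : 𝓜(ℂ, B)}
    (hv : v ∈ unitary 𝓜(ℂ, B)) : ∃ w ∈ unitary B, (w : 𝓜(ℂ, B)) = v := by
  have h1 : ∀ y, v.fst y = v.snd 1 * y := fun y => by rw [v.central, one_mul]
  have h2 : ∀ y, v.snd y = y * v.snd 1 := fun y => by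
    rw [← mul_one (v.snd y), v.central, h1, mul_one]
  have hw : ((v.snd 1 : B) : 𝓜(ℂ, B)) = v := by
    refine DoubleCentralizer.ext ℂ B _ _ (Prod.ext ?_ ?_)
    · ext y; exact (h1 y).symm
    · ext y; exact (h2 y).symm
  have hinj : Function.Injective (fun b : B => (b : 𝓜(ℂ, B))) := fun a b hab => by
    have := congrArg (fun m : 𝓜(ℂ, B) => m.fst 1) hab
    simpa using this
  have hone : ((1 : B) : 𝓜(ℂ, B)) = 1 := by
    refine DoubleCentralizer.ext ℂ B _ _ (Prod.ext ?_ ?_)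
    · ext y; simp
    · ext y; simp
  refine ⟨v.snd 1, ?_, hw⟩
  rw [← hw, Unitary.mem_iff] at hv
  have e1 : ∀ b, DoubleCentralizer.coeHom (𝕜 := ℂ) (A := B) b = (b : 𝓜(ℂ, B)) := fun _ => rfl
  rw [← hone, ← e1, ← e1, ← map_star, ← map_mul, ← map_mul] at hv
  exact Unitary.mem_iff.2 ⟨hinj hv.1, hinj hv.2⟩

namespace CStarTensor

variable {A : Type u} {D : Type v} {T : Type w} [NonUnitalCStarAlgebra A] [CStarAlgebra D]
  [NonUnitalCStarAlgebra T]

lemma conjApprox_lift_lTensor_mul (h : CStarTensor A D T) {p q : D} {C : ℝ} (hp : ‖p‖ ≤ 1)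
    (hq : ‖q‖ ≤ C) (z : A ⊗[ℂ] D) : ConjApprox C (h.lift z)
      (h.lift (LinearMap.lTensor A (LinearMap.mulRight ℂ q ∘ₗ LinearMap.mulLeft ℂ p) z)) := by
  obtain ⟨l, hl, hl1⟩ := exists_contractive_approximateUnit A
  have := hl.neBot
  have key : Tendsto (fun e => h.tmul e p * h.lift z * h.tmul e q) l
      (𝓝 (h.lift (LinearMap.lTensor A (LinearMap.mulRight ℂ q ∘ₗ LinearMap.mulLeft ℂ p) z))) := by
    induction z with
    | zero => simp
    | tmul a d =>
      have : Tendsto (fun e => e * a * e) l (𝓝 a) := by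
        rw [tendsto_iff_norm_sub_tendsto_zero]
        have h1 := (tendsto_iff_norm_sub_tendsto_zero.1 (hl.tendsto_mul_left a)).add
          (tendsto_iff_norm_sub_tendsto_zero.1 (hl.tendsto_mul_right a))
        rw [add_zero] at h1
        refine squeeze_zero' (Eventually.of_forall fun _ => norm_nonneg _) ?_ h1
        filter_upwards [hl1] with e he
        calc ‖e * a * e - a‖ = ‖e * (a * e - a) + (e * a - a)‖ := by
              rw [mul_sub, mul_assoc]; congr 1; abel
          _ ≤ ‖e * (a * e - a)‖ + ‖e * a - a‖ := norm_add_le _ _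
          _ ≤ 1 * ‖a * e - a‖ + ‖e * a - a‖ := by
              gcongr; exact (norm_mul_le _ _).trans (by gcongr)
          _ = _ := by rw [one_mul]
      simpa [h.mul_tmul, Function.comp_def] using
        ((h.continuous_tmul_left (p * d * q)).tendsto a).comp this
    | add z z' hz hz' => simpa [mul_add, add_mul] using hz.add hz'
  have hC : 0 ≤ C := (norm_nonneg q).trans hq
  intro ε hε
  have h0 := tendsto_iff_norm_sub_tendsto_zero.1 key
  obtain ⟨e, he, he1⟩ := ((h0.eventually_lt_const hε).and hl1).exists
  refine ⟨h.tmul e p, h.tmul e q, ?_, ?_, by rwa [norm_sub_rev]⟩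
  · rw [h.norm_tmul]
    exact mul_le_one₀ he1 (norm_nonneg _) hp
  · rw [h.norm_tmul]
    calc ‖e‖ * ‖q‖ ≤ 1 * C := by gcongr
      _ = C := one_mul C

lemma conjApprox_lift_lTensor (h : CStarTensor A D T) (F G : D →ₗ[ℂ] D) {p q : ℕ → D} {C : ℝ}
    (hp : ∀ n, ‖p n‖ ≤ 1) (hq : ∀ n, ‖q n‖ ≤ C)
    (hlim : ∀ d, Tendsto (fun n => p n * F d * q n) atTop (𝓝 (G d))) (z : A ⊗[ℂ] D) :
    ConjApprox C (h.lift (LinearMap.lTensor A F z)) (h.lift (LinearMap.lTensor A G z)) := by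
  refine ConjApprox.of_tendsto_right (l := atTop) ?_ (Eventually.of_forall fun n =>
    h.conjApprox_lift_lTensor_mul (hp n) (hq n) (LinearMap.lTensor A F z))
  induction z with
  | zero => simp
  | tmul a d =>
    simpa [Function.comp_def] using ((h.continuous_tmul_right a).tendsto _).comp (hlim d)
  | add z z' hz hz' => simpa using hz.add hz'

lemma exists_act (h : CStarTensor A D T) (ψ : CStarTensor D D D) {u : ℕ → D}
    (hu : ∀ n, u n ∈ unitary D)
    (hlim : ∀ d, Tendsto (fun n => star (u n) * d * u n) atTop (𝓝 (ψ.tmul d 1))) (e : D) :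
    ∃ S : T →L[ℂ] T,
    (∀ a d, S (h.tmul a d) = h.tmul a (ψ.tmul d e)) ∧ (∀ x, ‖S x‖ ≤ ‖e‖ * ‖x‖) ∧
    (∀ x, ConjApprox ‖e‖ x (S x)) ∧ (e = 1 → ∀ x, ConjApprox 1 (S x) x) := by
  let R : D →ₗ[ℂ] D := (LinearMap.mk₂ ℂ ψ.tmul ψ.add_left ψ.smul_left ψ.add_right
    ψ.smul_right).flip e
  have hR : ∀ d, R d = ψ.tmul d e := fun _ => rfl
  have hu1 := fun n => norm_le_one_of_mem_unitary (hu n)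
  have hu2 := fun n => norm_le_one_of_mem_unitary (Unitary.star_mem (hu n))
  have happ : ∀ z, ConjApprox ‖e‖ (h.lift z) (h.lift (LinearMap.lTensor A R z)) := fun z => by
    have hq : ∀ n, ‖u n * ψ.tmul 1 e‖ ≤ ‖e‖ := fun n => by
      calc ‖u n * ψ.tmul 1 e‖ ≤ ‖u n‖ * ‖ψ.tmul 1 e‖ := norm_mul_le _ _
        _ ≤ 1 * (1 * ‖e‖) := by
          rw [ψ.norm_tmul]
          gcongr
          exacts [hu1 n, norm_le_one_of_mem_unitary (one_mem _)]
        _ = ‖e‖ := by ring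
    have := h.conjApprox_lift_lTensor LinearMap.id R hu2 hq (fun d => ?_) z
    · simpa using this
    · have := (hlim d).mul_const (ψ.tmul 1 e)
      simpa [ψ.mul_tmul, mul_assoc, hR] using this
  have hbound : ∃ C, ∀ z, ‖(h.lift ∘ₗ LinearMap.lTensor A R) z‖ ≤ C * ‖h.lift z‖ :=
    ⟨‖e‖, fun z => (happ z).norm_le⟩
  have hS := LinearMap.extendOfNorm_eq h.denseRange_lift hbound
  set S := (h.lift ∘ₗ LinearMap.lTensor A R).extendOfNorm h.lift
  have happrox : ∀ x, ∀ ε > 0, ∃ z, ‖x - h.lift z‖ < ε ∧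
      ‖S x - h.lift (LinearMap.lTensor A R z)‖ < ε := fun x ε hε => by
    obtain ⟨δ, hδ, hSδ⟩ := Metric.continuous_iff.1 S.continuous x ε hε
    obtain ⟨z, hz⟩ := h.denseRange_lift.exists_dist_lt x (lt_min hε hδ)
    refine ⟨z, ?_, ?_⟩
    · rw [← dist_eq_norm]; exact hz.trans_le (min_le_left _ _)
    · have := hSδ (h.lift z) (by rw [dist_comm]; exact hz.trans_le (min_le_right _ _))
      rwa [hS, dist_comm, dist_eq_norm] at this
  have hright : ∀ x, ConjApprox ‖e‖ x (S x) := fun x => ConjApprox.of_approx fun ε hε => by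
    obtain ⟨z, h1, h2⟩ := happrox x ε hε
    exact ⟨_, _, h1, h2, happ z⟩
  refine ⟨S, fun a d => hS (a ⊗ₜ d), fun x => (hright x).norm_le, hright, ?_⟩
  rintro rfl x
  refine ConjApprox.of_approx fun ε hε => ?_
  obtain ⟨z, h1, h2⟩ := happrox x ε hε
  refine ⟨_, _, h2, h1, ?_⟩
  simpa using h.conjApprox_lift_lTensor R LinearMap.id hu1 hu2
    (fun d => tendsto_conj_of_tendsto_conj hu (hlim d)) z

/-- A tensor product with `D` carries the structure of a self-tensor product with `D`. -/
def selfTensor (h : CStarTensor A D T) (ψ : CStarTensor D D D) {u : ℕ → D}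
    (hu : ∀ n, u n ∈ unitary D)
    (hlim : ∀ d, Tendsto (fun n => star (u n) * d * u n) atTop (𝓝 (ψ.tmul d 1))) :
    SelfTensor T D :=
  have hS := h.exists_act ψ hu hlim
  let S := fun e => (hS e).choose
  have hSt : ∀ e a d, S e (h.tmul a d) = h.tmul a (ψ.tmul d e) := fun e => (hS e).choose_spec.1
  { tmul := fun x e => S e x
    add_left := fun _ _ _ => map_add _ _ _
    add_right := fun x e e' => by
      refine h.induction_on (p := fun x => S (e + e') x = S e x + S e' x)
        (isClosed_eq (by fun_prop) (by fun_prop)) (fun a d => ?_) (fun x y hx hy => ?_) x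
      · simp only [hSt, ψ.add_right, h.add_right]
      · simp only [map_add, hx, hy]; abel
    smul_left := fun _ _ _ => map_smul _ _ _
    smul_right := fun c x e => by
      refine h.induction_on (p := fun x => S (c • e) x = c • S e x)
        (isClosed_eq (by fun_prop) (by fun_prop)) (fun a d => ?_) (fun x y hx hy => ?_) x
      · simp only [hSt, ψ.smul_right, h.smul_right]
      · simp only [map_add, hx, hy, smul_add]
    mul_tmul := fun x y e e' => by
      refine h.induction_on (p := fun x => S e x * S e' y = S (e * e') (x * y))
        (isClosed_eq (by fun_prop) (by fun_prop)) (fun a d => ?_) (fun x y hx hy => ?_) x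
      · refine h.induction_on (p := fun y => S e (h.tmul a d) * S e' y =
          S (e * e') (h.tmul a d * y))
          (isClosed_eq (by fun_prop) (by fun_prop)) (fun a d => ?_) (fun x y hx hy => ?_) y
        · simp only [hSt, ψ.mul_tmul, h.mul_tmul]
        · simp only [map_add, mul_add, hx, hy]
      · simp only [map_add, add_mul, hx, hy]
    star_tmul := fun x e => by
      refine h.induction_on (p := fun x => star (S e x) = S (star e) (star x))
        (isClosed_eq (by fun_prop) (by fun_prop)) (fun a d => ?_) (fun x y hx hy => ?_) x
      · simp only [hSt, ψ.star_tmul, h.star_tmul]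
      · simp only [map_add, star_add, hx, hy]
    norm_tmul_le := fun x e => ((hS e).choose_spec.2.1 x).trans_eq (mul_comm _ _)
    dense_span := by
      set K := (Submodule.span ℂ {t : T | ∃ x e, S e x = t}).topologicalClosure
      have hKc : IsClosed (K : Set T) := Submodule.isClosed_topologicalClosure _
      intro x
      change x ∈ K
      refine h.induction_on (p := fun x => x ∈ K) hKc (fun a t => ?_)
        (fun x y hx hy => K.add_mem hx hy) x
      refine ψ.induction_on (p := fun t => h.tmul a t ∈ K)
        (hKc.preimage (h.continuous_tmul_right a)) (fun d e => ?_) (fun t t' ht ht' => ?_) t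
      · exact Submodule.le_topologicalClosure _ (Submodule.subset_span ⟨_, _, hSt e a d⟩)
      · rw [h.add_right]; exact K.add_mem ht ht'
    conj_right := fun x => ((hS 1).choose_spec.2.2.1 x).mono
      (norm_le_one_of_mem_unitary (one_mem _))
    conj_left := fun x => (hS 1).choose_spec.2.2.2 rfl x }

end CStarTensor

/-- Transport of strong self-absorption to maps on `D` itself. -/
lemma exists_unitary_tendsto {D TD : Type u} [CStarAlgebra D] [CStarAlgebra TD]
    (hD : MinTensor D D TD) (φ : D ≃⋆ₐ[ℂ] TD) (hφ : ApproxUnitaryEquiv (⇑φ) hD.fst) :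
    ∃ u : ℕ → D, (∀ n, u n ∈ unitary D) ∧ ∀ d, Tendsto (fun n => star (u n) * d * u n) atTop
      (𝓝 ((hD.toCStarTensor.trans φ.symm).tmul d 1)) := by
  obtain ⟨v, hv, hlim⟩ := hφ
  choose w hw hwv using fun n => exists_unitary_coe_eq (hv n)
  refine ⟨fun n => φ.symm (w n), fun n => ?_, fun d => ?_⟩
  · rw [Unitary.mem_iff, ← map_star, ← map_mul, ← map_mul, (Unitary.mem_iff.1 (hw n)).1,
      (Unitary.mem_iff.1 (hw n)).2, map_one]
    exact ⟨rfl, rfl⟩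
  · have h1 : Tendsto (fun n => star (w n) * φ d * w n) atTop (𝓝 (hD.tmul d 1)) := by
      rw [tendsto_iff_norm_sub_tendsto_zero]
      refine (hlim d).congr fun n => ?_
      have e1 : ∀ b, DoubleCentralizer.coeHom (𝕜 := ℂ) (A := TD) b = (b : 𝓜(ℂ, TD)) :=
        fun _ => rfl
      rw [← hwv, ← e1, ← e1, ← e1, ← map_star, ← map_mul, ← map_mul, ← map_sub, e1,
        ← DoubleCentralizer.norm_fst, DoubleCentralizer.coe_fst,
        ContinuousLinearMap.opNorm_mul_apply]
      rfl
    simp only [← map_star]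
    have h2 := ((NonUnitalStarAlgHom.isometry φ.symm φ.symm.injective).continuous.tendsto _).comp h1
    simp only [Function.comp_def, map_mul, φ.symm_apply_apply] at h2
    exact h2

/-- `D`-stability passes to closed two-sided ideals and quotients: if `D` is separable,
unital, strongly self-absorbing and `K₁`-injective, `A` is separable and `D`-stable, `J`
is a closed two-sided ideal of `A` (realized as the range of an injective *-homomorphism
`ι : J → A`) and `A/J` is the corresponding quotient (realized by a surjective
*-homomorphism `π : A → AJ` with kernel `J`), then `J` and `A/J` are `D`-stable. -/
theorem stmt_14 {A J AJ D TD AD : Type u}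
    [NonUnitalCStarAlgebra A] [NonUnitalCStarAlgebra J] [NonUnitalCStarAlgebra AJ]
    [CStarAlgebra D] [CStarAlgebra TD] [NonUnitalCStarAlgebra AD]
    [TopologicalSpace.SeparableSpace A] [TopologicalSpace.SeparableSpace D]
    (hD : MinTensor D D TD) (hDu : hD.tmul 1 1 = 1)
    (hssa : IsStronglySelfAbsorbing hD) (hK1 : K1Injective D)
    -- `A` is `D`-stable
    (hAD : MinTensor A D AD) (hstable : Nonempty (AD ≃⋆ₐ[ℂ] A))
    -- `J` is a closed two-sided ideal of `A`
    (ι : J →⋆ₙₐ[ℂ] A) (hι : Function.Injective ι)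
    (hideal : ∀ x ∈ Set.range ι, ∀ a : A, a * x ∈ Set.range ι ∧ x * a ∈ Set.range ι)
    -- `AJ = A / J`
    (π : A →⋆ₙₐ[ℂ] AJ) (hπ : Function.Surjective π)
    (hker : ∀ a : A, π a = 0 ↔ a ∈ Set.range ι) :
    -- then `J` and `A/J` are `D`-stable
    (∀ (JD : Type u) [NonUnitalCStarAlgebra JD],
      MinTensor J D JD → Nonempty (JD ≃⋆ₐ[ℂ] J)) ∧
    (∀ (QD : Type u) [NonUnitalCStarAlgebra QD],
      MinTensor AJ D QD → Nonempty (QD ≃⋆ₐ[ℂ] AJ)) := by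
  obtain ⟨-, φ, hφ⟩ := hssa
  obtain ⟨u, hu, hlim⟩ := exists_unitary_tendsto hD φ hφ
  obtain ⟨θ⟩ := hstable
  set ψ := hD.toCStarTensor.trans φ.symm
  have hψ : ∀ a b, ψ.tmul a b = φ.symm (hD.tmul a b) := fun _ _ => rfl
  obtain ⟨σ, hσ⟩ := hD.minimal TD hD.toCStarTensor.swap
  let β : D →⋆ₙₐ[ℂ] D := (φ.symm : TD →⋆ₙₐ[ℂ] D).comp (σ.comp (φ : D →⋆ₙₐ[ℂ] TD))
  have hβ : ∀ a b, β (ψ.tmul a b) = ψ.tmul b a := fun a b => by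
    change φ.symm (σ (φ (φ.symm (hD.tmul a b)))) = φ.symm (hD.tmul b a)
    rw [φ.apply_symm_apply]
    exact congrArg φ.symm (hσ b a)
  have hsimple := one_mem_of_mem_twoSidedIdeal ψ (by rw [hψ, hDu, map_one]) β hβ hu hlim
  let S := (hAD.toCStarTensor.selfTensor ψ hu hlim).quotient (θ : AD →⋆ₙₐ[ℂ] A) θ.surjective
  refine ⟨fun JD _ hJD => ?_, fun QD _ hQD => (S.quotient π hπ).nonempty_starAlgEquiv hsimple hQD⟩
  choose f hf using S.exists_tmul_eq ι π hker
  exact (S.restrict ι hι hideal f hf).nonempty_starAlgEquiv hsimple hJD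
end
end

section
/- Let D be a separable, unital, strongly self-absorbing, K₁-injective C*-algebra, and let A = lim→ Aᵢ be an inductive limit of a sequence of separable D-stable C*-algebras Aᵢ, i ∈ ℕ. Then A is D-stable. -/
open scoped MultiplierAlgebra TensorProduct
open Filter Topology

noncomputable section

universe u v w x

/-- Iterated composition of the connecting maps of an inductive system of C*-algebras. -/
def chainFun {A : ℕ → Type u} [∀ n, NonUnitalCStarAlgebra (A n)]
    (f : ∀ n, A n →⋆ₙₐ[ℂ] A (n + 1)) : ∀ n k, A n → A (n + k)
  | _, 0 => id
  | n, (k + 1) => fun x => f (n + k) (chainFun f n k x)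

/-- Data exhibiting `L` as the C*-inductive limit of the system `(A n, f n)`: compatible
*-homomorphisms `A n → L` with dense combined range, such that the norm of `ι n x` is the
limit of the norms along the system. -/
structure IsCStarInductiveLimit {A : ℕ → Type u} [∀ n, NonUnitalCStarAlgebra (A n)]
    (f : ∀ n, A n →⋆ₙₐ[ℂ] A (n + 1)) (L : Type v) [NonUnitalCStarAlgebra L] where
  ι : ∀ n, A n →⋆ₙₐ[ℂ] L
  compat : ∀ n x, ι (n + 1) (f n x) = ι n x
  dense : Dense (⋃ n, Set.range (ι n))
  norm_eq : ∀ n x, Tendsto (fun k => ‖chainFun f n k x‖) atTop (𝓝 ‖ι n x‖)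

section Functionals

open scoped ComplexOrder InnerProductSpace

variable {B : Type u} [CStarAlgebra B]

theorem exists_gns (g : B →ₗ[ℂ] ℂ) (hg : ∀ x, 0 ≤ g (star x * x)) :
    ∃ (H : Type u) (_ : NormedAddCommGroup H) (_ : InnerProductSpace ℂ H) (_ : CompleteSpace H)
      (π : B →⋆ₐ[ℂ] (H →L[ℂ] H)) (Λ : B →ₗ[ℂ] H), DenseRange Λ ∧
      (∀ x y, π x (Λ y) = Λ (x * y)) ∧ ∀ x y, ⟪Λ x, Λ y⟫_ℂ = g (star x * y) := by
  let _ := CStarAlgebra.spectralOrder B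
  have _ := CStarAlgebra.spectralOrderedRing B
  let f : B →ₚ[ℂ] ℂ := PositiveLinearMap.mk₀ g (fun x hx => by
    obtain ⟨y, rfl⟩ := CStarAlgebra.nonneg_iff_eq_star_mul_self.mp hx
    exact hg y)
  refine ⟨f.GNS, inferInstance, inferInstance, inferInstance, f.gnsStarAlgHom,
    (UniformSpace.Completion.toComplL (𝕜 := ℂ) (E := f.PreGNS)).toLinearMap ∘ₗ
      f.toPreGNS.toLinearMap, ?_, ?_, ?_⟩
  · exact UniformSpace.Completion.denseRange_coe.comp f.toPreGNS.surjective.denseRange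
      (UniformSpace.Completion.continuous_coe _)
  · intro x y
    exact f.gnsNonUnitalStarAlgHom_apply_coe
  · intro x y
    exact (UniformSpace.Completion.inner_coe _ _).trans (f.preGNS_inner_def _ _)

theorem norm_apply_conj_le (g : B →ₗ[ℂ] ℂ) (hg : ∀ x, 0 ≤ g (star x * x)) (x y : B) :
    ‖g (star y * x * y)‖ ≤ ‖x‖ * (g (star y * y)).re := by
  obtain ⟨H, _, _, _, π, Λ, -, hΛ, hin⟩ := exists_gns g hg
  have h2 : (g (star y * y)).re = ‖Λ y‖ ^ 2 := by
    rw [← hin, ← inner_self_eq_norm_sq (𝕜 := ℂ)]; rfl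
  rw [mul_assoc, ← hin, ← hΛ, h2]
  calc _ ≤ ‖Λ y‖ * ‖π x (Λ y)‖ := norm_inner_le_norm _ _
    _ ≤ ‖Λ y‖ * (‖x‖ * ‖Λ y‖) := by
      gcongr
      exact (ContinuousLinearMap.le_opNorm _ _).trans (by
        gcongr; exact NonUnitalStarAlgHom.norm_apply_le π x)
    _ = _ := by ring

theorem norm_apply_le_of_positive (g : B →ₗ[ℂ] ℂ) (hg : ∀ x, 0 ≤ g (star x * x)) (x : B) :
    ‖g x‖ ≤ ‖x‖ * (g 1).re := by
  simpa using norm_apply_conj_le g hg x 1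

theorem positive_of_norm_le_one (g : B →L[ℂ] ℂ) (hn : ‖g‖ ≤ 1) (h1 : g 1 = 1) (x : B) :
    0 ≤ g (star x * x) := by
  rcases subsingleton_or_nontrivial B with hB | hB
  · simp [Subsingleton.elim (1 : B) 0] at h1
  have hle : ∀ y, ‖g y‖ ≤ ‖y‖ := fun y =>
    (g.le_opNorm y).trans (by nlinarith [norm_nonneg y])
  -- the functional is real on self-adjoint elements
  have him : ∀ a : B, IsSelfAdjoint a → (g a).im = 0 := by
    intro a ha
    have key : ∀ t : ℝ, ((g a).im + t) ^ 2 ≤ ‖a‖ ^ 2 + t ^ 2 := by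
      intro t
      have h := hle (a + (Complex.I * t) • 1)
      have e : star (a + (Complex.I * t) • (1 : B)) * (a + (Complex.I * t) • 1)
          = a * a + ((t ^ 2 : ℝ) : ℂ) • 1 := by
        have hI : Complex.I * Complex.I = -1 := Complex.I_mul_I
        simp only [star_add, ha.star_eq, star_smul, star_one, add_mul, mul_add, smul_mul_assoc,
          mul_smul_comm, one_mul, mul_one, star_mul', Complex.star_def,
          Complex.conj_I, Complex.conj_ofReal]
        have : Complex.I * t * (-Complex.I * t) = ((t ^ 2 : ℝ) : ℂ) := by
          push_cast; linear_combination (-(t : ℂ) ^ 2) * hI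
        rw [smul_add, smul_smul, this]
        module
      have h2 : ‖a + (Complex.I * t) • (1 : B)‖ ^ 2 ≤ ‖a‖ ^ 2 + t ^ 2 := by
        rw [sq, ← CStarRing.norm_star_mul_self, e]
        refine (norm_add_le _ _).trans ?_
        rw [norm_smul, CStarRing.norm_one, mul_one, Complex.norm_real, Real.norm_eq_abs,
          abs_of_nonneg (sq_nonneg t), sq ‖a‖]
        gcongr
        exact norm_mul_le _ _
      have h3 : g (a + (Complex.I * t) • (1 : B)) = g a + Complex.I * t := by simp [h1]
      rw [h3] at h
      have h4 := Complex.abs_im_le_norm (g a + Complex.I * t)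
      have h5 : (g a + Complex.I * t).im = (g a).im + t := by simp
      rw [h5] at h4
      calc _ = |(g a).im + t| ^ 2 := (sq_abs _).symm
        _ ≤ ‖a + (Complex.I * t) • (1 : B)‖ ^ 2 := by
          gcongr; exact h4.trans h
        _ ≤ _ := h2
    by_contra hne
    have h := key ((‖a‖ ^ 2 + 1) / (2 * (g a).im))
    have : (2 * (g a).im) * ((‖a‖ ^ 2 + 1) / (2 * (g a).im)) = ‖a‖ ^ 2 + 1 := by
      field_simp
    nlinarith [sq_nonneg (g a).im]
  have hsa := IsSelfAdjoint.star_mul_self x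
  rw [Complex.nonneg_iff]
  refine ⟨?_, (him _ hsa).symm⟩
  let _ := CStarAlgebra.spectralOrder B
  have _ := CStarAlgebra.spectralOrderedRing B
  by_contra! hneg
  set p := star x * x with hp
  have hp0 : 0 ≤ p := star_mul_self_nonneg x
  have hpne : 0 < ‖p‖ := by
    rw [norm_pos_iff]; intro h; simp [h] at hneg
  have h1' : ‖algebraMap ℝ B ‖p‖ - p‖ ≤ ‖p‖ := by
    have hle1 : p ≤ algebraMap ℝ B ‖p‖ := IsSelfAdjoint.le_algebraMap_norm_self hsa
    have := CStarAlgebra.norm_le_norm_of_nonneg_of_le (a := algebraMap ℝ B ‖p‖ - p)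
      (b := algebraMap ℝ B ‖p‖) (sub_nonneg.mpr hle1) (by simpa using hp0)
    simpa [norm_algebraMap'] using this
  have h2 := hle (algebraMap ℝ B ‖p‖ - p)
  have h3 : g (algebraMap ℝ B ‖p‖ - p) = ‖p‖ - g p := by
    rw [map_sub, Algebra.algebraMap_eq_smul_one, ← Complex.coe_smul, map_smul, h1]; simp
  rw [h3] at h2
  have h4 := (Complex.re_le_norm ((‖p‖ : ℂ) - g p))
  simp at h4
  linarith

theorem exists_state_norm_sq [Nontrivial B] (x : B) :
    ∃ g : B →L[ℂ] ℂ, ‖g‖ ≤ 1 ∧ g 1 = 1 ∧ g (star x * x) = (‖x‖ ^ 2 : ℝ) := by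
  let _ := CStarAlgebra.spectralOrder B
  have _ := CStarAlgebra.spectralOrderedRing B
  set p := star x * x with hp
  have hp0 : 0 ≤ p := star_mul_self_nonneg x
  have hpn : ‖p‖ = ‖x‖ ^ 2 := by rw [hp, CStarRing.norm_star_mul_self, sq]
  have hq : 1 + ‖p‖ ≤ ‖1 + p‖ := by
    have hmem : ‖p‖ ∈ spectrum ℝ p := CStarAlgebra.norm_mem_spectrum_of_nonneg hp0
    have : ‖p‖ + 1 ∈ spectrum ℝ (algebraMap ℝ B 1 + p) := spectrum.add_mem_add_iff.mpr hmem
    rw [map_one] at this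
    have h := spectrum.norm_le_norm_of_mem this
    have h' := Real.le_norm_self (‖p‖ + 1)
    linarith
  obtain ⟨g, hg, hgq⟩ := exists_dual_vector'' ℂ (1 + p)
  have hle : ∀ y, ‖g y‖ ≤ ‖y‖ := fun y =>
    (g.le_opNorm y).trans (by nlinarith [norm_nonneg y])
  have h1 := hle 1
  rw [CStarRing.norm_one] at h1
  have h2 := hle p
  have hre : (g 1).re + (g p).re = ‖1 + p‖ := by
    rw [← Complex.add_re, ← map_add, hgq]; simp
  have hsum : g 1 + g p = ((‖1 + p‖ : ℝ) : ℂ) := by rw [← map_add, hgq]; simp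
  have hg1 : g 1 = 1 := by
    have e1 := Complex.re_le_norm (g 1)
    have e2 := Complex.re_le_norm (g p)
    have e3 : (g 1).re = 1 := by linarith
    have e4 := Complex.sq_norm_sub_sq_re (g 1)
    have e5 : (g 1).im = 0 := by
      rw [e3] at e4
      nlinarith [norm_nonneg (g 1), sq_nonneg (g 1).im]
    exact Complex.ext (by simpa using e3) (by simpa using e5)
  refine ⟨g, hg, hg1, ?_⟩
  have e2 := Complex.re_le_norm (g p)
  have e3 : ‖1 + p‖ ≤ 1 + ‖p‖ := by simpa using norm_add_le (1 : B) p
  rw [hg1] at hsum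
  rw [← hpn, eq_sub_of_add_eq' hsum, le_antisymm e3 hq]
  simp

end Functionals

namespace CStarTensor

variable {A : Type u} {B : Type v} {T : Type w} [NonUnitalCStarAlgebra A]
  [NonUnitalCStarAlgebra B] [NonUnitalCStarAlgebra T] (h : CStarTensor A B T)

/-- The tensor map of a C*-tensor product as a bilinear map. -/
def bilin : A →ₗ[ℂ] B →ₗ[ℂ] T :=
  LinearMap.mk₂ ℂ h.tmul h.add_left h.smul_left h.add_right h.smul_right

@[simp] theorem bilin_apply (a : A) (b : B) : h.bilin a b = h.tmul a b := rfl

/-- The canonical map from the algebraic tensor product. -/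
def ofAlg : A ⊗[ℂ] B →ₗ[ℂ] T := TensorProduct.lift h.bilin

@[simp] theorem ofAlg_tmul (a : A) (b : B) : h.ofAlg (a ⊗ₜ b) = h.tmul a b := rfl

theorem denseRange_ofAlg : DenseRange h.ofAlg := by
  have e : (Set.range h.ofAlg) = (Submodule.span ℂ {t : T | ∃ a b, h.tmul a b = t} : Set T) := by
    rw [← LinearMap.coe_range, SetLike.coe_set_eq, LinearMap.range_eq_map,
      ← TensorProduct.span_tmul_eq_top, Submodule.map_span]
    congr 1
    ext t
    simp [Set.mem_image]
  rw [DenseRange, e]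
  exact h.dense_span

theorem ofAlg_sum {ι : Type*} (s : Finset ι) (a : ι → A) (b : ι → B) :
    h.ofAlg (∑ i ∈ s, a i ⊗ₜ b i) = ∑ i ∈ s, h.tmul (a i) (b i) := by simp

theorem exists_norm_sub_sum_lt (x : T) {ε : ℝ} (hε : 0 < ε) :
    ∃ (n : ℕ) (a : Fin n → A) (b : Fin n → B), ‖x - ∑ i, h.tmul (a i) (b i)‖ < ε := by
  obtain ⟨y, hy⟩ := h.denseRange_ofAlg.exists_dist_lt x hε
  obtain ⟨s, rfl⟩ := TensorProduct.exists_finset y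
  refine ⟨s.card, fun i => (s.equivFin.symm i).1.1, fun i => (s.equivFin.symm i).1.2, ?_⟩
  rw [s.equivFin.symm.sum_comp (fun i : s => h.tmul i.1.1 i.1.2),
    Finset.sum_coe_sort s (fun i => h.tmul i.1 i.2), ← h.ofAlg_sum, ← dist_eq_norm]
  exact hy

theorem induction {p : T → Prop} (hc : IsClosed {x | p x})
    (h1 : ∀ a b, p (h.tmul a b)) (h2 : ∀ x y, p x → p y → p (x + y)) (x : T) : p x := by
  refine h.denseRange_ofAlg.induction_on x hc fun y => ?_
  induction y using TensorProduct.induction_on with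
  | zero => simpa [show h.tmul 0 0 = 0 from (h.bilin 0).map_zero] using h1 0 0
  | tmul a b => exact h1 a b
  | add y z hy hz => simpa using h2 _ _ hy hz

theorem continuousLinearMap_ext {E : Type*} [NormedAddCommGroup E] [NormedSpace ℂ E]
    {f g : T →L[ℂ] E} (hfg : ∀ a b, f (h.tmul a b) = g (h.tmul a b)) : f = g := by
  ext x
  exact h.induction (isClosed_eq f.continuous g.continuous) hfg
    (fun x y hx hy => by simp [hx, hy]) x

theorem continuous_tmul : Continuous fun p : A × B => h.tmul p.1 p.2 := by
  let f : A →L[ℂ] B →L[ℂ] T := h.bilin.mkContinuous₂ 1 fun a b => by simp [h.norm_tmul]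
  exact f.continuous₂

theorem exists_extend {E : Type*} [NormedAddCommGroup E] [NormedSpace ℂ E] [CompleteSpace E]
    (f : A →ₗ[ℂ] B →ₗ[ℂ] E) {C : ℝ}
    (hf : ∀ (n : ℕ) (a : Fin n → A) (b : Fin n → B),
      ‖∑ i, f (a i) (b i)‖ ≤ C * ‖∑ i, h.tmul (a i) (b i)‖) :
    ∃ F : T →L[ℂ] E, (∀ a b, F (h.tmul a b) = f a b) ∧ ∀ x, ‖F x‖ ≤ C * ‖x‖ := by
  have hb : ∀ y : A ⊗[ℂ] B, ‖TensorProduct.lift f y‖ ≤ C * ‖h.ofAlg y‖ := by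
    intro y
    obtain ⟨s, rfl⟩ := TensorProduct.exists_finset y
    have := hf s.card (fun i => (s.equivFin.symm i).1.1) (fun i => (s.equivFin.symm i).1.2)
    rw [s.equivFin.symm.sum_comp (fun i : s => h.tmul i.1.1 i.1.2),
      Finset.sum_coe_sort s (fun i => h.tmul i.1 i.2),
      s.equivFin.symm.sum_comp (fun i : s => f i.1.1 i.1.2),
      Finset.sum_coe_sort s (fun i => f i.1 i.2)] at this
    simpa using this
  refine ⟨(TensorProduct.lift f).extendOfNorm h.ofAlg, fun a b => ?_, fun x => ?_⟩
  · exact LinearMap.extendOfNorm_eq h.denseRange_ofAlg ⟨C, hb⟩ (a ⊗ₜ b)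
  · exact LinearMap.norm_extendOfNorm_apply_le h.denseRange_ofAlg C hb x

section Unital

variable {A : Type u} {B : Type v} {T : Type w} [CStarAlgebra A] [CStarAlgebra B]
  [CStarAlgebra T] (h : CStarTensor A B T)

/-- The second-factor embedding as a unital *-homomorphism. -/
def inr (hu : h.tmul 1 1 = 1) : B →⋆ₐ[ℂ] T where
  toFun b := h.tmul 1 b
  map_one' := hu
  map_mul' a b := by simp [h.mul_tmul]
  map_zero' := (h.bilin 1).map_zero
  map_add' a b := h.add_right 1 a b
  commutes' r := by simp [Algebra.algebraMap_eq_smul_one, h.smul_right, hu]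
  map_star' a := by simp [h.star_tmul]

end Unital

end CStarTensor

section ProductState

open scoped ComplexOrder

theorem sq_apply_re_mem {B : Type u} [CStarAlgebra B] (g : B →L[ℂ] ℂ) (hn : ‖g‖ ≤ 1)
    (h1 : g 1 = 1) (x : B) : g (star x * x) = ((g (star x * x)).re : ℂ) ∧
      0 ≤ (g (star x * x)).re := by
  have := positive_of_norm_le_one g hn h1 x
  rw [Complex.nonneg_iff] at this
  exact ⟨Complex.ext rfl (by simpa using this.2.symm), this.1⟩

theorem exists_star_mul_self_add_eq_one {B : Type u} [CStarAlgebra B] (c : B) (hc : ‖c‖ ≤ 1) :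
    ∃ c' : B, star c * c + star c' * c' = 1 := by
  let _ := CStarAlgebra.spectralOrder B
  have _ := CStarAlgebra.spectralOrderedRing B
  have h1 : star c * c ≤ 1 := by
    rcases subsingleton_or_nontrivial B with hB | hB
    · exact (Subsingleton.elim _ _).le
    have := CStarAlgebra.norm_le_one_iff_of_nonneg (star c * c) (star_mul_self_nonneg c)
    rw [← this, CStarRing.norm_star_mul_self]
    nlinarith [norm_nonneg c]
  obtain ⟨c', hc'⟩ := CStarAlgebra.nonneg_iff_eq_star_mul_self.mp (sub_nonneg.mpr h1)
  exact ⟨c', by rw [← hc']; abel⟩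

/-- The functional `x ↦ Φ (star y * x * y)`. -/
def conjFunctional {B : Type u} [CStarAlgebra B] (Φ : B →L[ℂ] ℂ) (y : B) : B →L[ℂ] ℂ :=
  Φ.comp ((ContinuousLinearMap.mul ℂ B).flip y ∘L ContinuousLinearMap.mul ℂ B (star y))

theorem CStarTensor.exists_product_state {A : Type u} {B : Type v} {T : Type w} [CStarAlgebra A]
    [CStarAlgebra B] [CStarAlgebra T] [Nontrivial T] (h : CStarTensor A B T)
    (hu : h.tmul 1 1 = 1) :
    ∃ Φ : T →L[ℂ] ℂ, ‖Φ‖ ≤ 1 ∧ Φ 1 = 1 ∧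
      ∀ a b, Φ (h.tmul a b) = Φ (h.tmul a 1) * Φ (h.tmul 1 b) := by
  let S : Set (T →L[ℂ] ℂ) := {Φ | ‖Φ‖ ≤ 1 ∧ Φ 1 = 1}
  let r : WeakDual ℂ T →ₗ[ℝ] (A → ℂ) :=
    { toFun := fun Φ a => Φ (h.tmul a 1)
      map_add' := fun _ _ => rfl
      map_smul' := fun _ _ => rfl }
  have hr : Continuous r := continuous_pi fun a => WeakDual.eval_continuous _
  let S' : Set (WeakDual ℂ T) := WeakDual.toStrongDual ⁻¹' S
  have hS'c : IsCompact S' := by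
    have h1 := WeakDual.isCompact_closedBall (𝕜 := ℂ) (E := T) 0 1
    have h2 : IsClosed {Φ : WeakDual ℂ T | Φ 1 = 1} :=
      isClosed_eq (WeakDual.eval_continuous _) continuous_const
    convert h1.inter_right h2 using 1
    ext Φ
    simp [S', S]
  have hne : S'.Nonempty := by
    obtain ⟨g, hg, hg1, -⟩ := exists_state_norm_sq (1 : T)
    exact ⟨WeakDual.toStrongDual.symm g, hg, hg1⟩
  obtain ⟨φ, hφ⟩ := (hS'c.image hr).extremePoints_nonempty (hne.image r)
  obtain ⟨⟨Φ, hΦ, rfl⟩, hext⟩ := hφ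
  let Ψ : T →L[ℂ] ℂ := WeakDual.toStrongDual Φ
  have hΨ : ‖Ψ‖ ≤ 1 ∧ Ψ 1 = 1 := hΦ
  refine ⟨Ψ, hΨ.1, hΨ.2, ?_⟩
  have hpos := positive_of_norm_le_one Ψ hΨ.1 hΨ.2
  have hle : ∀ y x, ‖Ψ (star y * x * y)‖ ≤ ‖x‖ * (Ψ (star y * y)).re :=
    fun y x => norm_apply_conj_le (Ψ : T →ₗ[ℂ] ℂ) hpos x y
  have key : ∀ c : B, ‖c‖ ≤ 1 → ∀ a, Ψ (h.tmul a (star c * c)) =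
      Ψ (h.tmul a 1) * Ψ (h.tmul 1 (star c * c)) := by
    intro c hc
    obtain ⟨c', hcc⟩ := exists_star_mul_self_add_eq_one c hc
    have hconj : ∀ (c : B) a, star (h.tmul 1 c) * h.tmul a 1 * h.tmul 1 c =
        h.tmul a (star c * c) := by
      intro c a; simp [h.star_tmul, h.mul_tmul]
    have hmul : ∀ c : B, star (h.tmul 1 c) * h.tmul 1 c = h.tmul 1 (star c * c) := by
      intro c; simp [h.star_tmul, h.mul_tmul]
    obtain ⟨ht, ht0⟩ := sq_apply_re_mem Ψ hΨ.1 hΨ.2 (h.tmul 1 c)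
    obtain ⟨hs, hs0⟩ := sq_apply_re_mem Ψ hΨ.1 hΨ.2 (h.tmul 1 c')
    rw [hmul] at ht ht0 hs hs0
    set t := (Ψ (h.tmul 1 (star c * c))).re
    set s := (Ψ (h.tmul 1 (star c' * c'))).re
    have hsum : ∀ a, Ψ (h.tmul a (star c * c)) + Ψ (h.tmul a (star c' * c')) =
        Ψ (h.tmul a 1) := by
      intro a; rw [← map_add, ← h.add_right, hcc]
    have hts : t + s = 1 := by
      have := hsum 1
      rw [hu, hΨ.2, ht, hs] at this
      exact_mod_cast this
    have hbt : ∀ a, ‖Ψ (h.tmul a (star c * c))‖ ≤ ‖h.tmul a (1 : B)‖ * t := by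
      intro a; have := hle (h.tmul 1 c) (h.tmul a 1); rwa [hconj, hmul] at this
    have hbs : ∀ a, ‖Ψ (h.tmul a (star c' * c'))‖ ≤ ‖h.tmul a (1 : B)‖ * s := by
      intro a; have := hle (h.tmul 1 c') (h.tmul a 1); rwa [hconj, hmul] at this
    intro a
    rw [ht]
    rcases ht0.eq_or_lt with h0 | htpos
    · have := hbt a
      rw [← h0, mul_zero, norm_le_zero_iff] at this
      rw [this, ← h0]; simp
    rcases hs0.eq_or_lt with h0 | hspos
    · have := hbs a
      rw [← h0, mul_zero, norm_le_zero_iff] at this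
      have h2 := hsum a
      have h3 : t = 1 := by linarith
      rw [this, add_zero] at h2
      rw [h2, h3]; simp
    have hmem : ∀ (c : B) (t : ℝ), Ψ (h.tmul 1 (star c * c)) = t → 0 < t →
        ∃ Θ ∈ S', ∀ a, Ψ (h.tmul a (star c * c)) = t * r Θ a := by
      intro c t ht htpos
      have ht' : (t : ℂ) ≠ 0 := by exact_mod_cast htpos.ne'
      refine ⟨WeakDual.toStrongDual.symm ((t : ℂ)⁻¹ • conjFunctional Ψ (h.tmul 1 c)),
        ⟨?_, ?_⟩, ?_⟩
      · refine ContinuousLinearMap.opNorm_le_bound _ zero_le_one fun x => ?_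
        have := hle (h.tmul 1 c) x
        rw [hmul, ht, Complex.ofReal_re] at this
        change ‖(t : ℂ)⁻¹ • Ψ (star (h.tmul 1 c) * x * h.tmul 1 c)‖ ≤ 1 * ‖x‖
        rw [norm_smul, norm_inv, Complex.norm_real, Real.norm_of_nonneg htpos.le, one_mul,
          inv_mul_le_iff₀ htpos]
        linarith
      · change (t : ℂ)⁻¹ • Ψ (star (h.tmul 1 c) * 1 * h.tmul 1 c) = 1
        rw [mul_one, hmul, ht, smul_eq_mul, inv_mul_cancel₀ ht']
      · intro a
        change _ = (t : ℂ) * ((t : ℂ)⁻¹ • Ψ (star (h.tmul 1 c) * h.tmul a 1 * h.tmul 1 c))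
        rw [hconj, smul_eq_mul, mul_inv_cancel_left₀ ht']
    obtain ⟨Θ, hΘ, hΘr⟩ := hmem c t ht htpos
    obtain ⟨Θ', hΘ', hΘr'⟩ := hmem c' s hs hspos
    have heq := hext (Set.mem_image_of_mem r hΘ) (Set.mem_image_of_mem r hΘ')
      ⟨t, s, htpos, hspos, hts, by
        funext a
        have : r Φ a = Ψ (h.tmul a 1) := rfl
        rw [this, ← hsum a, hΘr, hΘr']
        simp⟩
    rw [hΘr, congrFun heq a, mul_comm]
    rfl
  have key2 : ∀ (c : B) a, Ψ (h.tmul a (star c * c)) =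
      Ψ (h.tmul a 1) * Ψ (h.tmul 1 (star c * c)) := by
    intro c a
    let k : ℂ := ((1 + ‖c‖ : ℝ) : ℂ)
    have hk : k ≠ 0 := Complex.ofReal_ne_zero.mpr (by positivity)
    have h1 := key (k⁻¹ • c) (by
      rw [norm_smul, norm_inv, Complex.norm_real, Real.norm_of_nonneg (by positivity),
        inv_mul_le_iff₀ (by positivity)]
      linarith) a
    have h2 : star (k⁻¹ • c) * (k⁻¹ • c) = (star k⁻¹ * k⁻¹) • (star c * c) := by
      rw [star_smul, smul_mul_smul_comm]
    have h3 : star k⁻¹ * k⁻¹ ≠ 0 := by simp [hk]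
    rw [h2, h.smul_right, h.smul_right, map_smul, map_smul, smul_eq_mul, smul_eq_mul,
      mul_left_comm] at h1
    exact mul_left_cancel₀ h3 h1
  intro a b
  let _ := CStarAlgebra.spectralOrder B
  have _ := CStarAlgebra.spectralOrderedRing B
  have hb : b ∈ Submodule.span ℂ {p : B | 0 ≤ p} := by
    rw [CStarAlgebra.span_nonneg]; trivial
  induction hb using Submodule.span_induction with
  | mem p hp =>
    obtain ⟨c, rfl⟩ := CStarAlgebra.nonneg_iff_eq_star_mul_self.mp (Set.mem_ofPred.mp hp)
    exact key2 c a
  | zero =>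
    have h0 : ∀ a, h.tmul a 0 = 0 := fun a => (h.bilin a).map_zero
    rw [h0, h0, map_zero, mul_zero]
  | add x y _ _ hx hy => rw [h.add_right, h.add_right, map_add, map_add, hx, hy]; ring
  | smul k x _ hx =>
    rw [h.smul_right, h.smul_right, map_smul, map_smul, hx, smul_eq_mul, smul_eq_mul]; ring

end ProductState

theorem continuous_starHom {A : Type*} {B : Type*} {F : Type*} [NonUnitalCStarAlgebra A]
    [NonUnitalCStarAlgebra B] [FunLike F A B] [NonUnitalAlgHomClass F ℂ A B]
    [StarHomClass F A B] (f : F) : Continuous f :=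
  AddMonoidHomClass.continuous_of_bound f 1 fun x => by
    simpa using NonUnitalStarAlgHom.norm_apply_le f x

section FinApproxEquiv

variable {X : Type*} {Y : Type*} {B : Type*} {C : Type*} [CStarAlgebra B] [CStarAlgebra C]

/-- Approximate unitary equivalence of maps into a unital C*-algebra, on finite sets. -/
def FinApproxEquiv (f g : X → B) : Prop :=
  ∀ (F : Finset X) (ε : ℝ), 0 < ε → ∃ u ∈ unitary B, ∀ x ∈ F, ‖star u * f x * u - g x‖ < ε

theorem norm_star_mul_mul_of_mem_unitary {u : B} (hu : u ∈ unitary B) (x : B) :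
    ‖star u * x * u‖ = ‖x‖ := by
  rw [CStarRing.norm_mul_mem_unitary _ hu, CStarRing.norm_mem_unitary_mul _ (Unitary.star_mem hu)]

theorem norm_mul_mul_star_of_mem_unitary {u : B} (hu : u ∈ unitary B) (x : B) :
    ‖u * x * star u‖ = ‖x‖ := by
  rw [CStarRing.norm_mul_mem_unitary _ (Unitary.star_mem hu), CStarRing.norm_mem_unitary_mul _ hu]

theorem star_conj_sub {u : B} (hu : u ∈ unitary B) (x y : B) :
    u * y * star u - x = -(u * (star u * x * u - y) * star u) := by
  have h := Unitary.mul_star_self_of_mem hu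
  have e : u * (star u * x * u) * star u = x := by
    calc _ = (u * star u) * x * (u * star u) := by noncomm_ring
      _ = x := by rw [h]; simp
  rw [mul_sub, sub_mul, e]; abel

theorem FinApproxEquiv.symm {f g : X → B} (h : FinApproxEquiv f g) : FinApproxEquiv g f := by
  intro F ε hε
  obtain ⟨u, hu, huF⟩ := h F ε hε
  refine ⟨star u, Unitary.star_mem hu, fun x hx => ?_⟩
  rw [star_star, star_conj_sub hu, norm_neg, norm_mul_mul_star_of_mem_unitary hu]
  exact huF x hx

theorem FinApproxEquiv.trans {f g k : X → B} (h : FinApproxEquiv f g) (h' : FinApproxEquiv g k) :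
    FinApproxEquiv f k := by
  intro F ε hε
  obtain ⟨u, hu, huF⟩ := h F (ε / 2) (half_pos hε)
  obtain ⟨v, hv, hvF⟩ := h' F (ε / 2) (half_pos hε)
  refine ⟨u * v, mul_mem hu hv, fun x hx => ?_⟩
  have e : star (u * v) * f x * (u * v) - k x =
      star v * (star u * f x * u - g x) * v + (star v * g x * v - k x) := by
    rw [star_mul]; noncomm_ring
  rw [e]
  refine (norm_add_le _ _).trans_lt ?_
  rw [norm_star_mul_mul_of_mem_unitary hv]
  linarith [huF x hx, hvF x hx]

theorem FinApproxEquiv.map {f g : X → B} (h : FinApproxEquiv f g) (π : B →⋆ₐ[ℂ] C) :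
    FinApproxEquiv (fun x => π (f x)) (fun x => π (g x)) := by
  intro F ε hε
  obtain ⟨u, hu, huF⟩ := h F ε hε
  refine ⟨π u, Unitary.map_mem π hu, fun x hx => ?_⟩
  rw [← map_star, ← map_mul, ← map_mul, ← map_sub]
  exact (NonUnitalStarAlgHom.norm_apply_le π _).trans_lt (huF x hx)

theorem FinApproxEquiv.comp {f g : X → B} (h : FinApproxEquiv f g) (k : Y → X) :
    FinApproxEquiv (fun y => f (k y)) (fun y => g (k y)) := by
  classical
  intro F ε hε
  obtain ⟨u, hu, huF⟩ := h (F.image k) ε hε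
  exact ⟨u, hu, fun x hx => huF _ (Finset.mem_image_of_mem k hx)⟩

theorem DoubleCentralizer.coe_fst_one (m : 𝓜(ℂ, B)) : ((m.fst 1 : B) : 𝓜(ℂ, B)) = m := by
  have h1 : ∀ y, m.fst y = m.snd 1 * y := fun y => by simpa using (m.central 1 y).symm
  have h2 : ∀ x, m.snd x = x * m.fst 1 := fun x => by simpa using m.central x 1
  have h3 : m.fst 1 = m.snd 1 := by simpa using h1 1
  refine DoubleCentralizer.ext ℂ B _ _ (Prod.ext ?_ ?_)
  · ext y
    change m.fst 1 * y = m.fst y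
    rw [h3, ← h1]
  · ext y
    change y * m.fst 1 = m.snd y
    rw [h2]

theorem DoubleCentralizer.norm_coe (b : B) : ‖(b : 𝓜(ℂ, B))‖ = ‖b‖ := by
  rw [← DoubleCentralizer.norm_fst, DoubleCentralizer.coe_fst]
  exact ContinuousLinearMap.opNorm_mul_apply _ _ _

theorem ApproxUnitaryEquiv.finApproxEquiv {X : Type u} {B : Type v} [CStarAlgebra B] {f g : X → B}
    (h : ApproxUnitaryEquiv f g) : FinApproxEquiv f g := by
  obtain ⟨v, hv, hlim⟩ := h
  intro F ε hε
  have : ∀ᶠ n in atTop, ∀ x ∈ F,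
      ‖star (v n) * (f x : 𝓜(ℂ, B)) * v n - (g x : 𝓜(ℂ, B))‖ < ε := by
    rw [Filter.eventually_all_finset]
    exact fun x _ => (hlim x).eventually_lt_const hε
  obtain ⟨n, hn⟩ := this.exists
  let c := DoubleCentralizer.coeHom (𝕜 := ℂ) (A := B)
  have hc : ∀ b, c b = (b : 𝓜(ℂ, B)) := fun _ => rfl
  have hinj : Function.Injective c := by
    refine (injective_iff_map_eq_zero c).mpr fun b hb => ?_
    rw [← norm_eq_zero, ← DoubleCentralizer.norm_coe, ← hc, hb, norm_zero]
  have hone : c 1 = 1 := DoubleCentralizer.coe_fst_one 1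
  set u := (v n).fst 1 with hu
  have huv : c u = v n := DoubleCentralizer.coe_fst_one (v n)
  refine ⟨u, ?_, fun x hx => ?_⟩
  · rw [Unitary.mem_iff]
    constructor <;> apply hinj <;> rw [map_mul, map_star, huv, hone]
    · exact Unitary.star_mul_self_of_mem (hv n)
    · exact Unitary.mul_star_self_of_mem (hv n)
  · rw [← DoubleCentralizer.norm_coe, ← hc, map_sub, map_mul, map_mul, map_star, huv]
    exact hn x hx

end FinApproxEquiv

section HalfFlip

variable {D TD : Type u} [CStarAlgebra D] [CStarAlgebra TD] (hD : MinTensor D D TD)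

theorem MinTensor.exists_twisted_flip (hDu : hD.tmul 1 1 = 1) (s : D ≃⋆ₐ[ℂ] D) :
    ∃ α : TD →⋆ₐ[ℂ] TD, ∀ a b, α (hD.tmul (s b) a) = hD.tmul a b := by
  have hs : ∀ b, ‖s b‖ = ‖b‖ := fun b =>
    NonUnitalStarAlgHom.norm_map s s.injective b
  let h' : CStarTensor D D TD :=
    { tmul := fun a b => hD.tmul (s b) a
      add_left := fun a a' b => hD.add_right _ _ _
      add_right := fun a b b' => by rw [map_add, hD.add_left]
      smul_left := fun c a b => hD.smul_right _ _ _
      smul_right := fun c a b => by rw [map_smul, hD.smul_left]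
      mul_tmul := fun a a' b b' => by rw [hD.mul_tmul, map_mul]
      star_tmul := fun a b => by rw [hD.star_tmul, map_star]
      norm_tmul := fun a b => by rw [hD.norm_tmul, hs, mul_comm]
      dense_span := by
        convert hD.dense_span using 4
        ext t
        constructor
        · rintro ⟨a, b, rfl⟩; exact ⟨_, _, rfl⟩
        · rintro ⟨a, b, rfl⟩; exact ⟨b, s.symm a, by simp⟩ }
  obtain ⟨π, hπ⟩ := hD.minimal TD h'
  have h1 : h'.tmul 1 1 = 1 := by change hD.tmul (s 1) 1 = 1; rw [map_one, hDu]
  have hπ1 : π 1 = 1 := by simpa [h1, hDu] using hπ 1 1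
  exact ⟨{ π with
    map_one' := hπ1
    commutes' := fun r => by
      change π _ = _
      rw [Algebra.algebraMap_eq_smul_one, map_smul, hπ1] }, hπ⟩

theorem MinTensor.exists_flip (hDu : hD.tmul 1 1 = 1) :
    ∃ σ : TD ≃⋆ₐ[ℂ] TD, ∀ a b, σ (hD.tmul a b) = hD.tmul b a := by
  obtain ⟨α, hα⟩ := hD.exists_twisted_flip hDu (StarAlgEquiv.refl ℂ D)
  have hα' : ∀ a b, α (hD.tmul a b) = hD.tmul b a := fun a b => hα b a
  have hαα : ∀ x, α (α x) = x := by
    have hc : Continuous α := continuous_starHom α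
    refine hD.induction (isClosed_eq (hc.comp hc) continuous_id) ?_ ?_
    · intro a b; rw [hα', hα']
    · intro x y hx hy; rw [map_add, map_add, hx, hy]
  exact ⟨StarAlgEquiv.ofBijective α (Function.bijective_iff_has_inverse.mpr ⟨α, hαα, hαα⟩), hα'⟩

theorem IsStronglySelfAbsorbing.finApproxEquiv_fst_snd (hDu : hD.tmul 1 1 = 1)
    (hssa : IsStronglySelfAbsorbing hD) :
    FinApproxEquiv (fun d => hD.tmul d 1) (fun d => hD.tmul 1 d) := by
  obtain ⟨-, φ, hφ⟩ := hssa
  have hφ' : FinApproxEquiv φ (fun d => hD.tmul d 1) := hφ.finApproxEquiv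
  obtain ⟨σ, hσ⟩ := hD.exists_flip hDu
  have hσσ : ∀ x, σ (σ x) = x := by
    have hc : Continuous σ := continuous_starHom σ
    refine hD.induction (isClosed_eq (hc.comp hc) continuous_id) ?_ ?_
    · intro a b; rw [hσ, hσ]
    · intro x y hx hy; rw [map_add, map_add, hx, hy]
  let s : D ≃⋆ₐ[ℂ] D := (φ.trans σ).trans φ.symm
  have hs : ∀ d, s d = φ.symm (σ (φ d)) := fun _ => rfl
  have hss : ∀ d, s (s d) = d := fun d => by simp [hs, hσσ]
  obtain ⟨α, hα⟩ := hD.exists_twisted_flip hDu s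
  have hα' : ∀ d e, α (hD.tmul d e) = hD.tmul e (s d) := fun d e => by
    simpa [hss] using hα e (s d)
  let i₂ := hD.toCStarTensor.inr hDu
  let β : TD →⋆ₐ[ℂ] TD := i₂.comp ((σ.trans φ.symm).toStarAlgHom)
  have hβ : ∀ x, β x = i₂ (φ.symm (σ x)) := fun _ => rfl
  have h1 : FinApproxEquiv (fun d => α (hD.tmul d 1)) (fun d => β (hD.tmul d 1)) := by
    have := hφ'.map β
    simp only [hα', hβ]
    exact this
  have h2 : FinApproxEquiv (fun x => α x) (fun x => β x) := by
    have := ((hφ'.map α).trans h1).trans (hφ'.map β).symm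
    simpa using this.comp φ.symm
  have h3 := h2.comp (fun e => hD.tmul 1 e)
  simp only [hα', hβ, hσ, map_one] at h3
  have h4 := hφ'.symm.map (i₂.comp φ.symm.toStarAlgHom)
  refine h3.trans ?_
  have e : (fun d => hD.tmul 1 d) = fun d => i₂.comp φ.symm.toStarAlgHom (φ d) := by
    funext d
    change _ = i₂ (φ.symm (φ d))
    rw [φ.symm_apply_apply]
    rfl
  rw [e]
  exact h4

end HalfFlip

theorem exists_isApproximateUnit (A : Type*) [NonUnitalCStarAlgebra A] :
    ∃ l : Filter A, l.IsApproximateUnit ∧ ∀ᶠ e in l, IsSelfAdjoint e ∧ ‖e‖ ≤ 1 := by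
  let _ := CStarAlgebra.spectralOrder A
  have _ := CStarAlgebra.spectralOrderedRing A
  have h := CStarAlgebra.increasingApproximateUnit A
  exact ⟨_, h.toIsApproximateUnit, h.eventually_isSelfAdjoint.and h.eventually_norm⟩

theorem NonUnitalStarAlgHom.exists_ker_approx_unit {A : Type*} {C : Type*}
    [NonUnitalCStarAlgebra A] [NonUnitalCStarAlgebra C] (π : A →⋆ₙₐ[ℂ] C) {ι : Type*} [Finite ι]
    (p : ι → A) (hp : ∀ i, π (p i) = 0) {ε : ℝ} (hε : 0 < ε) :
    ∃ f : A, π f = 0 ∧ ‖f‖ ≤ 1 ∧ ∀ i, ‖p i - f * p i‖ < ε := by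
  let J : NonUnitalStarSubalgebra ℂ A := (⊥ : NonUnitalStarSubalgebra ℂ C).comap π
  have hJ : ∀ x, x ∈ J ↔ π x = 0 := fun x => by
    rw [NonUnitalStarSubalgebra.mem_comap, NonUnitalStarAlgebra.mem_bot]
  have : IsClosed (J : Set A) := by
    have e : (J : Set A) = {x | π x = 0} := Set.ext hJ
    rw [e]
    exact isClosed_eq (continuous_starHom π) continuous_const
  obtain ⟨l, hl, hl1⟩ := exists_isApproximateUnit J
  have := hl.neBot
  have h2 : ∀ᶠ f : J in l, ∀ i, ‖p i - f * p i‖ < ε := by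
    rw [Filter.eventually_all]
    intro i
    have h3 := hl.tendsto_mul_right ⟨p i, (hJ _).mpr (hp i)⟩
    rw [tendsto_iff_norm_sub_tendsto_zero] at h3
    filter_upwards [h3.eventually_lt_const hε] with f hf
    rw [norm_sub_rev]
    exact hf
  obtain ⟨f, hf1, hf2⟩ := (hl1.and h2).exists
  exact ⟨f, (hJ _).mp f.2, hf1.2, hf2⟩

section Slice

open scoped ComplexOrder InnerProductSpace

theorem ContinuousLinearMap.opNorm_le_of_denseRange_inner {V H : Type*} [NormedAddCommGroup H]
    [InnerProductSpace ℂ H] (Λ : V → H) (hΛ : DenseRange Λ) (S : H →L[ℂ] H) {C : ℝ} (hC : 0 ≤ C)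
    (hS : ∀ c d, ‖⟪Λ c, S (Λ d)⟫_ℂ‖ ≤ C * ‖Λ c‖ * ‖Λ d‖) : ‖S‖ ≤ C := by
  refine S.opNorm_le_bound hC fun v => ?_
  have key : ∀ d, ‖S (Λ d)‖ ≤ C * ‖Λ d‖ := by
    intro d
    have : ∀ v, ‖⟪v, S (Λ d)⟫_ℂ‖ ≤ C * ‖v‖ * ‖Λ d‖ := fun v =>
      hΛ.induction_on v (isClosed_le (by fun_prop) (by fun_prop)) fun c => hS c d
    have h1 := this (S (Λ d))
    rw [inner_self_eq_norm_sq_to_K] at h1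
    have h2 : ‖S (Λ d)‖ * ‖S (Λ d)‖ ≤ ‖S (Λ d)‖ * (C * ‖Λ d‖) := by
      have e : ‖((‖S (Λ d)‖ : ℂ)) ^ 2‖ = ‖S (Λ d)‖ * ‖S (Λ d)‖ := by simp [sq]
      calc _ = ‖((‖S (Λ d)‖ : ℂ)) ^ 2‖ := e.symm
        _ ≤ _ := h1
        _ = _ := by ring
    rcases (norm_nonneg (S (Λ d))).eq_or_lt with h0 | h0
    · rw [← h0]; positivity
    · exact le_of_mul_le_mul_left h2 h0
  exact hΛ.induction_on v (isClosed_le (by fun_prop) (by fun_prop)) key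

variable {D TD : Type u} [CStarAlgebra D] [CStarAlgebra TD]

theorem CStarTensor.injective_of_halfFlip (hD : CStarTensor D D TD)
    (hflip : FinApproxEquiv (fun d => hD.tmul d 1) (fun d => hD.tmul 1 d))
    {C : Type*} [CStarAlgebra C] [Nontrivial C] (π : D →⋆ₐ[ℂ] C) : Function.Injective π := by
  refine (injective_iff_map_eq_zero π).mpr fun d hd => ?_
  by_contra hne
  have hd0 : 0 < ‖d‖ := norm_pos_iff.mpr hne
  have : Nontrivial D := ⟨⟨d, 0, hne⟩⟩
  have : Nontrivial TD := ⟨⟨hD.tmul d 1, 0, by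
    rw [← norm_ne_zero_iff, hD.norm_tmul, norm_one, mul_one]; exact hd0.ne'⟩⟩
  let ε : ℝ := ‖d‖ / 8
  have hε : 0 < ε := by positivity
  obtain ⟨u, hu, hud⟩ := hflip {d} ε hε
  have hud := hud d (Finset.mem_singleton_self d)
  -- approximate the unitary by elements of the algebraic tensor product
  have hcont : Tendsto (fun z => ‖star z * hD.tmul d 1 * z - hD.tmul 1 d‖) (𝓝 u)
      (𝓝 ‖star u * hD.tmul d 1 * u - hD.tmul 1 d‖) := by
    have : Continuous fun z => ‖star z * hD.tmul d 1 * z - hD.tmul 1 d‖ := by fun_prop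
    exact this.tendsto u
  obtain ⟨δ, hδ, hball⟩ := Metric.eventually_nhds_iff.mp (hcont.eventually_lt_const hud)
  obtain ⟨n, c, e, hz⟩ := hD.exists_norm_sub_sum_lt u hδ
  have hz' := hball (y := ∑ i, hD.tmul (c i) (e i)) (by rwa [dist_comm, dist_eq_norm])
  have hexp : star (∑ i, hD.tmul (c i) (e i)) * hD.tmul d 1 * ∑ i, hD.tmul (c i) (e i) =
      ∑ p : Fin n × Fin n, hD.tmul (star (c p.1) * d * c p.2) (star (e p.1) * e p.2) := by
    rw [star_sum, Finset.sum_mul, Finset.sum_mul_sum, ← Finset.sum_product']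
    simp [hD.star_tmul, hD.mul_tmul]
  rw [hexp] at hz'
  set M := ∑ p : Fin n × Fin n, ‖star (e p.1) * e p.2‖ with hM
  have hM0 : 0 ≤ M := Finset.sum_nonneg fun _ _ => norm_nonneg _
  obtain ⟨f, hf0, hf1, hf⟩ := NonUnitalStarAlgHom.exists_ker_approx_unit
    (π : D →⋆ₙₐ[ℂ] C) (fun p : Fin n × Fin n => star (c p.1) * d * c p.2)
    (fun p => by change π _ = 0; simp [hd]) (ε := ε / (M + 1)) (by positivity)
  have hX : ‖∑ p : Fin n × Fin n, hD.tmul (star (c p.1) * d * c p.2 -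
      f * (star (c p.1) * d * c p.2)) (star (e p.1) * e p.2)‖ ≤ ε := by
    calc _ ≤ ∑ p : Fin n × Fin n, ε / (M + 1) * ‖star (e p.1) * e p.2‖ := by
          refine norm_sum_le_of_le _ fun p _ => ?_
          rw [hD.norm_tmul]
          gcongr
          exact (hf p).le
      _ = ε * (M / (M + 1)) := by rw [← Finset.mul_sum]; ring
      _ ≤ ε * 1 := by
          gcongr
          rw [div_le_one (by positivity)]; linarith
      _ = ε := mul_one ε
  have hsplit : hD.tmul (1 - f) d = (∑ p : Fin n × Fin n, hD.tmul (star (c p.1) * d * c p.2 -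
      f * (star (c p.1) * d * c p.2)) (star (e p.1) * e p.2)) - hD.tmul (1 - f) 1 *
      (∑ p : Fin n × Fin n, hD.tmul (star (c p.1) * d * c p.2) (star (e p.1) * e p.2) -
        hD.tmul 1 d) := by
    rw [mul_sub, Finset.mul_sum]
    simp only [hD.mul_tmul, one_mul, mul_one, sub_mul]
    abel
  have h1 : ‖1 - f‖ * ‖d‖ ≤ ε + 2 * ε := by
    rw [← hD.norm_tmul, hsplit]
    refine (norm_sub_le _ _).trans (add_le_add hX ((norm_mul_le _ _).trans ?_))
    rw [hD.norm_tmul, norm_one, mul_one]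
    have : ‖1 - f‖ ≤ 2 := (norm_sub_le _ _).trans (by rw [norm_one]; linarith)
    gcongr
  have h2 : 1 ≤ ‖1 - f‖ := by
    have h3 := NonUnitalStarAlgHom.norm_apply_le π (1 - f)
    have h4 : π f = 0 := hf0
    rwa [map_sub, map_one, h4, sub_zero, norm_one] at h3
  have h3 : ε = ‖d‖ / 8 := rfl
  nlinarith

theorem CStarTensor.exists_slice [Nontrivial D] (hD : CStarTensor D D TD)
    (hDu : hD.tmul 1 1 = 1)
    (hflip : FinApproxEquiv (fun d => hD.tmul d 1) (fun d => hD.tmul 1 d)) :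
    ∃ (φ : D →L[ℂ] ℂ) (R : TD →L[ℂ] D), (∀ x, 0 ≤ φ (star x * x)) ∧ φ 1 = 1 ∧
      (∀ a b, R (hD.tmul a b) = φ a • b) ∧ ∀ x, ‖R x‖ ≤ ‖x‖ := by
  have : Nontrivial TD := ⟨⟨hD.tmul 1 1, 0, by
    rw [← norm_ne_zero_iff, hD.norm_tmul, norm_one, mul_one]; exact one_ne_zero⟩⟩
  obtain ⟨Φ, hΦn, hΦ1, hΦ⟩ := hD.exists_product_state hDu
  have hΦpos := positive_of_norm_le_one Φ hΦn hΦ1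
  let φ : D →L[ℂ] ℂ := LinearMap.mkContinuous (Φ.toLinearMap ∘ₗ (hD.bilin.flip 1)) 1 fun x => by
    refine (Φ.le_of_opNorm_le hΦn _).trans ?_
    simp [hD.norm_tmul]
  have hφ : ∀ a, φ a = Φ (hD.tmul a 1) := fun _ => rfl
  let ψ : D →ₗ[ℂ] ℂ := Φ.toLinearMap ∘ₗ (hD.bilin 1)
  have hψ : ∀ a, ψ a = Φ (hD.tmul 1 a) := fun _ => rfl
  have hφpos : ∀ x, 0 ≤ φ (star x * x) := fun x => by
    have := hΦpos (hD.tmul x 1)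
    rw [hφ]
    simpa [hD.star_tmul, hD.mul_tmul] using this
  have hψpos : ∀ x, 0 ≤ ψ (star x * x) := fun x => by
    have := hΦpos (hD.tmul 1 x)
    rw [hψ]
    simpa [hD.star_tmul, hD.mul_tmul] using this
  have hφ1 : φ 1 = 1 := by rw [hφ, hDu, hΦ1]
  obtain ⟨H, _, _, _, π, Λ, hΛd, hΛ, hin⟩ := exists_gns ψ hψpos
  obtain ⟨K, _, _, _, ρ, Λ', -, hΛ', hin'⟩ := exists_gns Φ.toLinearMap hΦpos
  have : Nontrivial H := by
    refine ⟨⟨Λ 1, 0, fun h0 => ?_⟩⟩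
    have := hin 1 1
    rw [h0, inner_zero_left, star_one, one_mul, hψ, hDu, hΦ1] at this
    exact zero_ne_one this
  have hπ : ∀ b, ‖π b‖ = ‖b‖ := fun b =>
    NonUnitalStarAlgHom.norm_map π (hD.injective_of_halfFlip hflip π) b
  have hnorm : ∀ c, ‖Λ' (hD.tmul 1 c)‖ = ‖Λ c‖ := by
    intro c
    have h1 := hin' (hD.tmul 1 c) (hD.tmul 1 c)
    have h2 := hin c c
    rw [hD.star_tmul, hD.mul_tmul, star_one, one_mul] at h1
    have h3 := h1.trans h2.symm
    rw [inner_self_eq_norm_sq_to_K, inner_self_eq_norm_sq_to_K] at h3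
    have h4 : ‖Λ' (hD.tmul 1 c)‖ ^ 2 = ‖Λ c‖ ^ 2 := by exact_mod_cast h3
    exact (sq_eq_sq₀ (norm_nonneg _) (norm_nonneg _)).mp h4
  obtain ⟨R, hR, hRn⟩ := hD.exists_extend ((LinearMap.lsmul ℂ D).comp φ.toLinearMap) (C := 1) (by
    intro n a b
    rw [one_mul, ← hπ]
    refine ContinuousLinearMap.opNorm_le_of_denseRange_inner Λ hΛd _ (norm_nonneg _) fun c d => ?_
    have e : ⟪Λ c, π (∑ i, (LinearMap.lsmul ℂ D).comp φ.toLinearMap (a i) (b i)) (Λ d)⟫_ℂ =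
        ⟪Λ' (hD.tmul 1 c), ρ (∑ i, hD.tmul (a i) (b i)) (Λ' (hD.tmul 1 d))⟫_ℂ := by
      rw [hΛ, hin, hΛ', hin', Finset.sum_mul, Finset.mul_sum, Finset.sum_mul, Finset.mul_sum,
        map_sum, map_sum]
      refine Finset.sum_congr rfl fun i _ => ?_
      rw [hD.star_tmul, hD.mul_tmul, hD.mul_tmul, star_one, one_mul, mul_one]
      change ψ (star c * ((φ (a i) • b i) * d)) = Φ (hD.tmul (a i) (star c * (b i * d)))
      rw [hΦ, smul_mul_assoc, mul_smul_comm, map_smul, smul_eq_mul]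
      rfl
    rw [e, ← hnorm, ← hnorm]
    calc _ ≤ ‖Λ' (hD.tmul 1 c)‖ * ‖ρ (∑ i, hD.tmul (a i) (b i)) (Λ' (hD.tmul 1 d))‖ :=
          norm_inner_le_norm _ _
      _ ≤ ‖Λ' (hD.tmul 1 c)‖ * (‖∑ i, hD.tmul (a i) (b i)‖ * ‖Λ' (hD.tmul 1 d)‖) := by
          gcongr
          exact ContinuousLinearMap.le_of_opNorm_le _ (NonUnitalStarAlgHom.norm_apply_le ρ _) _
      _ = _ := by ring)
  exact ⟨φ, R, hφpos, hφ1, hR, fun x => by simpa using hRn x⟩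

end Slice

section Nuclearity

open scoped ComplexOrder InnerProductSpace

theorem CStarTensor.sum_induction {A : Type u} {B : Type v} {T : Type w} [NonUnitalCStarAlgebra A]
    [NonUnitalCStarAlgebra B] [NonUnitalCStarAlgebra T] (h : CStarTensor A B T) {p : T → Prop}
    (hc : IsClosed {x | p x})
    (hp : ∀ (n : ℕ) (a : Fin n → A) (b : Fin n → B), p (∑ i, h.tmul (a i) (b i))) (x : T) :
    p x := by
  have : x ∈ closure {x | p x} := by
    refine Metric.mem_closure_iff.mpr fun ε hε => ?_
    obtain ⟨n, a, b, hab⟩ := h.exists_norm_sub_sum_lt x hε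
    exact ⟨_, hp n a b, by rwa [dist_eq_norm]⟩
  rwa [hc.closure_eq] at this

variable {D TD : Type u} [CStarAlgebra D] [CStarAlgebra TD]

theorem CStarTensor.exists_finite_rank_approx (hD : CStarTensor D D TD)
    (hflip : FinApproxEquiv (fun d => hD.tmul d 1) (fun d => hD.tmul 1 d))
    (φ : D →L[ℂ] ℂ) (hφ1 : φ 1 = 1) (R : TD →L[ℂ] D) (hR : ∀ a b, R (hD.tmul a b) = φ a • b)
    (hRn : ∀ x, ‖R x‖ ≤ ‖x‖) (F : Finset D) {ε : ℝ} (hε : 0 < ε) :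
    ∃ (n : ℕ) (c e : Fin n → D), ∀ b ∈ F,
      ‖∑ p : Fin n × Fin n, φ (star (c p.1) * b * c p.2) • (star (e p.1) * e p.2) - b‖ < ε := by
  obtain ⟨u, hu, hud⟩ := hflip F ε hε
  have hev : ∀ᶠ z in 𝓝 u, ∀ b ∈ F, ‖star z * hD.tmul b 1 * z - hD.tmul 1 b‖ < ε := by
    rw [Filter.eventually_all_finset]
    intro b hb
    have : Continuous fun z => ‖star z * hD.tmul b 1 * z - hD.tmul 1 b‖ := by fun_prop
    exact (this.tendsto u).eventually_lt_const (hud b hb)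
  obtain ⟨δ, hδ, hball⟩ := Metric.eventually_nhds_iff.mp hev
  obtain ⟨n, c, e, hz⟩ := hD.exists_norm_sub_sum_lt u hδ
  refine ⟨n, c, e, fun b hb => ?_⟩
  have hz' := hball (y := ∑ i, hD.tmul (c i) (e i)) (by rwa [dist_comm, dist_eq_norm]) b hb
  have hexp : star (∑ i, hD.tmul (c i) (e i)) * hD.tmul b 1 * ∑ i, hD.tmul (c i) (e i) =
      ∑ p : Fin n × Fin n, hD.tmul (star (c p.1) * b * c p.2) (star (e p.1) * e p.2) := by
    rw [star_sum, Finset.sum_mul, Finset.sum_mul_sum, ← Finset.sum_product']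
    simp [hD.star_tmul, hD.mul_tmul]
  rw [hexp] at hz'
  have h1 := (hRn _).trans_lt hz'
  simpa [hR, hφ1] using h1

theorem exists_gram_factor (φ : D →ₗ[ℂ] ℂ) (hφ : ∀ x, 0 ≤ φ (star x * x)) {ι : Type} [Fintype ι]
    (y : ι → D) : ∃ (m : ℕ) (w : Fin m → ι → ℂ), ∀ i j,
      φ (star (y i) * y j) = ∑ s, star (w s i) * w s j := by
  classical
  obtain ⟨H, _, _, _, -, Λ, -, -, hin⟩ := exists_gns φ hφ
  obtain ⟨m, v, hv⟩ := Matrix.posSemidef_iff_eq_sum_vecMulVec.mp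
    (Matrix.posSemidef_gram ℂ fun i => Λ (y i))
  refine ⟨m, fun s i => star (v s i), fun i j => ?_⟩
  rw [← hin, ← Matrix.gram_apply (𝕜 := ℂ) (fun i => Λ (y i)), hv, Matrix.sum_apply]
  simp [Matrix.vecMulVec_apply]

/-- Positivity of a bilinear form on the algebraic tensor product. -/
def PositiveBilin (f : D →L[ℂ] D →L[ℂ] ℂ) : Prop :=
  ∀ (n : ℕ) (p q : Fin n → D), 0 ≤ ∑ l, ∑ m, f (star (p l) * p m) (star (q l) * q m)

theorem PositiveBilin.sum_nonneg {f : D →L[ℂ] D →L[ℂ] ℂ} (hf : PositiveBilin f) {ι : Type*}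
    [Fintype ι] (p q : ι → D) :
    0 ≤ ∑ l, ∑ m, f (star (p l) * p m) (star (q l) * q m) := by
  let e := (Fintype.equivFin ι).symm
  convert hf _ (p ∘ e) (q ∘ e) using 1
  rw [← e.sum_comp]
  exact Finset.sum_congr rfl fun l _ => (e.sum_comp _).symm

theorem CStarTensor.norm_sum_le_of_positiveBilin [Nontrivial D] (hD : CStarTensor D D TD)
    (hDu : hD.tmul 1 1 = 1)
    (hflip : FinApproxEquiv (fun d => hD.tmul d 1) (fun d => hD.tmul 1 d))
    (σ : TD ≃⋆ₐ[ℂ] TD) (hσ : ∀ a b, σ (hD.tmul a b) = hD.tmul b a)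
    {f : D →L[ℂ] D →L[ℂ] ℂ} (hf : PositiveBilin f) (n : ℕ) (a b : Fin n → D) :
    ‖∑ i, f (a i) (b i)‖ ≤ (f 1 1).re * ‖∑ i, hD.tmul (a i) (b i)‖ := by
  classical
  obtain ⟨φ, R, hφ, hφ1, hR, hRn⟩ := hD.exists_slice hDu hflip
  let σL : TD →L[ℂ] TD := ⟨(σ : TD →⋆ₐ[ℂ] TD).toAlgHom.toLinearMap, continuous_starHom σ⟩
  let R₂ : TD →L[ℂ] D := R.comp σL
  have hR₂ : ∀ a b, R₂ (hD.tmul a b) = φ b • a := fun a b => by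
    change R (σ _) = _
    rw [hσ, hR]
  -- the bound for the form composed with a finite rank approximation
  have key : ∀ (N : ℕ) (c e : Fin N → D),
      ‖∑ i, f (a i) (∑ p : Fin N × Fin N, φ (star (c p.1) * b i * c p.2) •
        (star (e p.1) * e p.2))‖ ≤
      (f 1 (∑ p : Fin N × Fin N, φ (star (c p.1) * 1 * c p.2) • (star (e p.1) * e p.2))).re *
        ‖∑ i, hD.tmul (a i) (b i)‖ := by
    intro N c e
    let g : TD →L[ℂ] ℂ := ∑ p : Fin N × Fin N, (f.flip (star (e p.1) * e p.2)).comp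
      (R₂.comp ((ContinuousLinearMap.mul ℂ TD).flip (hD.tmul 1 (c p.2)) ∘L
        ContinuousLinearMap.mul ℂ TD (hD.tmul 1 (star (c p.1)))))
    have hg : ∀ a b, g (hD.tmul a b) =
        ∑ p : Fin N × Fin N, φ (star (c p.1) * b * c p.2) • f a (star (e p.1) * e p.2) := by
      intro a b
      simp [g, hD.mul_tmul, hR₂]
    have hg' : ∀ a b, g (hD.tmul a b) = f a (∑ p : Fin N × Fin N,
        φ (star (c p.1) * b * c p.2) • (star (e p.1) * e p.2)) := by
      intro a b
      rw [hg, map_sum]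
      simp
    have hpos : ∀ x, 0 ≤ g (star x * x) := by
      refine hD.sum_induction (isClosed_le continuous_const (by fun_prop)) ?_
      intro n p q
      obtain ⟨m, w, hw⟩ := exists_gram_factor φ.toLinearMap hφ
        (fun i : Fin n × Fin N => q i.1 * c i.2)
      have e1 : g (star (∑ i, hD.tmul (p i) (q i)) * ∑ i, hD.tmul (p i) (q i)) =
          ∑ s, ∑ i : Fin n × Fin N, ∑ j : Fin n × Fin N,
            f (star (p i.1) * p j.1) (star (w s i • e i.2) * (w s j • e j.2)) := by
        have e2 : ∀ i j : Fin n × Fin N, ∑ s, f (star (p i.1) * p j.1)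
            (star (w s i • e i.2) * (w s j • e j.2)) =
            φ (star (c i.2) * (star (q i.1) * q j.1) * c j.2) •
              f (star (p i.1) * p j.1) (star (e i.2) * e j.2) := by
          intro i j
          have := hw i j
          simp only [star_mul] at this
          rw [show star (c i.2) * (star (q i.1) * q j.1) * c j.2 =
            star (c i.2) * star (q i.1) * (q j.1 * c j.2) by noncomm_ring]
          change φ _ = _ at this
          rw [this, Finset.sum_smul]
          refine Finset.sum_congr rfl fun s _ => ?_
          rw [star_smul, smul_mul_smul_comm, map_smul]
        have e3 : ∑ s, ∑ i : Fin n × Fin N, ∑ j : Fin n × Fin N,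
            f (star (p i.1) * p j.1) (star (w s i • e i.2) * (w s j • e j.2)) =
            ∑ i : Fin n × Fin N, ∑ j : Fin n × Fin N,
              φ (star (c i.2) * (star (q i.1) * q j.1) * c j.2) •
                f (star (p i.1) * p j.1) (star (e i.2) * e j.2) := by
          rw [Finset.sum_comm]
          refine Finset.sum_congr rfl fun i _ => ?_
          rw [Finset.sum_comm]
          exact Finset.sum_congr rfl fun j _ => e2 i j
        rw [e3, star_sum, Finset.sum_mul_sum, map_sum]
        simp only [map_sum, hD.star_tmul, hD.mul_tmul, hg, Fintype.sum_prod_type]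
        exact Finset.sum_congr rfl fun l _ => Finset.sum_comm
      rw [e1]
      exact Finset.sum_nonneg fun s _ =>
        hf.sum_nonneg (fun i : Fin n × Fin N => p i.1) (fun i => w s i • e i.2)
    have h1 := norm_apply_le_of_positive g.toLinearMap hpos (∑ i, hD.tmul (a i) (b i))
    change ‖g _‖ ≤ _ * (g 1).re at h1
    rw [map_sum, ← hDu] at h1
    simp only [hg'] at h1
    rwa [mul_comm]
  let F : Finset D := insert 1 (Finset.univ.image b)
  have happrox := fun k : ℕ => hD.exists_finite_rank_approx hflip φ hφ1 R hR hRn F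
    (Nat.one_div_pos_of_nat (α := ℝ) (n := k))
  choose N c e hce using happrox
  have hlim : ∀ y ∈ F, Tendsto (fun k => ∑ p : Fin (N k) × Fin (N k),
      φ (star (c k p.1) * y * c k p.2) • (star (e k p.1) * e k p.2)) atTop (𝓝 y) := by
    intro y hy
    rw [tendsto_iff_norm_sub_tendsto_zero]
    exact squeeze_zero (fun _ => norm_nonneg _) (fun k => (hce k y hy).le)
      tendsto_one_div_add_atTop_nhds_zero_nat
  refine le_of_tendsto_of_tendsto' (Tendsto.norm (tendsto_finsetSum _ fun i _ =>
    ((f (a i)).continuous.tendsto _).comp (hlim (b i) (by simp [F]))))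
    (Tendsto.mul_const _ ((Complex.continuous_re.tendsto _).comp
      (((f 1).continuous.tendsto _).comp (hlim 1 (by simp [F]))))) fun k => key _ (c k) (e k)

end Nuclearity

section Amplification

/-- A contractive bilinear map `A × T → B` that is multiplicative and star-preserving. -/
structure StarPairing (A T B : Type*) [NonUnitalCStarAlgebra A] [NonUnitalCStarAlgebra T]
    [NonUnitalCStarAlgebra B] where
  pair : A →ₗ[ℂ] T →ₗ[ℂ] B
  pair_mul_pair : ∀ a a' x x', pair a x * pair a' x' = pair (a * a') (x * x')
  star_pair : ∀ a x, star (pair a x) = pair (star a) (star x)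
  norm_pair_le : ∀ a x, ‖pair a x‖ ≤ ‖a‖ * ‖x‖

variable {D TD : Type u} [CStarAlgebra D] [CStarAlgebra TD]
  {A T : Type*} {L : Type v} {LD : Type w} [NonUnitalCStarAlgebra A] [NonUnitalCStarAlgebra T]
  [NonUnitalCStarAlgebra L] [NonUnitalCStarAlgebra LD]

theorem CStarTensor.norm_amplify_le [Nontrivial D] (hD : CStarTensor D D TD)
    (hDu : hD.tmul 1 1 = 1)
    (hflip : FinApproxEquiv (fun d => hD.tmul d 1) (fun d => hD.tmul 1 d))
    (σ : TD ≃⋆ₐ[ℂ] TD) (hσ : ∀ a b, σ (hD.tmul a b) = hD.tmul b a)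
    (hA : CStarTensor A D T) (θ : T →⋆ₙₐ[ℂ] L) (hL : CStarTensor L D LD) (e : A)
    (n : ℕ) (a b : Fin n → D) :
    ‖∑ i, hL.tmul (θ (hA.tmul e (a i))) (b i)‖ ≤ ‖e‖ * ‖∑ i, hD.tmul (a i) (b i)‖ := by
  set Y := ∑ i, hL.tmul (θ (hA.tmul e (a i))) (b i)
  set X := ∑ i, hD.tmul (a i) (b i)
  obtain ⟨ω, hω, hω1, hωY⟩ := exists_state_norm_sq (Y : Unitization ℂ LD)
  let g : D →ₗ[ℂ] D →ₗ[ℂ] ℂ := LinearMap.mk₂ ℂ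
    (fun a b => ω (hL.tmul (θ (hA.tmul (star e * e) a)) b : LD))
    (fun a a' b => by simp [hA.add_right, hL.add_left])
    (fun c a b => by simp [hA.smul_right, hL.smul_left])
    (fun a b b' => by simp [hL.add_right])
    (fun c a b => by simp [hL.smul_right])
  have hg : ∀ a b, ‖g a b‖ ≤ ‖e‖ ^ 2 * ‖a‖ * ‖b‖ := by
    intro a b
    calc ‖g a b‖ ≤ 1 * ‖((hL.tmul (θ (hA.tmul (star e * e) a)) b : LD) : Unitization ℂ LD)‖ :=
          (ω.le_opNorm _).trans (by gcongr)
      _ = ‖θ (hA.tmul (star e * e) a)‖ * ‖b‖ := by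
          rw [one_mul, Unitization.norm_inr, hL.norm_tmul]
      _ ≤ ‖hA.tmul (star e * e) a‖ * ‖b‖ := by
          gcongr
          exact NonUnitalStarAlgHom.norm_apply_le θ _
      _ = _ := by rw [hA.norm_tmul, CStarRing.norm_star_mul_self, sq]
  let f : D →L[ℂ] D →L[ℂ] ℂ := g.mkContinuous₂ (‖e‖ ^ 2) hg
  have hf : ∀ a b, f a b = ω (hL.tmul (θ (hA.tmul (star e * e) a)) b : LD) := fun _ _ => rfl
  have hYY : ∀ (n : ℕ) (p q : Fin n → D),
      ∑ l, ∑ m, f (star (p l) * p m) (star (q l) * q m) =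
        ω ((star (∑ i, hL.tmul (θ (hA.tmul e (p i))) (q i)) *
          ∑ i, hL.tmul (θ (hA.tmul e (p i))) (q i) : LD)) := by
    intro n p q
    rw [star_sum, Finset.sum_mul_sum]
    simp_rw [hf, hL.star_tmul, hL.mul_tmul, ← map_star, hA.star_tmul, ← map_mul, hA.mul_tmul]
    simp only [← Unitization.inrNonUnitalStarAlgHom_apply, map_sum]
  have hpos : PositiveBilin f := by
    intro n p q
    rw [hYY]
    set Z := ∑ i, hL.tmul (θ (hA.tmul e (p i))) (q i)
    have := positive_of_norm_le_one ω hω hω1 (Z : Unitization ℂ LD)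
    simpa using this
  have h11 : (f 1 1).re ≤ ‖e‖ ^ 2 := by
    refine (Complex.re_le_norm _).trans ((hg 1 1).trans ?_)
    simp
  have key := hD.norm_sum_le_of_positiveBilin hDu hflip σ hσ hpos (n * n)
    (fun k => star (a (finProdFinEquiv.symm k).1) * a (finProdFinEquiv.symm k).2)
    (fun k => star (b (finProdFinEquiv.symm k).1) * b (finProdFinEquiv.symm k).2)
  rw [finProdFinEquiv.symm.sum_comp
      (fun k : Fin n × Fin n => f (star (a k.1) * a k.2) (star (b k.1) * b k.2)),
    finProdFinEquiv.symm.sum_comp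
      (fun k : Fin n × Fin n => hD.tmul (star (a k.1) * a k.2) (star (b k.1) * b k.2)),
    Fintype.sum_prod_type, Fintype.sum_prod_type, hYY] at key
  have hXX : ∑ i, ∑ j, hD.tmul (star (a i) * a j) (star (b i) * b j) = star X * X := by
    rw [star_sum, Finset.sum_mul_sum]
    simp_rw [hD.star_tmul, hD.mul_tmul]
  have hYω : ω ((star Y * Y : LD)) = (‖Y‖ ^ 2 : ℝ) := by
    rw [Unitization.inr_mul, Unitization.inr_star, hωY, Unitization.norm_inr]
  rw [hXX, hYω, CStarRing.norm_star_mul_self, Complex.norm_real,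
    Real.norm_of_nonneg (by positivity)] at key
  refine le_of_sq_le_sq ?_ (by positivity)
  calc ‖Y‖ ^ 2 ≤ (f 1 1).re * (‖X‖ * ‖X‖) := key
    _ ≤ ‖e‖ ^ 2 * (‖X‖ * ‖X‖) := by gcongr
    _ = _ := by ring

theorem CStarTensor.exists_starPairing [Nontrivial D] (hD : CStarTensor D D TD)
    (hDu : hD.tmul 1 1 = 1)
    (hflip : FinApproxEquiv (fun d => hD.tmul d 1) (fun d => hD.tmul 1 d))
    (σ : TD ≃⋆ₐ[ℂ] TD) (hσ : ∀ a b, σ (hD.tmul a b) = hD.tmul b a)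
    (hA : CStarTensor A D T) (θ : T →⋆ₙₐ[ℂ] L) (hL : CStarTensor L D LD) :
    ∃ M : StarPairing A TD LD, ∀ e a b,
      M.pair e (hD.tmul a b) = hL.tmul (θ (hA.tmul e a)) b := by
  have hex : ∀ e : A, ∃ F : TD →L[ℂ] LD,
      (∀ a b, F (hD.tmul a b) = hL.tmul (θ (hA.tmul e a)) b) ∧ ∀ x, ‖F x‖ ≤ ‖e‖ * ‖x‖ := fun e =>
    hD.exists_extend (LinearMap.mk₂ ℂ (fun a b => hL.tmul (θ (hA.tmul e a)) b)
      (fun a a' b => by simp [hA.add_right, hL.add_left])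
      (fun c a b => by simp [hA.smul_right, hL.smul_left])
      (fun a b b' => by simp [hL.add_right])
      (fun c a b => by simp [hL.smul_right]))
      (hD.norm_amplify_le hDu hflip σ hσ hA θ hL e)
  choose F hF hFn using hex
  refine ⟨⟨LinearMap.mk₂ ℂ (fun e x => F e x) ?_ ?_ (by simp) (by simp), ?_, ?_, hFn⟩, hF⟩
  · intro e e' x
    rw [hD.continuousLinearMap_ext (f := F (e + e')) (g := F e + F e')
      (fun a b => by simp [hF, hA.add_left, hL.add_left])]
    simp
  · intro c e x
    rw [hD.continuousLinearMap_ext (f := F (c • e)) (g := c • F e)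
      (fun a b => by simp [hF, hA.smul_left, hL.smul_left])]
    simp
  · intro e e' x y
    simp only [LinearMap.mk₂_apply]
    revert y
    refine hD.induction (isClosed_eq (by fun_prop) (by fun_prop)) (fun a b => ?_)
      fun y y' hy hy' => by simp only [map_add, mul_add, hy, hy']
    revert x
    refine hD.induction (isClosed_eq (by fun_prop) (by fun_prop)) (fun a' b' => ?_)
      fun y y' hy hy' => by simp only [map_add, add_mul, hy, hy']
    simp [hF, hL.mul_tmul, hD.mul_tmul, ← map_mul, hA.mul_tmul]
  · intro e
    simp only [LinearMap.mk₂_apply]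
    refine hD.induction (isClosed_eq (by fun_prop) (by fun_prop)) (fun a b => ?_)
      fun y y' hy hy' => by simp only [map_add, star_add, hy, hy']
    simp [hF, hL.star_tmul, hD.star_tmul, ← map_star, hA.star_tmul]

end Amplification

namespace StarPairing

variable {A T B : Type*} [NonUnitalCStarAlgebra A] [CStarAlgebra T] [NonUnitalCStarAlgebra B]
  (M : StarPairing A T B) {l : Filter A}

theorem tendsto_pair {X : Type*} {k : Filter X} {f : X → A} {a : A} (hf : Tendsto f k (𝓝 a))
    (x : T) : Tendsto (fun t => M.pair (f t) x) k (𝓝 (M.pair a x)) := by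
  rw [tendsto_iff_norm_sub_tendsto_zero] at hf ⊢
  refine squeeze_zero (fun _ => norm_nonneg _) (fun t => ?_) (by simpa using hf.mul_const ‖x‖)
  rw [← LinearMap.map_sub₂]
  exact M.norm_pair_le _ _

/-- A family `Z` of elements of the unitization of `B` asymptotically acts along the filter `l`
on the range of a pairing as left multiplication by `y`. -/
def LeftActs (l : Filter A) (Z : A → Unitization ℂ B) (y : T) : Prop :=
  ∀ a x, Tendsto (fun e => Z e * (M.pair a x : B)) l (𝓝 ((M.pair a (y * x) : B) : Unitization ℂ B))

variable {M}

theorem LeftActs.one : M.LeftActs l (fun _ => 1) 1 := fun a x => by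
  simpa using tendsto_const_nhds

theorem LeftActs.mul {Z Z' : A → Unitization ℂ B} {y y' : T} {C : ℝ}
    (hC : ∀ᶠ e in l, ‖Z e‖ ≤ C) (h : M.LeftActs l Z y) (h' : M.LeftActs l Z' y') :
    M.LeftActs l (fun e => Z e * Z' e) (y * y') := by
  intro a x
  have h1 := (h' a x).sub_const ((M.pair a (y' * x) : B) : Unitization ℂ B)
  rw [sub_self] at h1
  have h2 := isBoundedUnder_le_mul_tendsto_zero
    (isBoundedUnder_of_eventually_le (f := l) (u := norm ∘ Z) hC) h1
  have h3 := h2.add (h a (y' * x))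
  rw [zero_add, ← mul_assoc] at h3
  refine h3.congr fun e => ?_
  noncomm_ring

theorem LeftActs.pow {Z : A → Unitization ℂ B} {y : T} {C : ℝ}
    (hC : ∀ᶠ e in l, ‖Z e‖ ≤ C) (h : M.LeftActs l Z y) (n : ℕ) :
    M.LeftActs l (fun e => Z e ^ n) (y ^ n) := by
  induction n with
  | zero => simpa using LeftActs.one
  | succ n ih => simpa only [pow_succ'] using h.mul hC ih

theorem LeftActs.exp {Z : A → Unitization ℂ B} {y : T} {C : ℝ}
    (hC : ∀ᶠ e in l, ‖Z e‖ ≤ C) (h : M.LeftActs l Z y) :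
    M.LeftActs l (fun e => NormedSpace.exp (Z e)) (NormedSpace.exp y) := by
  intro a x
  have e1 : ∀ e, NormedSpace.exp (Z e) * (M.pair a x : B) =
      ∑' n : ℕ, ((n.factorial : ℂ)⁻¹ • Z e ^ n) * (M.pair a x : B) := fun e =>
    ((NormedSpace.exp_series_hasSum_exp' (𝕂 := ℂ) (Z e)).mul_right _).tsum_eq.symm
  have e2 : ((M.pair a (NormedSpace.exp y * x) : B) : Unitization ℂ B) =
      ∑' n : ℕ, ((M.pair a (((n.factorial : ℂ)⁻¹ • y ^ n) * x) : B) : Unitization ℂ B) := by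
    have hs := (NormedSpace.exp_series_hasSum_exp' (𝕂 := ℂ) y).mul_right x
    let P : T →L[ℂ] B := (M.pair a).mkContinuous ‖a‖ (M.norm_pair_le a)
    have hc : Continuous fun z => ((M.pair a z : B) : Unitization ℂ B) :=
      Unitization.continuous_inr.comp P.continuous
    let Q : T →+ Unitization ℂ B := ((Unitization.inrHom ℂ ℂ B).comp (M.pair a)).toAddMonoidHom
    exact (hs.map Q hc).tsum_eq.symm
  simp_rw [e1, e2]
  refine tendsto_tsum_of_dominated_convergence
    (bound := fun n : ℕ => (C ^ n / n.factorial) * ‖((M.pair a x : B) : Unitization ℂ B)‖)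
    ((Real.summable_pow_div_factorial C).mul_right _) (fun n => ?_) ?_
  · simpa [smul_mul_assoc] using ((h.pow hC n) a x).const_smul ((n.factorial : ℂ)⁻¹)
  · filter_upwards [hC] with e he n
    refine (norm_mul_le _ _).trans ?_
    gcongr
    rw [norm_smul, norm_inv, Complex.norm_natCast, inv_mul_eq_div]
    gcongr
    exact (norm_pow_le _ _).trans (by gcongr)

theorem leftActs_pair (hl : l.IsApproximateUnit) (c : ℂ) (h : T) :
    M.LeftActs l (fun e => c • (M.pair e h : Unitization ℂ B)) (c • h) := by
  intro a x
  simp only [smul_mul_assoc, ← Unitization.inr_mul, M.pair_mul_pair, map_smul,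
    Unitization.inr_smul]
  exact (((Unitization.continuous_inr.tendsto _).comp
    (M.tendsto_pair (hl.tendsto_mul_right a) (h * x))).const_smul c)

theorem eventually_norm_smul_pair_le (hl1 : ∀ᶠ e in l, IsSelfAdjoint e ∧ ‖e‖ ≤ 1) (c : ℂ) (h : T) :
    ∀ᶠ e in l, ‖c • (M.pair e h : Unitization ℂ B)‖ ≤ ‖c‖ * ‖h‖ := by
  filter_upwards [hl1] with e he
  rw [norm_smul, Unitization.norm_inr]
  gcongr
  exact (M.norm_pair_le e h).trans (mul_le_of_le_one_left (norm_nonneg _) he.2)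

theorem exists_leftActs (hl : l.IsApproximateUnit)
    (hl1 : ∀ᶠ e in l, IsSelfAdjoint e ∧ ‖e‖ ≤ 1) {u : unitary T} (hu : Joined 1 u) :
    ∃ Z : A → Unitization ℂ B, (∀ᶠ e in l, Z e ∈ unitary (Unitization ℂ B)) ∧
      M.LeftActs l Z u ∧ M.LeftActs l (fun e => star (Z e)) (star u : T) := by
  obtain ⟨hs, rfl⟩ := Unitary.mem_pathComponentOne_iff.mp hu
  clear hu
  induction hs with
  | nil => exact ⟨fun _ => 1, by simp, by simpa using LeftActs.one, by simpa using LeftActs.one⟩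
  | cons h hs ih =>
    obtain ⟨Z, hZ, h1, h2⟩ := ih
    let V : A → Unitization ℂ B := fun e => NormedSpace.exp (Complex.I • (M.pair e h : B))
    have hstar : star (selfAdjoint.expUnitary h : T) = NormedSpace.exp (-Complex.I • (h : T)) := by
      rw [selfAdjoint.expUnitary_coe, NormedSpace.star_exp, star_smul, h.2.star_eq]
      simp
    have hVs : ∀ᶠ e in l,
        star (V e) = NormedSpace.exp (-Complex.I • (M.pair e h : Unitization ℂ B)) := by
      filter_upwards [hl1] with e he
      rw [NormedSpace.star_exp, star_smul, ← Unitization.inr_star, M.star_pair, h.2.star_eq,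
        he.1.star_eq]
      simp
    have hV : ∀ᶠ e in l, V e ∈ unitary (Unitization ℂ B) := by
      filter_upwards [hl1] with e he
      exact (selfAdjoint.expUnitary (⟨M.pair e h, by
        rw [selfAdjoint.mem_iff, ← Unitization.inr_star, M.star_pair, h.2.star_eq,
          he.1.star_eq]⟩ : selfAdjoint (Unitization ℂ B))).2
    have hV1 : M.LeftActs l V (selfAdjoint.expUnitary h : T) :=
      (leftActs_pair hl Complex.I (h : T)).exp (eventually_norm_smul_pair_le hl1 _ _)
    have hV2 : M.LeftActs l (fun e => star (V e)) (star (selfAdjoint.expUnitary h) : T) := by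
      rw [hstar]
      refine fun a x => ((leftActs_pair hl (-Complex.I) (h : T)).exp
        (eventually_norm_smul_pair_le hl1 _ _) a x).congr' ?_
      filter_upwards [hVs] with e he
      rw [he]
    refine ⟨fun e => V e * Z e, ?_, ?_, ?_⟩
    · filter_upwards [hV, hZ] with e he he' using mul_mem he he'
    · simpa using hV1.mul (hV.mono fun e he => (CStarRing.norm_of_mem_unitary he).le) h1
    · simpa using h2.mul (hZ.mono fun e he => (CStarRing.norm_of_mem_unitary
        (Unitary.star_mem he)).le) hV2

theorem exists_tendsto_conj (hl : l.IsApproximateUnit)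
    (hl1 : ∀ᶠ e in l, IsSelfAdjoint e ∧ ‖e‖ ≤ 1) {u : unitary T} (hu : Joined 1 u) :
    ∃ Z : A → Unitization ℂ B, (∀ᶠ e in l, Z e ∈ unitary (Unitization ℂ B)) ∧
      ∀ a x, Tendsto (fun e => star (Z e) * (M.pair a x : B) * Z e) l
        (𝓝 ((M.pair a (star (u : T) * x * u) : B) : Unitization ℂ B)) := by
  obtain ⟨Z, hZ, -, h2⟩ := exists_leftActs (M := M) hl hl1 hu
  refine ⟨Z, hZ, fun a x => ?_⟩
  have hright : Tendsto (fun e => ((M.pair a x : B) : Unitization ℂ B) * Z e) l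
      (𝓝 ((M.pair a (x * u) : B) : Unitization ℂ B)) := by
    have := (h2 (star a) (star x)).star
    simpa [← Unitization.inr_star, M.star_pair] using this
  have h3 := isBoundedUnder_le_mul_tendsto_zero
    (isBoundedUnder_of_eventually_le (f := l) (u := norm ∘ fun e => star (Z e))
      (hZ.mono fun e he => (CStarRing.norm_of_mem_unitary (Unitary.star_mem he)).le))
    (sub_self (((M.pair a (x * u) : B) : Unitization ℂ B)) ▸ hright.sub_const _)
  have h4 := h3.add (h2 a (x * u))
  rw [zero_add, ← mul_assoc] at h4
  refine h4.congr fun e => ?_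
  noncomm_ring

end StarPairing

section Whitehead

variable {B : Type*} [CStarAlgebra B]

/-- The unitary `2 × 2` diagonal matrix with given unitary entries. -/
def diagonalUnitary (x y : unitary B) : unitary (Matrix (Fin 2) (Fin 2) B) :=
  ⟨!![(x : B), 0; 0, (y : B)], by
    rw [Unitary.mem_iff]
    constructor <;> ext i j <;> fin_cases i <;> fin_cases j <;>
      simp [Matrix.star_eq_conjTranspose, Matrix.mul_apply, Fin.sum_univ_two]⟩

theorem diagonalUnitary_mul (x y x' y' : unitary B) :
    diagonalUnitary x y * diagonalUnitary x' y' = diagonalUnitary (x * x') (y * y') :=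
  Subtype.ext (by simp [diagonalUnitary])

/-- The rotation matrix by the angle `t` with entries in a unital C*-algebra. -/
def rotationUnitary (B : Type*) [CStarAlgebra B] (t : ℝ) : unitary (Matrix (Fin 2) (Fin 2) B) :=
  ⟨!![algebraMap ℝ B (Real.cos t), -algebraMap ℝ B (Real.sin t);
      algebraMap ℝ B (Real.sin t), algebraMap ℝ B (Real.cos t)], by
    have h1 : algebraMap ℝ B (Real.cos t) * algebraMap ℝ B (Real.cos t) +
        algebraMap ℝ B (Real.sin t) * algebraMap ℝ B (Real.sin t) = 1 := by
      rw [← map_mul, ← map_mul, ← map_add, ← sq, ← sq, Real.cos_sq_add_sin_sq, map_one]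
    have h2 := Algebra.commutes (Real.cos t) (algebraMap ℝ B (Real.sin t))
    have h3 : ∀ r : ℝ, star (algebraMap ℝ B r) = algebraMap ℝ B r := fun r => by
      rw [← algebraMap_star_comm, star_trivial]
    rw [Unitary.mem_iff]
    constructor <;> ext i j <;> fin_cases i <;> fin_cases j <;>
      simp [Matrix.star_eq_conjTranspose, Matrix.mul_apply, Fin.sum_univ_two, h3, h1, h2,
        ← add_comm (algebraMap ℝ B (Real.cos t) * algebraMap ℝ B (Real.cos t))]⟩

theorem continuous_rotationUnitary : Continuous (rotationUnitary B) := by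
  refine Continuous.subtype_mk (continuous_matrix fun i j => ?_) _
  have := continuous_algebraMap ℝ B
  fin_cases i <;> fin_cases j <;> simp <;> fun_prop

theorem joined_one_rotationUnitary (t : ℝ) : Joined 1 (rotationUnitary B t) := by
  have h0 : rotationUnitary B 0 = 1 := Subtype.ext (by simp [rotationUnitary, Matrix.one_fin_two])
  rw [← h0]
  exact (PathConnectedSpace.joined (0 : ℝ) t).map continuous_rotationUnitary

theorem joined_one_commutator {G : Type*} [Group G] [TopologicalSpace G] [IsTopologicalGroup G]
    (x : G) {r : G} (hr : Joined 1 r) : Joined 1 (x * r * x⁻¹ * r⁻¹) := by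
  simpa using (((Joined.refl x).mul hr).mul (Joined.refl x⁻¹)).mul hr.inv

theorem joined_one_diagonalUnitary (x : unitary B) : Joined 1 (diagonalUnitary x x⁻¹) := by
  have h := joined_one_commutator (diagonalUnitary x 1)
    (joined_one_rotationUnitary (B := B) (Real.pi / 2))
  have e1 : (diagonalUnitary x 1)⁻¹ = diagonalUnitary x⁻¹ 1 := by
    rw [inv_eq_iff_mul_eq_one, diagonalUnitary_mul]
    exact Subtype.ext (by simp [diagonalUnitary, Matrix.one_fin_two])
  have e2 : diagonalUnitary x 1 * rotationUnitary B (Real.pi / 2) * diagonalUnitary x⁻¹ 1 *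
      (rotationUnitary B (Real.pi / 2))⁻¹ = diagonalUnitary x x⁻¹ := by
    rw [mul_inv_eq_iff_eq_mul]
    exact Subtype.ext (by simp [diagonalUnitary, rotationUnitary])
  rwa [e1, e2] at h

theorem K1Injective.joined_one_commutator (hK1 : K1Injective B) (a b : unitary B) :
    Joined 1 (a * b * a⁻¹ * b⁻¹) := by
  have h1 := ((joined_one_diagonalUnitary a).mul (joined_one_diagonalUnitary b)).mul
    (joined_one_diagonalUnitary (b * a)⁻¹)
  rw [diagonalUnitary_mul, diagonalUnitary_mul, one_mul, one_mul] at h1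
  have e : stabUnitary 1 ((a * b * a⁻¹ * b⁻¹ : unitary B) : B) =
      (diagonalUnitary (a * b * (b * a)⁻¹) (a⁻¹ * b⁻¹ * (b * a)⁻¹⁻¹) :
        Matrix (Fin 2) (Fin 2) B) := by
    have e' : a⁻¹ * b⁻¹ * (b * a)⁻¹⁻¹ = 1 := by group
    have e'' : a * b * (b * a)⁻¹ = a * b * a⁻¹ * b⁻¹ := by group
    rw [e', e'', stabUnitary]
    ext i j
    fin_cases i <;> fin_cases j <;> simp [diagonalUnitary]
  refine (hK1 _ ⟨1, e ▸ (diagonalUnitary _ _).2, ?_⟩).symm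
  convert h1.symm using 1
  exact Subtype.ext e

end Whitehead

section UnitariesConnectedToOne

variable {D TD : Type u} [CStarAlgebra D] [CStarAlgebra TD]

theorem K1Injective.joined_one_commutator_of_equiv (hK1 : K1Injective D) (φ : D ≃⋆ₐ[ℂ] TD)
    (a b : unitary TD) : Joined 1 (a * b * a⁻¹ * b⁻¹) := by
  let Φ : unitary D → unitary TD := fun x => ⟨φ x, Unitary.map_mem φ x.2⟩
  have hΦ : Continuous Φ := ((continuous_starHom φ).comp continuous_subtype_val).subtype_mk _
  have h := (hK1.joined_one_commutator ⟨φ.symm a, Unitary.map_mem φ.symm a.2⟩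
    ⟨φ.symm b, Unitary.map_mem φ.symm b.2⟩).map hΦ
  convert h using 1 <;> exact Subtype.ext (by simp [Φ, ← Unitary.star_eq_inv, map_star])

theorem exists_joined_one_conj_near {hD : CStarTensor D D TD}
    (hK1 : K1Injective D) {φ : D ≃⋆ₐ[ℂ] TD} (hφ : FinApproxEquiv φ (fun d => hD.tmul d 1))
    (hflip : FinApproxEquiv (fun d => hD.tmul d 1) (fun d => hD.tmul 1 d))
    (F : Finset D) {ε : ℝ} (hε : 0 < ε) :
    ∃ c : unitary TD, Joined 1 c ∧ ∀ d ∈ F, ‖star (c : TD) * φ d * c - hD.tmul d 1‖ < ε := by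
  obtain ⟨v, hv, hvF⟩ := hφ F (ε / 2) (half_pos hε)
  set S := ∑ d ∈ F, ‖d‖ with hS
  have hS0 : 0 ≤ S := Finset.sum_nonneg fun _ _ => norm_nonneg _
  obtain ⟨q, hq, hqy⟩ := (hφ.trans hflip) {φ.symm (star v)} (ε / (4 * (S + 1))) (by positivity)
  have hqy := hqy _ (Finset.mem_singleton_self _)
  set y := φ.symm (star v)
  have hy : φ y = star v := φ.apply_symm_apply _
  rw [hy] at hqy
  set Z := star q * star v * q with hZ
  have hZu : Z ∈ unitary TD := mul_mem (mul_mem (Unitary.star_mem hq) (Unitary.star_mem hv)) hq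
  refine ⟨⟨v, hv⟩ * ⟨q, hq⟩⁻¹ * ⟨v, hv⟩⁻¹ * ⟨q, hq⟩⁻¹⁻¹,
    hK1.joined_one_commutator_of_equiv φ _ _, fun d hd => ?_⟩
  have e1 : ((⟨v, hv⟩ * ⟨q, hq⟩⁻¹ * ⟨v, hv⟩⁻¹ * ⟨q, hq⟩⁻¹⁻¹ : unitary TD) : TD) = v * Z := by
    simp [← Unitary.star_eq_inv, hZ, mul_assoc]
  have e2 : star (v * Z) * φ d * (v * Z) - hD.tmul d 1 =
      star Z * (star v * φ d * v - hD.tmul d 1) * Z +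
        star Z * (hD.tmul d 1 * (Z - hD.tmul 1 y) - (Z - hD.tmul 1 y) * hD.tmul d 1) := by
    have h1 : hD.tmul d 1 * hD.tmul 1 y = hD.tmul 1 y * hD.tmul d 1 := by simp [hD.mul_tmul]
    have h2 : star Z * Z = 1 := Unitary.star_mul_self_of_mem hZu
    have h3 : hD.tmul d 1 * (Z - hD.tmul 1 y) - (Z - hD.tmul 1 y) * hD.tmul d 1 =
        hD.tmul d 1 * Z - Z * hD.tmul d 1 := by
      rw [mul_sub, sub_mul, h1]; abel
    have h4 : star Z * (hD.tmul d 1 * Z - Z * hD.tmul d 1) =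
        star Z * hD.tmul d 1 * Z - hD.tmul d 1 := by
      rw [mul_sub, ← mul_assoc (star Z) Z, h2, one_mul, mul_assoc]
    rw [h3, h4, star_mul]
    noncomm_ring
  have h1 : ‖(1 : D)‖ ≤ 1 := by
    nontriviality D
    exact CStarRing.norm_one.le
  have hd1 : ‖hD.tmul d 1‖ ≤ S := by
    rw [hD.norm_tmul]
    exact (mul_le_of_le_one_right (norm_nonneg _) h1).trans
      (Finset.single_le_sum (f := fun d : D => ‖d‖) (fun _ _ => norm_nonneg _) hd)
  rw [e1, e2]
  refine (norm_add_le _ _).trans_lt ?_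
  rw [norm_star_mul_mul_of_mem_unitary hZu, CStarRing.norm_mem_unitary_mul _ (Unitary.star_mem hZu)]
  have h4 : ‖hD.tmul d 1 * (Z - hD.tmul 1 y) - (Z - hD.tmul 1 y) * hD.tmul d 1‖ ≤
      2 * (S + 1) * (ε / (4 * (S + 1))) := by
    refine (norm_sub_le _ _).trans ?_
    have h5 : ‖hD.tmul d 1‖ * ‖Z - hD.tmul 1 y‖ ≤ (S + 1) * (ε / (4 * (S + 1))) := by
      gcongr
      exact hd1.trans (by linarith)
    linarith [norm_mul_le (hD.tmul d 1) (Z - hD.tmul 1 y),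
      norm_mul_le (Z - hD.tmul 1 y) (hD.tmul d 1), mul_comm ‖hD.tmul d 1‖ ‖Z - hD.tmul 1 y‖]
  have h6 : 2 * (S + 1) * (ε / (4 * (S + 1))) = ε / 2 := by field_simp; norm_num
  linarith [hvF d hd]

theorem exists_joined_one_absorbing {hD : CStarTensor D D TD}
    (hK1 : K1Injective D) {φ : D ≃⋆ₐ[ℂ] TD} (hφ : FinApproxEquiv φ (fun d => hD.tmul d 1))
    (hflip : FinApproxEquiv (fun d => hD.tmul d 1) (fun d => hD.tmul 1 d))
    (F : Finset D) {ε : ℝ} (hε : 0 < ε) :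
    ∃ c : unitary TD, Joined 1 c ∧
      (∀ d ∈ F, ‖star (c : TD) * hD.tmul d 1 * c - hD.tmul d 1‖ < ε) ∧
      ∀ d ∈ F, ∃ d', ‖star (c : TD) * hD.tmul 1 d * c - hD.tmul d' 1‖ < ε := by
  classical
  obtain ⟨c₁, hc₁, h₁⟩ := exists_joined_one_conj_near hK1 hφ hflip F (half_pos hε)
  obtain ⟨c₂, hc₂, h₂⟩ := exists_joined_one_conj_near hK1 hφ hflip
    (F ∪ F.image fun d => φ.symm (c₁ * hD.tmul 1 d * star (c₁ : TD))) (half_pos hε)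
  refine ⟨c₁⁻¹ * c₂, by simpa using hc₁.inv.mul hc₂, fun d hd => ?_, fun d hd =>
    ⟨φ.symm (c₁ * hD.tmul 1 d * star (c₁ : TD)), ?_⟩⟩
  · have e : star ((c₁⁻¹ * c₂ : unitary TD) : TD) * hD.tmul d 1 * (c₁⁻¹ * c₂ : unitary TD) -
        hD.tmul d 1 = star (c₂ : TD) * (c₁ * hD.tmul d 1 * star (c₁ : TD) - φ d) * c₂ +
          (star (c₂ : TD) * φ d * c₂ - hD.tmul d 1) := by
      simp only [← Unitary.star_eq_inv, Unitary.coe_star, Submonoid.coe_mul, star_mul, star_star]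
      noncomm_ring
    rw [e]
    refine (norm_add_le _ _).trans_lt ?_
    rw [norm_star_mul_mul_of_mem_unitary c₂.2, star_conj_sub c₁.2, norm_neg,
      norm_mul_mul_star_of_mem_unitary c₁.2]
    linarith [h₁ d hd, h₂ d (Finset.mem_union_left _ hd)]
  · have := h₂ _ (Finset.mem_union_right _ (Finset.mem_image_of_mem _ hd))
    rw [φ.apply_symm_apply] at this
    refine lt_of_eq_of_lt ?_ (this.trans (half_lt_self hε))
    congr 2
    simp [← Unitary.star_eq_inv, mul_assoc]

end UnitariesConnectedToOne

section Conjugation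

variable {B : Type*} [NonUnitalCStarAlgebra B]

theorem Unitization.inr_snd_mul_inr_mul (x y : Unitization ℂ B) (z : B) :
    (((x * z * y).snd : B) : Unitization ℂ B) = x * z * y := by
  refine Unitization.ext ?_ ?_ <;> simp

theorem star_conj_mul_star_conj {R : Type*} [Monoid R] [StarMul R] (v : unitary R) (x y : R) :
    star (v : R) * x * v * (star (v : R) * y * v) = star (v : R) * (x * y) * v := by
  calc star (v : R) * x * v * (star (v : R) * y * v)
      = star (v : R) * x * (v * star (v : R)) * (y * v) := by simp only [mul_assoc]
    _ = _ := by rw [Unitary.mul_star_self_of_mem v.2, mul_one]; simp only [mul_assoc]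

/-- Conjugation `z ↦ v* z v` by a unitary of the unitization, as a *-automorphism. -/
def unitizationConj (v : unitary (Unitization ℂ B)) : B ≃⋆ₐ[ℂ] B where
  toFun z := (star (v : Unitization ℂ B) * z * v).snd
  invFun z := ((v : Unitization ℂ B) * z * star (v : Unitization ℂ B)).snd
  left_inv z := by
    apply Unitization.inr_injective (R := ℂ)
    rw [Unitization.inr_snd_mul_inr_mul, Unitization.inr_snd_mul_inr_mul, ← mul_assoc,
      ← mul_assoc, Unitary.mul_star_self_of_mem v.2, one_mul, mul_assoc,
      Unitary.mul_star_self_of_mem v.2, mul_one]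
  right_inv z := by
    apply Unitization.inr_injective (R := ℂ)
    rw [Unitization.inr_snd_mul_inr_mul, Unitization.inr_snd_mul_inr_mul, ← mul_assoc,
      ← mul_assoc, Unitary.star_mul_self_of_mem v.2, one_mul, mul_assoc,
      Unitary.star_mul_self_of_mem v.2, mul_one]
  map_mul' z z' := by
    apply Unitization.inr_injective (R := ℂ)
    rw [Unitization.inr_snd_mul_inr_mul, Unitization.inr_mul, Unitization.inr_mul,
      Unitization.inr_snd_mul_inr_mul, Unitization.inr_snd_mul_inr_mul,
      star_conj_mul_star_conj]
  map_add' z z' := by simp [mul_add, add_mul]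
  map_smul' c z := by simp
  map_star' z := by
    apply Unitization.inr_injective (R := ℂ)
    rw [Unitization.inr_snd_mul_inr_mul, Unitization.inr_star, Unitization.inr_star,
      Unitization.inr_snd_mul_inr_mul, star_mul, star_mul, star_star, mul_assoc]

theorem inr_unitizationConj (v : unitary (Unitization ℂ B)) (z : B) :
    (unitizationConj v z : Unitization ℂ B) = star (v : Unitization ℂ B) * z * v :=
  Unitization.inr_snd_mul_inr_mul _ _ _

end Conjugation

section AutomorphismFilters

variable {B : Type*} [NonUnitalCStarAlgebra B]

theorem StarAlgEquiv.norm_apply (γ : B ≃⋆ₐ[ℂ] B) (z : B) : ‖γ z‖ = ‖z‖ :=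
  NonUnitalStarAlgHom.norm_map γ γ.injective z

theorem StarAlgEquiv.norm_apply_sub (γ : B ≃⋆ₐ[ℂ] B) (y z : B) : ‖γ y - γ z‖ = ‖y - z‖ := by
  rw [← map_sub, γ.norm_apply]

theorem isClosed_setOf_tendsto_apply (k : Filter (B ≃⋆ₐ[ℂ] B)) :
    IsClosed {z | Tendsto (fun γ : B ≃⋆ₐ[ℂ] B => γ z) k (𝓝 z)} := by
  refine isClosed_of_closure_subset fun z hz => Metric.tendsto_nhds.mpr fun ε hε => ?_
  obtain ⟨y, hy, hzy⟩ := Metric.mem_closure_iff.mp hz (ε / 3) (by positivity)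
  filter_upwards [Metric.tendsto_nhds.mp hy (ε / 3) (by positivity)] with γ hγ
  have h1 : dist (γ z) (γ y) = dist z y := by
    rw [dist_eq_norm, dist_eq_norm, γ.norm_apply_sub]
  linarith [dist_triangle4 (γ z) (γ y) y z, dist_comm z y]

theorem isClosed_setOf_eventually_near (k : Filter (B ≃⋆ₐ[ℂ] B)) (S : Set B) :
    IsClosed {z | ∀ ε > 0, ∀ᶠ γ in k, ∃ s ∈ S, ‖γ z - s‖ < ε} := by
  refine isClosed_of_closure_subset fun z hz ε hε => ?_
  obtain ⟨y, hy, hzy⟩ := Metric.mem_closure_iff.mp hz (ε / 2) (by positivity)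
  filter_upwards [hy (ε / 2) (by positivity)] with γ ⟨s, hs, hγ⟩
  refine ⟨s, hs, ?_⟩
  have h1 : ‖γ z - γ y‖ = dist z y := by rw [dist_eq_norm, γ.norm_apply_sub]
  linarith [norm_sub_le_norm_sub_add_norm_sub (γ z) (γ y) s]

end AutomorphismFilters

section LocalAbsorption

variable {D TD : Type u} [CStarAlgebra D] [CStarAlgebra TD] {A T : Type*} {L : Type v}
  {LD : Type w} [NonUnitalCStarAlgebra A] [NonUnitalCStarAlgebra T] [NonUnitalCStarAlgebra L]
  [NonUnitalCStarAlgebra LD]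

theorem StarPairing.exists_starAlgEquiv (M : StarPairing A TD LD) {u : unitary TD}
    (hu : Joined 1 u) (R : Finset (A × TD)) {ε : ℝ} (hε : 0 < ε) :
    ∃ γ : LD ≃⋆ₐ[ℂ] LD, ∀ r ∈ R,
      ‖γ (M.pair r.1 r.2) - M.pair r.1 (star (u : TD) * r.2 * u)‖ < ε := by
  obtain ⟨l, hl, hl1⟩ := exists_isApproximateUnit A
  obtain ⟨Z, hZ, hlim⟩ := StarPairing.exists_tendsto_conj (M := M) hl hl1 hu
  have hev : ∀ᶠ e in l, ∀ r ∈ R, ‖star (Z e) * (M.pair r.1 r.2 : LD) * Z e -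
      (M.pair r.1 (star (u : TD) * r.2 * u) : LD)‖ < ε := by
    rw [Filter.eventually_all_finset]
    intro r _
    simpa only [dist_eq_norm] using Metric.tendsto_nhds.mp (hlim r.1 r.2) ε hε
  have := hl.neBot
  obtain ⟨e, he, hR⟩ := (hZ.and hev).exists
  refine ⟨unitizationConj ⟨Z e, he⟩, fun r hr => ?_⟩
  rw [← Unitization.norm_inr (𝕜 := ℂ), Unitization.inr_sub, inr_unitizationConj]
  exact hR r hr

/-- There are automorphisms of `L ⊗ D` almost fixing finitely many elements of `θ(A ⊗ D) ⊗ 1`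
and moving finitely many elements of `θ(A ⊗ D) ⊗ D` close to `L ⊗ 1`. -/
theorem exists_starAlgEquiv_absorbing [Nontrivial D] {hD : CStarTensor D D TD}
    (hDu : hD.tmul 1 1 = 1) (hK1 : K1Injective D) {φ : D ≃⋆ₐ[ℂ] TD}
    (hφ : FinApproxEquiv φ (fun d => hD.tmul d 1))
    (hflip : FinApproxEquiv (fun d => hD.tmul d 1) (fun d => hD.tmul 1 d))
    {σ : TD ≃⋆ₐ[ℂ] TD} (hσ : ∀ a b, σ (hD.tmul a b) = hD.tmul b a)
    (hA : CStarTensor A D T) (θ : T →⋆ₙₐ[ℂ] L) (hL : CStarTensor L D LD)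
    (R : Finset (A × D × D)) {ε : ℝ} (hε : 0 < ε) :
    ∃ γ : LD ≃⋆ₐ[ℂ] LD, ∀ r ∈ R,
      ‖γ (hL.tmul (θ (hA.tmul r.1 r.2.1)) 1) - hL.tmul (θ (hA.tmul r.1 r.2.1)) 1‖ < ε ∧
      ∃ l, ‖γ (hL.tmul (θ (hA.tmul r.1 r.2.1)) r.2.2) - hL.tmul l 1‖ < ε := by
  classical
  obtain ⟨M, hM⟩ := hD.exists_starPairing hDu hflip σ hσ hA θ hL
  set K := ∑ r ∈ R, ‖r.1‖ * (‖r.2.1‖ + ‖r.2.2‖ + 1) with hK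
  have hK0 : 0 ≤ K := Finset.sum_nonneg fun r _ => by positivity
  set δ := ε / (2 * (K + 1)) with hδ
  have hδ0 : 0 < δ := by positivity
  obtain ⟨u, hu, h1, h2⟩ := exists_joined_one_absorbing hK1 hφ hflip
    (R.image (fun r => r.2.1) ∪ R.image fun r => r.2.2) hδ0
  obtain ⟨γ, hγ⟩ := M.exists_starAlgEquiv hu
    (R.image (fun r => (r.1, hD.tmul r.2.1 1)) ∪ R.image fun r => (r.1, hD.tmul r.2.1 r.2.2))
    (half_pos hε)
  refine ⟨γ, fun r hr => ?_⟩
  obtain ⟨a, d, d'⟩ := r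
  have hKr : ‖a‖ * (‖d‖ + ‖d'‖ + 1) ≤ K :=
    Finset.single_le_sum (f := fun r : A × D × D => ‖r.1‖ * (‖r.2.1‖ + ‖r.2.2‖ + 1))
      (fun r _ => by positivity) hr
  have hb : ‖a‖ * ((‖d‖ + ‖d'‖ + 1) * δ) < ε / 2 := by
    calc ‖a‖ * ((‖d‖ + ‖d'‖ + 1) * δ) ≤ K * δ := by rw [← mul_assoc]; gcongr
      _ < (K + 1) * δ := by gcongr; linarith
      _ = ε / 2 := by rw [hδ]; field_simp
  have h3 := h1 d (Finset.mem_union_left _ (Finset.mem_image_of_mem _ hr))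
  obtain ⟨d'', h4⟩ := h2 d' (Finset.mem_union_right _ (Finset.mem_image_of_mem _ hr))
  have h5 := hγ _ (Finset.mem_union_left _ (Finset.mem_image_of_mem _ hr))
  have h6 := hγ _ (Finset.mem_union_right _ (Finset.mem_image_of_mem _ hr))
  simp only at h5 h6 ⊢
  constructor
  · rw [← hM]
    refine (norm_sub_le_norm_sub_add_norm_sub _
      (M.pair a (star (u : TD) * hD.tmul d 1 * u)) _).trans_lt ?_
    rw [← map_sub]
    have h7 := M.norm_pair_le a (star (u : TD) * hD.tmul d 1 * u - hD.tmul d 1)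
    have h8 : ‖a‖ * ‖star (u : TD) * hD.tmul d 1 * u - hD.tmul d 1‖ ≤
        ‖a‖ * ((‖d‖ + ‖d'‖ + 1) * δ) := by
      gcongr
      refine h3.le.trans (le_mul_of_one_le_left hδ0.le ?_)
      linarith [norm_nonneg d, norm_nonneg d']
    linarith
  · refine ⟨θ (hA.tmul a (d * d'')), ?_⟩
    rw [← hM, ← hM]
    refine (norm_sub_le_norm_sub_add_norm_sub _
      (M.pair a (star (u : TD) * hD.tmul d d' * u)) _).trans_lt ?_
    rw [← map_sub]
    have h7 := M.norm_pair_le a (star (u : TD) * hD.tmul d d' * u - hD.tmul (d * d'') 1)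
    have h8 : star (u : TD) * hD.tmul d d' * u - hD.tmul (d * d'') 1 =
        (star (u : TD) * hD.tmul d 1 * u - hD.tmul d 1) * (star (u : TD) * hD.tmul 1 d' * u) +
          hD.tmul d 1 * (star (u : TD) * hD.tmul 1 d' * u - hD.tmul d'' 1) := by
      have e1 : hD.tmul d d' = hD.tmul d 1 * hD.tmul 1 d' := by simp [hD.mul_tmul]
      have e2 : hD.tmul (d * d'') 1 = hD.tmul d 1 * hD.tmul d'' 1 := by simp [hD.mul_tmul]
      have e3 : star (u : TD) * (hD.tmul d 1 * hD.tmul 1 d') * u =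
          star (u : TD) * hD.tmul d 1 * u * (star (u : TD) * hD.tmul 1 d' * u) :=
        (star_conj_mul_star_conj u _ _).symm
      rw [e1, e2, e3]
      noncomm_ring
    have h9 : ‖star (u : TD) * hD.tmul d d' * u - hD.tmul (d * d'') 1‖ ≤
        (‖d‖ + ‖d'‖ + 1) * δ := by
      rw [h8]
      refine (norm_add_le _ _).trans ?_
      have e1 : ‖star (u : TD) * hD.tmul 1 d' * u‖ = ‖d'‖ := by
        rw [norm_star_mul_mul_of_mem_unitary u.2, hD.norm_tmul, CStarRing.norm_one, one_mul]
      have e2 : ‖hD.tmul d 1‖ = ‖d‖ := by rw [hD.norm_tmul, CStarRing.norm_one, mul_one]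
      have i1 := norm_mul_le (star (u : TD) * hD.tmul d 1 * u - hD.tmul d 1)
        (star (u : TD) * hD.tmul 1 d' * u)
      have i2 := norm_mul_le (hD.tmul d 1) (star (u : TD) * hD.tmul 1 d' * u - hD.tmul d'' 1)
      rw [e1] at i1
      rw [e2] at i2
      have i3 := mul_le_mul_of_nonneg_right h3.le (norm_nonneg d')
      have i4 := mul_le_mul_of_nonneg_left h4.le (norm_nonneg d)
      linarith
    have h10 := mul_le_mul_of_nonneg_left h9 (norm_nonneg a)
    linarith

end LocalAbsorption

section Intertwining

variable {L B : Type*} [NonUnitalCStarAlgebra L] [NonUnitalCStarAlgebra B]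

theorem exists_intertwining_sequence (φ : L →⋆ₙₐ[ℂ] B) (K : Filter (B ≃⋆ₐ[ℂ] B)) [K.NeBot]
    (h1 : ∀ l, Tendsto (fun γ : B ≃⋆ₐ[ℂ] B => γ (φ l)) K (𝓝 (φ l)))
    (h2 : ∀ z, ∀ ε > 0, ∀ᶠ γ in K, ∃ l, ‖γ z - φ l‖ < ε) (l : ℕ → L) (b : ℕ → B) :
    ∃ (Ψ : ℕ → B ≃⋆ₐ[ℂ] B) (S : ℕ → Finset L), Monotone S ∧ (∀ n, l n ∈ S (n + 1)) ∧
      (∀ n, ∀ x ∈ S n, ‖Ψ n (φ x) - Ψ (n + 1) (φ x)‖ ≤ (1 / 2) ^ n) ∧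
      ∀ n, ∀ k ≤ n, ∃ x ∈ S (n + 1), ‖b k - Ψ (n + 1) (φ x)‖ ≤ (1 / 2) ^ n := by
  classical
  have step : ∀ (n : ℕ) (p : (B ≃⋆ₐ[ℂ] B) × Finset L), ∃ q : (B ≃⋆ₐ[ℂ] B) × Finset L,
      p.2 ⊆ q.2 ∧ l n ∈ q.2 ∧ (∀ x ∈ p.2, ‖p.1 (φ x) - q.1 (φ x)‖ ≤ (1 / 2) ^ n) ∧
      ∀ k ≤ n, ∃ x ∈ q.2, ‖b k - q.1 (φ x)‖ ≤ (1 / 2) ^ n := by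
    rintro n ⟨Ψ, S⟩
    have hε : (0 : ℝ) < (1 / 2) ^ n := by positivity
    have e1 : ∀ᶠ γ in K, ∀ x ∈ S, ‖γ (φ x) - φ x‖ < (1 / 2) ^ n := by
      rw [Filter.eventually_all_finset]
      intro x _
      simpa only [dist_eq_norm] using Metric.tendsto_nhds.mp (h1 x) _ hε
    have e2 : ∀ᶠ γ in K, ∀ k ∈ Finset.range (n + 1), ∃ y,
        ‖γ (Ψ.symm (b k)) - φ y‖ < (1 / 2) ^ n := by
      rw [Filter.eventually_all_finset]
      exact fun k _ => h2 _ _ hε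
    obtain ⟨γ, hγ1, hγ2⟩ := (e1.and e2).exists
    choose! y hy using hγ2
    refine ⟨(γ.symm.trans Ψ, S ∪ insert (l n) ((Finset.range (n + 1)).image y)),
      Finset.subset_union_left, by simp, fun x hx => ?_, fun k hk => ⟨y k, ?_, ?_⟩⟩
    · simp only [StarAlgEquiv.trans_apply]
      rw [Ψ.norm_apply_sub, ← γ.norm_apply_sub, γ.apply_symm_apply]
      exact (hγ1 x hx).le
    · exact Finset.mem_union_right _ (Finset.mem_insert_of_mem
        (Finset.mem_image_of_mem _ (by simp; omega)))
    · simp only [StarAlgEquiv.trans_apply]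
      rw [← Ψ.symm.norm_apply_sub, ← γ.norm_apply_sub, Ψ.symm_apply_apply, γ.apply_symm_apply]
      exact (hy k (by simp; omega)).le
  choose q hq1 hq2 hq3 hq4 using step
  let p : ℕ → (B ≃⋆ₐ[ℂ] B) × Finset L := fun n => Nat.rec (StarAlgEquiv.refl ℂ B, ∅) q n
  exact ⟨fun n => (p n).1, fun n => (p n).2, monotone_nat_of_le_succ fun n => hq1 n (p n),
    fun n => hq2 n (p n), fun n => hq3 n (p n), fun n => hq4 n (p n)⟩

theorem exists_starAlgEquiv_of_norm_map_of_denseRange (ψ : L →⋆ₙₐ[ℂ] B)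
    (hψ : ∀ x, ‖ψ x‖ = ‖x‖) (hd : DenseRange ψ) : Nonempty (L ≃⋆ₐ[ℂ] B) := by
  have hi : Isometry ψ := AddMonoidHomClass.isometry_of_norm ψ hψ
  refine ⟨StarAlgEquiv.ofBijective ψ ⟨hi.injective, fun y => ?_⟩⟩
  have := hd y
  rwa [hi.isClosedEmbedding.isClosed_range.closure_eq] at this

theorem exists_starAlgEquiv_of_filter [TopologicalSpace.SeparableSpace L]
    [TopologicalSpace.SeparableSpace B] (φ : L →⋆ₙₐ[ℂ] B) (hφ : ∀ x, ‖φ x‖ = ‖x‖)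
    (K : Filter (B ≃⋆ₐ[ℂ] B)) [K.NeBot]
    (h1 : ∀ l, Tendsto (fun γ : B ≃⋆ₐ[ℂ] B => γ (φ l)) K (𝓝 (φ l)))
    (h2 : ∀ z, ∀ ε > 0, ∀ᶠ γ in K, ∃ l, ‖γ z - φ l‖ < ε) :
    Nonempty (L ≃⋆ₐ[ℂ] B) := by
  obtain ⟨l, hl⟩ := TopologicalSpace.exists_dense_seq L
  obtain ⟨b, hb⟩ := TopologicalSpace.exists_dense_seq B
  obtain ⟨Ψ, S, hS, hlS, hΨ, hbΨ⟩ := exists_intertwining_sequence φ K h1 h2 l b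
  have hstep : ∀ N, ∀ x ∈ S N, ∀ n, dist (Ψ (n + N) (φ x)) (Ψ (n + 1 + N) (φ x)) ≤
      (1 / 2) ^ N * (1 / 2) ^ n := by
    intro N x hx n
    rw [dist_eq_norm, mul_comm, ← pow_add, add_right_comm]
    exact hΨ _ x (hS (Nat.le_add_left N n) hx)
  have hcauchy : ∀ x, CauchySeq fun n => Ψ n (φ x) := by
    intro x
    refine hl.induction_on x ?_ fun n => ?_
    · refine isClosed_of_closure_subset fun z hz => Metric.cauchySeq_iff.mpr fun ε hε => ?_
      obtain ⟨y, hy, hzy⟩ := Metric.mem_closure_iff.mp hz (ε / 3) (by positivity)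
      obtain ⟨N, hN⟩ := Metric.cauchySeq_iff.mp hy (ε / 3) (by positivity)
      refine ⟨N, fun m hm n hn => ?_⟩
      have hd : ∀ n, dist (Ψ n (φ z)) (Ψ n (φ y)) = dist z y := fun n => by
        rw [dist_eq_norm, StarAlgEquiv.norm_apply_sub, ← map_sub, hφ, dist_eq_norm]
      linarith [dist_triangle4 (Ψ m (φ z)) (Ψ m (φ y)) (Ψ n (φ y)) (Ψ n (φ z)),
        dist_comm (Ψ n (φ y)) (Ψ n (φ z)), hd m, hd n, hN m hm n hn]
    · exact (cauchySeq_shift (n + 1)).mp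
        (cauchySeq_of_le_geometric _ _ (by norm_num) (hstep (n + 1) _ (hlS n)))
  choose ψ hψ using fun x => cauchySeq_tendsto_of_complete (hcauchy x)
  have hψS : ∀ N, ∀ x ∈ S N, ‖Ψ N (φ x) - ψ x‖ ≤ 2 * (1 / 2) ^ N := by
    intro N x hx
    have := dist_le_of_le_geometric_of_tendsto₀ _ _ (by norm_num) (hstep N x hx)
      ((tendsto_add_atTop_iff_nat N).mpr (hψ x))
    rw [Nat.zero_add, dist_eq_norm] at this
    exact this.trans_eq (by ring)
  let ψ' : L →⋆ₙₐ[ℂ] B :=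
    { toFun := ψ
      map_smul' := fun c x => tendsto_nhds_unique (hψ _) (by simpa using (hψ x).const_smul c)
      map_zero' := tendsto_nhds_unique (hψ _) (by simp)
      map_add' := fun x y => tendsto_nhds_unique (hψ _) (by simpa using (hψ x).add (hψ y))
      map_mul' := fun x y => tendsto_nhds_unique (hψ _) (by simpa using (hψ x).mul (hψ y))
      map_star' := fun x => tendsto_nhds_unique (hψ _) (by simpa [map_star] using (hψ x).star) }
  refine exists_starAlgEquiv_of_norm_map_of_denseRange ψ' (fun x => ?_) ?_
  · refine tendsto_nhds_unique (hψ x).norm ?_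
    simp [StarAlgEquiv.norm_apply, hφ]
  · refine Metric.dense_iff.mpr fun z ε hε => ?_
    obtain ⟨k, hk⟩ := hb.exists_dist_lt z (half_pos hε)
    obtain ⟨m, hm⟩ := exists_pow_lt_of_lt_one (show 0 < ε / 4 by positivity)
      (show (1 / 2 : ℝ) < 1 by norm_num)
    obtain ⟨x, hx, hxb⟩ := hbΨ (max m k) k (le_max_right _ _)
    have hle : (1 / 2 : ℝ) ^ (max m k) ≤ (1 / 2) ^ m :=
      pow_le_pow_of_le_one (by norm_num) (by norm_num) (le_max_left _ _)
    refine ⟨ψ x, ?_, x, rfl⟩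
    rw [Metric.mem_ball, dist_comm]
    have h3 := hψS _ x hx
    rw [← dist_eq_norm] at h3 hxb
    rw [pow_succ] at h3
    linarith [dist_triangle4 z (b k) (Ψ (max m k + 1) (φ x)) (ψ x)]

end Intertwining

section Globalization

variable {D TD : Type u} [CStarAlgebra D] [CStarAlgebra TD] {L : Type v}
  {LD : Type w} [NonUnitalCStarAlgebra L] [NonUnitalCStarAlgebra LD]

theorem exists_filter_absorbing [Nontrivial D] {hD : CStarTensor D D TD}
    (hDu : hD.tmul 1 1 = 1) (hK1 : K1Injective D) {φ : D ≃⋆ₐ[ℂ] TD}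
    (hφ : FinApproxEquiv φ (fun d => hD.tmul d 1))
    (hflip : FinApproxEquiv (fun d => hD.tmul d 1) (fun d => hD.tmul 1 d))
    {σ : TD ≃⋆ₐ[ℂ] TD} (hσ : ∀ a b, σ (hD.tmul a b) = hD.tmul b a)
    {A T : Type*} [NonUnitalCStarAlgebra A] [NonUnitalCStarAlgebra T]
    (hA : CStarTensor A D T) (θ : T →⋆ₙₐ[ℂ] L) (hL : CStarTensor L D LD) :
    ∃ k : Filter (LD ≃⋆ₐ[ℂ] LD), k.NeBot ∧
      (∀ t, Tendsto (fun γ : LD ≃⋆ₐ[ℂ] LD => γ (hL.tmul (θ t) 1)) k (𝓝 (hL.tmul (θ t) 1))) ∧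
      ∀ t d, ∀ ε > 0, ∀ᶠ γ in k, ∃ s ∈ Set.range fun l => hL.tmul l 1,
        ‖γ (hL.tmul (θ t) d) - s‖ < ε := by
  classical
  choose γ hγ using fun p : Finset (A × D × D) × ℕ =>
    exists_starAlgEquiv_absorbing hDu hK1 hφ hflip hσ hA θ hL p.1
      (Nat.one_div_pos_of_nat (α := ℝ) (n := p.2))
  have hev : ∀ r : A × D × D, ∀ ε > 0, ∀ᶠ p : Finset (A × D × D) × ℕ in atTop,
      r ∈ p.1 ∧ 1 / ((p.2 : ℝ) + 1) < ε := by
    intro r ε hε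
    obtain ⟨N, hN⟩ := exists_nat_one_div_lt hε
    filter_upwards [eventually_ge_atTop ({r}, N)] with p hp
    refine ⟨Finset.singleton_subset_iff.mp hp.1, lt_of_le_of_lt ?_ hN⟩
    have : (N : ℝ) ≤ p.2 := by exact_mod_cast hp.2
    gcongr
  have hcont : ∀ d, Continuous fun t => hL.tmul (θ t) d := fun d =>
    hL.continuous_tmul.comp ((continuous_starHom θ).prodMk continuous_const)

  refine ⟨map γ atTop, map_neBot, fun t => ?_, fun t d => ?_⟩
  · refine hA.induction ((isClosed_setOf_tendsto_apply (map γ atTop)).preimage (hcont 1))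
      (fun a d => Metric.tendsto_nhds.mpr fun ε hε => ?_) (fun x y hx hy => ?_) t
    · refine eventually_map.mpr ?_
      filter_upwards [hev (a, d, 0) ε hε] with p hp
      rw [dist_eq_norm]
      exact (hγ p _ hp.1).1.trans hp.2
    · simpa only [Set.mem_preimage, Set.mem_ofPred, map_add, hL.add_left] using Tendsto.add hx hy
  · refine hA.induction ((isClosed_setOf_eventually_near (map γ atTop) _).preimage (hcont d))
      (fun a d' ε hε => ?_) (fun x y hx hy ε hε => ?_) t
    · refine eventually_map.mpr ?_
      filter_upwards [hev (a, d', d) ε hε] with p hp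
      obtain ⟨l, hl⟩ := (hγ p _ hp.1).2
      exact ⟨_, ⟨l, rfl⟩, hl.trans hp.2⟩
    · filter_upwards [hx _ (half_pos hε), hy _ (half_pos hε)] with γ h h'
      obtain ⟨_, ⟨l, rfl⟩, hl⟩ := h
      obtain ⟨_, ⟨l', rfl⟩, hl'⟩ := h'
      refine ⟨_, ⟨l + l', rfl⟩, ?_⟩
      simp only [map_add, hL.add_left, add_sub_add_comm]
      exact (norm_add_le _ _).trans_lt (by linarith)

theorem exists_filter_absorbing_of_dense [Nontrivial D] {hD : CStarTensor D D TD}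
    (hDu : hD.tmul 1 1 = 1) (hK1 : K1Injective D) {φ : D ≃⋆ₐ[ℂ] TD}
    (hφ : FinApproxEquiv φ (fun d => hD.tmul d 1))
    (hflip : FinApproxEquiv (fun d => hD.tmul d 1) (fun d => hD.tmul 1 d))
    {σ : TD ≃⋆ₐ[ℂ] TD} (hσ : ∀ a b, σ (hD.tmul a b) = hD.tmul b a)
    {A T : ℕ → Type*} [∀ n, NonUnitalCStarAlgebra (A n)] [∀ n, NonUnitalCStarAlgebra (T n)]
    (hA : ∀ n, CStarTensor (A n) D (T n)) (θ : ∀ n, T n →⋆ₙₐ[ℂ] L)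
    (hmono : Monotone fun n => Set.range (θ n)) (hdense : Dense (⋃ n, Set.range (θ n)))
    (hL : CStarTensor L D LD) :
    ∃ k : Filter (LD ≃⋆ₐ[ℂ] LD), k.NeBot ∧
      (∀ l, Tendsto (fun γ : LD ≃⋆ₐ[ℂ] LD => γ (hL.tmul l 1)) k (𝓝 (hL.tmul l 1))) ∧
      ∀ z, ∀ ε > 0, ∀ᶠ γ in k, ∃ l, ‖γ z - hL.tmul l 1‖ < ε := by
  choose k hk h1 h2 using fun n =>
    exists_filter_absorbing hDu hK1 hφ hflip hσ (hA n) (θ n) hL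
  have hcont : ∀ d, Continuous fun l => hL.tmul l d := fun d =>
    hL.continuous_tmul.comp (continuous_id.prodMk continuous_const)
  have hrange : ∀ y ∈ ⋃ n, Set.range (θ n), ∀ᶠ n in atTop, ∃ t, θ n t = y := by
    intro y hy
    obtain ⟨n, hn⟩ := Set.mem_iUnion.mp hy
    filter_upwards [eventually_ge_atTop n] with m hm using hmono hm hn
  refine ⟨atTop.bind k, ⟨fun h => ?_⟩, fun l => ?_, fun z => ?_⟩
  · have h' : ∀ᶠ n in (atTop : Filter ℕ), ∀ᶠ _ in k n, False := by
      rw [← eventually_bind, h]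
      exact eventually_bot
    obtain ⟨n, hn⟩ := h'.exists
    exact (hk n).ne (eventually_false_iff_eq_bot.mp hn)
  · refine hdense.induction (fun y hy => ?_)
      ((isClosed_setOf_tendsto_apply (atTop.bind k)).preimage (hcont 1)) l
    refine Metric.tendsto_nhds.mpr fun ε hε => eventually_bind.mpr ?_
    filter_upwards [hrange y hy] with n ⟨t, ht⟩
    rw [← ht]
    exact Metric.tendsto_nhds.mp (h1 n t) ε hε
  · suffices h : ∀ ε > 0, ∀ᶠ γ in atTop.bind k, ∃ s ∈ Set.range fun l => hL.tmul l 1,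
        ‖γ z - s‖ < ε by simpa using h
    refine hL.induction (isClosed_setOf_eventually_near (atTop.bind k) _)
      (fun l d => ?_) (fun x y hx hy ε hε => ?_) z
    · refine hdense.induction (fun y hy ε hε => eventually_bind.mpr ?_)
        ((isClosed_setOf_eventually_near (atTop.bind k) _).preimage (hcont d)) l
      filter_upwards [hrange y hy] with n ⟨t, ht⟩
      rw [← ht]
      exact h2 n t d ε hε
    · filter_upwards [hx _ (half_pos hε), hy _ (half_pos hε)] with γ h h'
      obtain ⟨_, ⟨l, rfl⟩, hl⟩ := h
      obtain ⟨_, ⟨l', rfl⟩, hl'⟩ := h'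
      refine ⟨_, ⟨l + l', rfl⟩, ?_⟩
      simp only [map_add, hL.add_left, add_sub_add_comm]
      exact (norm_add_le _ _).trans_lt (by linarith)

end Globalization

theorem CStarTensor.separableSpace {A B T : Type*} [NonUnitalCStarAlgebra A]
    [NonUnitalCStarAlgebra B] [NonUnitalCStarAlgebra T] (h : CStarTensor A B T)
    [TopologicalSpace.SeparableSpace A] [TopologicalSpace.SeparableSpace B] :
    TopologicalSpace.SeparableSpace T := by
  rw [← TopologicalSpace.isSeparable_univ_iff, ← h.dense_span.closure_eq]
  refine (TopologicalSpace.IsSeparable.span ?_).closure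
  convert TopologicalSpace.isSeparable_range h.continuous_tmul
  ext t
  simp

theorem IsCStarInductiveLimit.separableSpace {A : ℕ → Type*} [∀ n, NonUnitalCStarAlgebra (A n)]
    [∀ n, TopologicalSpace.SeparableSpace (A n)] {f : ∀ n, A n →⋆ₙₐ[ℂ] A (n + 1)} {L : Type*}
    [NonUnitalCStarAlgebra L] (h : IsCStarInductiveLimit f L) :
    TopologicalSpace.SeparableSpace L := by
  rw [← TopologicalSpace.isSeparable_univ_iff, ← h.dense.closure_eq]
  exact (TopologicalSpace.IsSeparable.iUnion fun n =>
    TopologicalSpace.isSeparable_range (continuous_starHom (h.ι n))).closure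

theorem CStarTensor.subsingleton {A B T : Type*} [NonUnitalCStarAlgebra A]
    [NonUnitalCStarAlgebra B] [NonUnitalCStarAlgebra T] (h : CStarTensor A B T)
    [Subsingleton B] : Subsingleton T := by
  refine subsingleton_of_forall_eq 0 fun x => ?_
  refine h.induction (p := fun x => x = 0) isClosed_singleton (fun a b => ?_) ?_ x
  · rw [← norm_eq_zero, h.norm_tmul, Subsingleton.elim b 0, norm_zero, mul_zero]
  · rintro x y rfl rfl
    exact add_zero 0

/-- The *-homomorphism `a ↦ a ⊗ 1`. -/
def CStarTensor.inlOne {A B T : Type*} [NonUnitalCStarAlgebra A] [CStarAlgebra B]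
    [NonUnitalCStarAlgebra T] (h : CStarTensor A B T) : A →⋆ₙₐ[ℂ] T where
  toFun a := h.tmul a 1
  map_smul' c a := h.smul_left c a 1
  map_zero' := (h.bilin.flip 1).map_zero
  map_add' a a' := h.add_left a a' 1
  map_mul' a a' := by rw [h.mul_tmul, one_mul]
  map_star' a := by rw [h.star_tmul, star_one]

/-- `D`-stability passes to inductive limits: if `D` is separable, unital, strongly
self-absorbing and `K₁`-injective, and `L = lim→ Aᵢ` is the C*-inductive limit of a
sequence of separable `D`-stable C*-algebras, then `L` is `D`-stable. -/
theorem stmt_15 {D TD : Type u} [CStarAlgebra D] [CStarAlgebra TD]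
    [TopologicalSpace.SeparableSpace D]
    (hD : MinTensor D D TD) (hDu : hD.tmul 1 1 = 1)
    (hssa : IsStronglySelfAbsorbing hD) (hK1 : K1Injective D)
    -- a sequence of separable `D`-stable C*-algebras
    (A : ℕ → Type u) [∀ i, NonUnitalCStarAlgebra (A i)]
    [∀ i, TopologicalSpace.SeparableSpace (A i)]
    (T : ℕ → Type u) [∀ i, NonUnitalCStarAlgebra (T i)]
    (hT : ∀ i, MinTensor (A i) D (T i))
    (hstable : ∀ i, Nonempty (T i ≃⋆ₐ[ℂ] A i))
    -- `L` is the inductive limit of the system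
    (f : ∀ i, A i →⋆ₙₐ[ℂ] A (i + 1))
    (L : Type v) [NonUnitalCStarAlgebra L]
    (hL : IsCStarInductiveLimit f L) :
    -- then `L` is `D`-stable
    ∀ (LD : Type (max u v)) [NonUnitalCStarAlgebra LD],
      MinTensor L D LD → Nonempty (LD ≃⋆ₐ[ℂ] L) := by

  intro LD _ hLD
  rcases subsingleton_or_nontrivial D with _ | _
  · have hA : ∀ n, Subsingleton (A n) := fun n =>
      have := (hT n).toCStarTensor.subsingleton
      (hstable n).some.symm.injective.subsingleton
    have : Subsingleton LD := hLD.toCStarTensor.subsingleton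
    have : Subsingleton L := by
      refine subsingleton_of_forall_eq 0 fun x => ?_
      refine hL.dense.induction (P := fun x => x = 0) (fun y hy => ?_) isClosed_singleton x
      obtain ⟨n, a, rfl⟩ := Set.mem_iUnion.mp hy
      rw [Subsingleton.elim a 0, map_zero]
    exact ⟨StarAlgEquiv.ofBijective (0 : LD →⋆ₙₐ[ℂ] L)
      ⟨Function.injective_of_subsingleton _, fun y => ⟨0, Subsingleton.elim _ _⟩⟩⟩
  have hflip := IsStronglySelfAbsorbing.finApproxEquiv_fst_snd hD hDu hssa
  obtain ⟨σ, hσ⟩ := hD.exists_flip hDu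
  obtain ⟨-, φ, hφ⟩ := hssa
  have := hL.separableSpace
  have := hLD.toCStarTensor.separableSpace
  let e := fun n => (hstable n).some
  let θ : ∀ n, T n →⋆ₙₐ[ℂ] L := fun n => (hL.ι n).comp (e n : T n →⋆ₙₐ[ℂ] A n)
  have hθ : ∀ n, Set.range (θ n) = Set.range (hL.ι n) := fun n =>
    (e n).surjective.range_comp (hL.ι n)
  obtain ⟨k, hk, h1, h2⟩ := exists_filter_absorbing_of_dense hDu hK1 hφ.finApproxEquiv hflip hσ
    (fun n => (hT n).toCStarTensor) θ
    (by
      refine monotone_nat_of_le_succ fun n => ?_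
      rw [hθ, hθ]
      rintro _ ⟨x, rfl⟩
      exact ⟨f n x, hL.compat n x⟩)
    (by simpa only [hθ] using hL.dense) hLD.toCStarTensor
  obtain ⟨E⟩ := exists_starAlgEquiv_of_filter hLD.toCStarTensor.inlOne
    (fun x => by
      change ‖hLD.tmul x 1‖ = _
      rw [hLD.norm_tmul, CStarRing.norm_one, mul_one]) k h1 h2
  exact ⟨E.symm⟩
end
end
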